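/- arXiv:2108.02227 — 2 statements merged into one kernel-verified Lean document; each statement's English description precedes it below -/
import Mathlib

section
/- Let c = 1 − (1 + log log 2)/(log 2) and ε > 0. Then for Lebesgue-almost all α > 0 there exists N₀(α) such that for all N ≥ N₀(α) one has δ_min^{(α)}(N) > (log N)^{2c} (log₂ N)^{2−c−ε} / (3 N log N). -/
open MeasureTheory Filter

/-- `log x`, read as `max {1, log x}`. -/
noncomputable def L (x : ℝ) : ℝ := max 1 (Real.log x)

/-- `log₂ x = log log x`, with the `max {1, ·}` convention. -/
noncomputable def LL (x : ℝ) : ℝ := L (L x)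

/-- `lam` enumerates, in increasing order (for indices `k ≥ 1`), the spectrum
`{α m² + n² : m, n ≥ 1}` of the rectangular billiard. -/
def IsSpectrumEnum (α : ℝ) (lam : ℕ → ℝ) : Prop :=
  (∀ j k : ℕ, 1 ≤ j → j < k → lam j < lam k) ∧ 0 < lam 1 ∧
    {x : ℝ | ∃ k : ℕ, 1 ≤ k ∧ lam k = x} =
      {x : ℝ | ∃ m n : ℕ, 1 ≤ m ∧ 1 ≤ n ∧ x = α * (m : ℝ) ^ 2 + (n : ℝ) ^ 2}

/-- `δ_min^{(α)}(N) = min {λ_{k+1} − λ_k : 1 ≤ k ≤ N}`. -/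
noncomputable def bDeltaMin (lam : ℕ → ℝ) (N : ℕ) : ℝ :=
  sInf {x : ℝ | ∃ k : ℕ, 1 ≤ k ∧ k ≤ N ∧ x = lam (k + 1) - lam k}

/-- The constant from the Erdős multiplication table problem. -/
noncomputable def erdosC : ℝ := 1 - (1 + Real.log (Real.log 2)) / Real.log 2

section
open scoped Nat

/-- `hitWeight m r / e ^ m` is the probability that a walk with steps `Poisson(1) - 1`
started at height `r` first reaches `0` at time `m`. -/
noncomputable def hitWeight (m r : ℕ) : ℝ :=
  if r ≤ m then (r : ℝ) / m * ((m : ℝ) ^ (m - r) / (m - r)!) else 0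

theorem hitWeight_nonneg (m r : ℕ) : 0 ≤ hitWeight m r := by
  unfold hitWeight
  split_ifs <;> positivity

theorem sum_choose_mul_linear (s : ℕ) (a m : ℝ) :
    (m + 1) * ∑ x ∈ Finset.range (s + 1), (s.choose x : ℝ) * (a + x) * m ^ (s - x)
      = (a * (m + 1) + s) * (m + 1) ^ s := by
  have h1 : ∑ x ∈ Finset.range (s + 1), (s.choose x : ℝ) * m ^ (s - x) = (m + 1) ^ s := by
    rw [add_comm m 1, add_pow]
    exact Finset.sum_congr rfl fun x _ => by ring
  have h2 : (m + 1) * ∑ x ∈ Finset.range (s + 1), (s.choose x : ℝ) * x * m ^ (s - x)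
      = s * (m + 1) ^ s := by
    cases s with
    | zero => simp
    | succ s =>
      rw [Finset.sum_range_succ']
      have : ∀ x ∈ Finset.range (s + 1),
          (((s + 1).choose (x + 1) : ℕ) : ℝ) * ((x + 1 : ℕ) : ℝ) * m ^ (s + 1 - (x + 1))
            = (s + 1 : ℝ) * ((s.choose x : ℝ) * m ^ (s - x)) := by
        intro x _
        have := Nat.add_one_mul_choose_eq s x
        have h' : ((s + 1 : ℝ)) * (s.choose x : ℝ)
            = ((s + 1).choose (x + 1) : ℝ) * ((x : ℝ) + 1) := by exact_mod_cast this
        rw [Nat.add_sub_add_right, ← mul_assoc, h']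
        push_cast
        ring
      rw [Finset.sum_congr rfl this, ← Finset.mul_sum]
      have h3 : ∑ x ∈ Finset.range (s + 1), (s.choose x : ℝ) * m ^ (s - x) = (m + 1) ^ s := by
        rw [add_comm m 1, add_pow]
        exact Finset.sum_congr rfl fun x _ => by ring
      rw [h3]
      push_cast
      ring
  have : ∑ x ∈ Finset.range (s + 1), (s.choose x : ℝ) * (a + x) * m ^ (s - x)
      = a * (∑ x ∈ Finset.range (s + 1), (s.choose x : ℝ) * m ^ (s - x))
        + ∑ x ∈ Finset.range (s + 1), (s.choose x : ℝ) * x * m ^ (s - x) := by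
    rw [Finset.mul_sum, ← Finset.sum_add_distrib]
    exact Finset.sum_congr rfl fun x _ => by ring
  rw [this, mul_add, h2, h1]
  ring

theorem hitWeight_succ (a s : ℕ) (hm : 0 < a + s) :
    hitWeight (a + s + 1) (a + 1)
      = ∑ x ∈ Finset.range (s + 1), hitWeight (a + s) (a + x) / x ! := by
  have hm' : (0 : ℝ) < (a : ℝ) + s := by exact_mod_cast hm
  have key := sum_choose_mul_linear s a (a + s)
  have e1 : ∀ x ∈ Finset.range (s + 1), hitWeight (a + s) (a + x) / x !
      = ((s.choose x : ℝ) * (a + x) * ((a : ℝ) + s) ^ (s - x)) / (((a : ℝ) + s) * s !) := by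
    intro x hx
    have hx' : x ≤ s := by simpa [Nat.lt_succ_iff] using hx
    have hc : (s.choose x : ℝ) * x ! * (s - x)! = s ! := by
      exact_mod_cast Nat.choose_mul_factorial_mul_factorial hx'
    have hxs : a + s - (a + x) = s - x := by omega
    unfold hitWeight
    rw [if_pos (by omega), hxs, ← hc]
    have := (s.choose_pos hx').ne'
    push_cast
    field_simp
  rw [Finset.sum_congr rfl e1, ← Finset.sum_div]
  unfold hitWeight
  rw [if_pos (by omega), show a + s + 1 - (a + 1) = s by omega]
  have hs : (0 : ℝ) < s ! := by positivity
  have h1 : (0 : ℝ) < (a : ℝ) + s + 1 := by linarith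
  push_cast
  rw [div_mul_div_comm, div_eq_div_iff (by positivity) (by positivity)]
  have : ((a : ℝ) * (a + s + 1) + s) = (a + s) * (a + 1) := by ring
  rw [this] at key
  linear_combination (-(s ! : ℝ)) * key

theorem sum_hitWeight_div_factorial_le {m a : ℕ} (hm : 0 < m) (X : ℕ) :
    ∑ x ∈ Finset.range X, hitWeight m (a + x) / x ! ≤ hitWeight (m + 1) (a + 1) := by
  by_cases h : a ≤ m
  · obtain ⟨s, rfl⟩ := Nat.exists_eq_add_of_le h
    rw [hitWeight_succ a s hm]
    have hz : ∀ x, s + 1 ≤ x → hitWeight (a + s) (a + x) / x ! = 0 := by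
      intro x hx
      simp [hitWeight, show ¬ (a + x ≤ a + s) by omega]
    calc _ ≤ ∑ x ∈ Finset.range (max X (s + 1)), hitWeight (a + s) (a + x) / x ! :=
          Finset.sum_le_sum_of_subset_of_nonneg
            (Finset.range_subset_range.2 (le_max_left _ _))
            fun x _ _ => div_nonneg (hitWeight_nonneg _ _) (by positivity)
      _ = _ := (Finset.sum_subset (Finset.range_subset_range.2 (le_max_right _ _))
            fun x _ hx => hz x (by simpa using hx)).symm
  · refine (Finset.sum_eq_zero fun x _ => ?_).le.trans (hitWeight_nonneg _ _)
    simp [hitWeight, show ¬ (a + x ≤ m) by omega]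

theorem pow_div_factorial_le_exp_div_sqrt {m l : ℕ} (hm : 0 < m) (hl : l ≤ m) :
    (m : ℝ) ^ l / l ! ≤ Real.exp m / √m := by
  have h1 : (m ! : ℝ) ≤ l ! * (m : ℝ) ^ (m - l) := by
    have h := Nat.factorial_mul_descFactorial (Nat.sub_le m l)
    rw [Nat.sub_sub_self hl] at h
    rw [← h]
    push_cast
    gcongr
    exact_mod_cast Nat.descFactorial_le_pow m (m - l)
  have h2 := Stirling.le_factorial_stirling m
  have hm' : (0 : ℝ) < m := by exact_mod_cast hm
  have h3 : √m * (m / Real.exp 1) ^ m ≤ (m ! : ℝ) := by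
    refine le_trans ?_ h2
    gcongr
    nlinarith [Real.pi_gt_three]
  rw [div_le_div_iff₀ (by positivity) (by positivity)]
  have h4 : √m * (m : ℝ) ^ m ≤ (m ! : ℝ) * Real.exp m := by
    rw [div_pow, ← Real.exp_nat_mul, mul_one, mul_div_assoc', div_le_iff₀ (Real.exp_pos _)] at h3
    exact h3
  have h5 : (m : ℝ) ^ m = (m : ℝ) ^ l * (m : ℝ) ^ (m - l) := by
    rw [← pow_add, Nat.add_sub_cancel' hl]
  have h6 : (m : ℝ) ^ l * √m * (m : ℝ) ^ (m - l) ≤ Real.exp m * l ! * (m : ℝ) ^ (m - l) := by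
    calc _ = √m * (m : ℝ) ^ m := by rw [h5]; ring
      _ ≤ (m ! : ℝ) * Real.exp m := h4
      _ ≤ (l ! * (m : ℝ) ^ (m - l)) * Real.exp m := by gcongr
      _ = _ := by ring
  exact le_of_mul_le_mul_right h6 (by positivity)

theorem hitWeight_le {m : ℕ} (hm : 0 < m) (h : ℕ) :
    hitWeight m h ≤ h / m * (Real.exp m / √m) := by
  unfold hitWeight
  split_ifs
  · exact mul_le_mul_of_nonneg_left
      (pow_div_factorial_le_exp_div_sqrt hm (Nat.sub_le _ _)) (by positivity)
  · positivity

theorem factorial_mul_exp_le {n : ℕ} (hn : 1 ≤ n) :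
    (n ! : ℝ) * Real.exp n ≤ Real.exp 1 * n * (n : ℝ) ^ n := by
  induction n, hn using Nat.le_induction with
  | base => simp
  | succ n hn ih =>
    have hn' : (0 : ℝ) < n := by exact_mod_cast hn
    have h1 : Real.exp 1 ≤ (((n : ℝ) + 1) / n) ^ (n + 1) := by
      have h2 : 1 ≤ ((n + 1 : ℕ) : ℝ) * Real.log (((n : ℝ) + 1) / n) := by
        have := Real.one_sub_inv_le_log_of_pos (x := ((n : ℝ) + 1) / n) (by positivity)
        have h3 : 1 - (((n : ℝ) + 1) / n)⁻¹ = 1 / ((n : ℝ) + 1) := by field_simp; ring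
        rw [h3, div_le_iff₀ (by positivity)] at this
        push_cast
        linarith
      calc Real.exp 1 ≤ Real.exp (((n + 1 : ℕ) : ℝ) * Real.log (((n : ℝ) + 1) / n)) :=
            Real.exp_le_exp.2 h2
        _ = _ := by rw [Real.exp_nat_mul, Real.exp_log (by positivity)]
    rw [div_pow, le_div_iff₀ (by positivity)] at h1
    rw [Nat.factorial_succ]
    push_cast
    rw [Real.exp_add]
    calc ((n : ℝ) + 1) * n ! * (Real.exp n * Real.exp 1)
        = ((n : ℝ) + 1) * Real.exp 1 * (n ! * Real.exp n) := by ring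
      _ ≤ ((n : ℝ) + 1) * Real.exp 1 * (Real.exp 1 * n * (n : ℝ) ^ n) := by gcongr
      _ = Real.exp 1 * ((n : ℝ) + 1) * (Real.exp 1 * (n : ℝ) ^ (n + 1)) := by ring
      _ ≤ _ := by gcongr

theorem le_hitWeight {v : ℕ} (hv : 1 ≤ v) :
    Real.exp (2 * v ^ 2 : ℕ) / (24 * (v : ℝ) ^ 3) ≤ hitWeight (2 * v ^ 2) v := by
  have hv' : (1 : ℝ) ≤ v := by exact_mod_cast hv
  have hvr : v ≤ 2 * v ^ 2 := by nlinarith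
  set r := 2 * v ^ 2 with hr
  have hrr : (r : ℝ) = 2 * (v : ℝ) ^ 2 := by rw [hr]; push_cast; ring
  have hr0 : (0 : ℝ) < r := by rw [hrr]; positivity
  have h1 : (r : ℝ) ^ r / 2 ≤ (r : ℝ) ^ (r - v) * ((r : ℝ) - v) ^ v := by
    have hb : 1 + (v : ℝ) * (-(v / r)) ≤ (1 + -(v / r : ℝ)) ^ v := by
      apply one_add_mul_le_pow
      rw [hrr]
      have : (v : ℝ) / (2 * v ^ 2) ≤ 1 := by
        rw [div_le_one (by positivity)]; nlinarith
      linarith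
    have hc : (v : ℝ) * (-(v / r)) = -(1 / 2) := by rw [hrr]; field_simp
    have hd : ((r : ℝ) - v) ^ v = (r : ℝ) ^ v * (1 + -(v / r : ℝ)) ^ v := by
      rw [← mul_pow]; congr 1; field_simp; ring
    rw [hd, ← mul_assoc, ← pow_add, Nat.sub_add_cancel hvr]
    rw [hc] at hb
    calc (r : ℝ) ^ r / 2 = (r : ℝ) ^ r * (1 / 2) := by ring
      _ ≤ _ := by gcongr; linarith
  have h2 : ((r : ℝ) - v) ^ v * ((r - v)! : ℝ) ≤ (r ! : ℝ) := by
    have h := Nat.factorial_mul_descFactorial hvr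
    have h' := Nat.pow_sub_le_descFactorial r v
    rw [← h]
    push_cast
    rw [mul_comm]
    gcongr
    calc ((r : ℝ) - v) ^ v ≤ ((r + 1 - v : ℕ) : ℝ) ^ v := by
          have : v ≤ r + 1 := by omega
          rw [Nat.cast_sub this]
          push_cast
          have : (v : ℝ) ≤ r := by exact_mod_cast hvr
          gcongr; linarith
      _ ≤ _ := by exact_mod_cast h'
  have h3 := factorial_mul_exp_le (n := r) (by omega)
  have he : Real.exp 1 < 3 := by linarith [Real.exp_one_lt_d9]
  unfold hitWeight
  rw [if_pos hvr, div_mul_div_comm, div_le_div_iff₀ (by positivity) (by positivity)]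
  have hf : (0 : ℝ) < ((r - v)! : ℝ) := by positivity
  have hrv : (0 : ℝ) ≤ (r : ℝ) - v := by
    have : (v : ℝ) ≤ r := by exact_mod_cast hvr
    linarith
  rcases hrv.eq_or_lt with h0 | hpos
  · exfalso
    rw [hrr] at h0
    nlinarith
  have h4 : Real.exp r * ((r - v)! : ℝ) * ((r : ℝ) - v) ^ v
      ≤ 6 * r * (r : ℝ) ^ (r - v) * ((r : ℝ) - v) ^ v := by
    calc _ ≤ Real.exp r * (r ! : ℝ) := by
          rw [mul_assoc, mul_comm ((r - v)! : ℝ)]; gcongr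
      _ ≤ Real.exp 1 * r * (r : ℝ) ^ r := by rw [mul_comm]; exact h3
      _ ≤ 3 * r * (2 * ((r : ℝ) ^ (r - v) * ((r : ℝ) - v) ^ v)) := by
          gcongr
          linarith
      _ = _ := by ring
  have h5 := le_of_mul_le_mul_right h4 (by positivity)
  calc Real.exp r * (r * ((r - v)! : ℝ)) = r * (Real.exp r * ((r - v)! : ℝ)) := by ring
    _ ≤ r * (6 * r * (r : ℝ) ^ (r - v)) := by gcongr
    _ = v * (r : ℝ) ^ (r - v) * (24 * (v : ℝ) ^ 3) := by rw [hrr]; ring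

theorem sum_le_sum_of_injOn {ι κ : Type*} {s : Finset ι} {t : Finset κ} {f : ι → ℝ} {g : κ → ℝ}
    (i : ι → κ) (hi : ∀ a ∈ s, i a ∈ t) (hinj : Set.InjOn i s)
    (hfg : ∀ a ∈ s, f a ≤ g (i a)) (hg : ∀ b ∈ t, 0 ≤ g b) :
    ∑ a ∈ s, f a ≤ ∑ b ∈ t, g b := by
  classical
  calc _ ≤ ∑ a ∈ s, g (i a) := Finset.sum_le_sum hfg
    _ = ∑ b ∈ s.image i, g b := (Finset.sum_image hinj).symm
    _ ≤ _ := Finset.sum_le_sum_of_subset_of_nonneg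
      (Finset.image_subset_iff.2 hi) fun b hb _ => hg b hb

/-- The `k`-th elementary symmetric sum of `w` over a finset is at most `(∑ w) ^ k / k!`. -/
theorem sum_powersetCard_prod_le (C : Finset ℕ) (w : ℕ → ℝ) (hw : ∀ p, 0 ≤ w p) (k : ℕ) :
    ∑ s ∈ C.powersetCard k, ∏ p ∈ s, w p ≤ (∑ p ∈ C, w p) ^ k / k ! := by
  induction C using Finset.induction_on generalizing k with
  | empty =>
    cases k with
    | zero => simp
    | succ k => simp [Finset.powersetCard_eq_empty.2 (Finset.card_empty ▸ Nat.succ_pos k)]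
  | insert a C ha ih =>
    cases k with
    | zero => simp
    | succ k =>
      have hC : 0 ≤ ∑ p ∈ C, w p := Finset.sum_nonneg fun p _ => hw p
      rw [Finset.powersetCard_succ_insert ha, Finset.sum_union, Finset.sum_image,
        Finset.sum_insert ha]
      · have h1 : ∀ s ∈ C.powersetCard k, ∏ p ∈ insert a s, w p = w a * ∏ p ∈ s, w p := by
          intro s hs
          exact Finset.prod_insert fun h => ha ((Finset.mem_powersetCard.1 hs).1 h)
        rw [Finset.sum_congr rfl h1, ← Finset.mul_sum]
        set σ := ∑ p ∈ C, w p
        calc _ ≤ σ ^ (k + 1) / (k + 1)! + w a * (σ ^ k / k !) := by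
              gcongr
              · exact ih _
              · exact hw a
              · exact ih _
          _ = (σ ^ (k + 1) + (k + 1) * w a * σ ^ k) / (k + 1)! := by
              rw [Nat.factorial_succ]; push_cast; field_simp
          _ ≤ _ := by
              gcongr
              have h2 := pow_add_mul_le_add_pow (a := σ) (b := w a) hC (by linarith [hw a]) (k + 1)
              have h3 : σ ^ (k + 1) + (k + 1) * w a * σ ^ k ≤ (σ + w a) ^ (k + 1) := by
                refine le_trans (le_of_eq ?_) h2
                push_cast
                simp
                ring
              linarith [add_comm σ (w a) ▸ h3]
      · intro s hs t ht hst
        have hs' : a ∉ s := fun h => ha ((Finset.mem_powersetCard.1 hs).1 h)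
        have ht' : a ∉ t := fun h => ha ((Finset.mem_powersetCard.1 ht).1 h)
        rw [← Finset.erase_insert hs', ← Finset.erase_insert ht', hst]
      · rw [Finset.disjoint_left]
        intro s hs hs'
        obtain ⟨t, _, rfl⟩ := Finset.mem_image.1 hs'
        exact ha ((Finset.mem_powersetCard.1 hs).1 (Finset.mem_insert_self _ _))

open Classical in
/-- The subsets of `P t` with `k` elements, at most `i + u` of which lie in `P i` (`i ≤ t`). -/
noncomputable def barrierSets (P : ℕ → Finset ℕ) (u t k : ℕ) : Finset (Finset ℕ) :=
  (P t).powerset.filter fun s => s.card = k ∧ ∀ i ≤ t, (s ∩ P i).card ≤ i + u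

theorem mem_barrierSets {P : ℕ → Finset ℕ} {u t k : ℕ} {s : Finset ℕ} :
    s ∈ barrierSets P u t k ↔ s ⊆ P t ∧ s.card = k ∧ ∀ i ≤ t, (s ∩ P i).card ≤ i + u := by
  simp [barrierSets]

theorem sum_barrierSets_succ_le {P : ℕ → Finset ℕ} {w : ℕ → ℝ}
    (hw : ∀ p, 0 ≤ w p) {lam : ℝ}
    (hc : ∀ t, ∑ p ∈ P (t + 1) \ P t, w p ≤ lam) (u t k : ℕ) :
    ∑ s ∈ barrierSets P u (t + 1) k, ∏ p ∈ s, w p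
      ≤ ∑ x ∈ Finset.range (k + 1),
          (∑ s ∈ barrierSets P u t (k - x), ∏ p ∈ s, w p) * (lam ^ x / x !) := by
  have h1 : ∑ s ∈ barrierSets P u (t + 1) k, ∏ p ∈ s, w p
      ≤ ∑ z ∈ (Finset.range (k + 1)).sigma fun x =>
          barrierSets P u t (k - x) ×ˢ (P (t + 1) \ P t).powersetCard x,
          (∏ p ∈ z.2.1, w p) * ∏ p ∈ z.2.2, w p := by
    refine sum_le_sum_of_injOn (fun s => ⟨(s \ P t).card, (s ∩ P t, s \ P t)⟩)
      ?_ ?_ ?_ ?_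
    · intro s hs
      rw [mem_barrierSets] at hs
      obtain ⟨h1, h2, h3⟩ := hs
      have hcard := Finset.card_sdiff_add_card_inter s (P t)
      simp only [Finset.mem_sigma, Finset.mem_range, Finset.mem_product, mem_barrierSets,
        Finset.mem_powersetCard, and_true]
      refine ⟨by omega, ⟨Finset.inter_subset_right, by omega, fun i hi => ?_⟩,
        Finset.sdiff_subset_sdiff h1 le_rfl⟩
      refine le_trans (Finset.card_le_card ?_) (h3 i (by omega))
      exact Finset.inter_subset_inter_right Finset.inter_subset_left
    · intro s _ s' _ h
      simp only [Sigma.mk.injEq, heq_eq_eq, Prod.mk.injEq] at h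
      rw [← Finset.sdiff_union_inter s (P t), h.2.1, h.2.2, Finset.sdiff_union_inter]
    · intro s _
      rw [mul_comm, ← Finset.prod_union (Finset.disjoint_sdiff_inter s (P t)),
        Finset.sdiff_union_inter]
    · intro z _
      exact mul_nonneg (Finset.prod_nonneg fun p _ => hw p) (Finset.prod_nonneg fun p _ => hw p)
  refine h1.trans ?_
  rw [Finset.sum_sigma]
  refine Finset.sum_le_sum fun x _ => ?_
  rw [Finset.sum_product]
  simp_rw [← Finset.mul_sum, ← Finset.sum_mul]
  refine mul_le_mul_of_nonneg_left ?_
    (Finset.sum_nonneg fun s _ => Finset.prod_nonneg fun p _ => hw p)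
  refine (sum_powersetCard_prod_le _ w hw x).trans ?_
  gcongr
  · exact Finset.sum_nonneg fun p _ => hw p
  · exact hc t

theorem sum_barrierSets_mul_hitWeight_le {P : ℕ → Finset ℕ} (hP0 : P 0 = ∅)
    {w : ℕ → ℝ} (hw : ∀ p, 0 ≤ w p) {lam : ℝ} (hl : 0 ≤ lam)
    (hc : ∀ t, ∑ p ∈ P (t + 1) \ P t, w p ≤ lam) {u r : ℕ} (hr : 0 < r) (t k : ℕ)
    (hk : k ≤ t + u) :
    (∑ s ∈ barrierSets P u t k, ∏ p ∈ s, w p) * hitWeight r (u + 1)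
      ≤ lam ^ k * hitWeight (r + t) (t + u - k + 1) := by
  induction t generalizing k with
  | zero =>
    rcases Nat.eq_zero_or_pos k with rfl | hk0
    · have : barrierSets P u 0 0 = {∅} := by
        ext s
        simp only [mem_barrierSets, Finset.mem_singleton, hP0]
        constructor
        · rintro ⟨h, -⟩; exact Finset.subset_empty.1 h
        · rintro rfl; simp
      simp [this]
    · have : barrierSets P u 0 k = ∅ := by
        rw [Finset.eq_empty_iff_forall_notMem]
        intro s hs
        rw [mem_barrierSets, hP0] at hs
        have := Finset.subset_empty.1 hs.1
        subst this
        simp at hs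
        omega
      rw [this]
      simp only [Finset.sum_empty, zero_mul]
      exact mul_nonneg (pow_nonneg hl _) (hitWeight_nonneg _ _)
  | succ t ih =>
    have hstep : ∀ x ∈ Finset.range (k + 1),
        (∑ s ∈ barrierSets P u t (k - x), ∏ p ∈ s, w p) * (lam ^ x / x !) * hitWeight r (u + 1)
          ≤ lam ^ k * (hitWeight (r + t) (t + 1 + u - k + x) / x !) := by
      intro x hx
      have hxk : x ≤ k := by simpa [Nat.lt_succ_iff] using hx
      by_cases h : k - x ≤ t + u
      · have := ih (k - x) h
        calc _ = ((∑ s ∈ barrierSets P u t (k - x), ∏ p ∈ s, w p) * hitWeight r (u + 1))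
              * (lam ^ x / x !) := by ring
          _ ≤ (lam ^ (k - x) * hitWeight (r + t) (t + u - (k - x) + 1)) * (lam ^ x / x !) := by
              gcongr
          _ = lam ^ (k - x + x) * (hitWeight (r + t) (t + u - (k - x) + 1) / x !) := by
              rw [pow_add]; ring
          _ = _ := by
              rw [Nat.sub_add_cancel hxk,
                show t + u - (k - x) + 1 = t + 1 + u - k + x by omega]
      · have : barrierSets P u t (k - x) = ∅ := by
          rw [Finset.eq_empty_iff_forall_notMem]
          intro s hs
          rw [mem_barrierSets] at hs
          have h2 := hs.2.2 t le_rfl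
          rw [Finset.inter_eq_left.2 hs.1, hs.2.1] at h2
          exact h h2
        rw [this]
        simp only [Finset.sum_empty, zero_mul]
        exact mul_nonneg (pow_nonneg hl _) (div_nonneg (hitWeight_nonneg _ _) (by positivity))
    calc _ ≤ (∑ x ∈ Finset.range (k + 1),
          (∑ s ∈ barrierSets P u t (k - x), ∏ p ∈ s, w p) * (lam ^ x / x !))
            * hitWeight r (u + 1) :=
          mul_le_mul_of_nonneg_right (sum_barrierSets_succ_le hw hc u t k)
            (hitWeight_nonneg _ _)
      _ ≤ ∑ x ∈ Finset.range (k + 1),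
          lam ^ k * (hitWeight (r + t) (t + 1 + u - k + x) / x !) := by
          rw [Finset.sum_mul]; exact Finset.sum_le_sum hstep
      _ ≤ _ := by
          rw [← Finset.mul_sum]
          exact mul_le_mul_of_nonneg_left
            (sum_hitWeight_div_factorial_le (by omega) _) (pow_nonneg hl _)

theorem sum_barrierSets_le {P : ℕ → Finset ℕ} (hP0 : P 0 = ∅)
    {w : ℕ → ℝ} (hw : ∀ p, 0 ≤ w p) {lam : ℝ} (hl : 0 ≤ lam)
    (hc : ∀ t, ∑ p ∈ P (t + 1) \ P t, w p ≤ lam) {u n k : ℕ} (hn : 0 < n)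
    (hk : k ≤ n + u) :
    ∑ s ∈ barrierSets P u n k, ∏ p ∈ s, w p
      ≤ lam ^ k * (n + u - k + 1 : ℕ) * (24 * (u + 1 : ℝ) ^ 3) * (Real.exp n / (n * √n)) := by
  set r := 2 * (u + 1) ^ 2 with hr
  have hr0 : 0 < r := by positivity
  have h1 := sum_barrierSets_mul_hitWeight_le hP0 hw hl hc hr0 n k hk
  have h2 := le_hitWeight (v := u + 1) (by omega)
  rw [← hr] at h2
  have h3 := hitWeight_le (m := r + n) (by omega) (n + u - k + 1)
  have hn' : (0 : ℝ) < n := by exact_mod_cast hn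
  set S := ∑ s ∈ barrierSets P u n k, ∏ p ∈ s, w p
  have hS : 0 ≤ S := Finset.sum_nonneg fun s _ => Finset.prod_nonneg fun p _ => hw p
  have h4 : S * (Real.exp r / (24 * ((u + 1 : ℕ) : ℝ) ^ 3))
      ≤ lam ^ k * (((n + u - k + 1 : ℕ) : ℝ) / n * (Real.exp (r + n) / √n)) := by
    calc _ ≤ S * hitWeight r (u + 1) := by gcongr
      _ ≤ lam ^ k * hitWeight (r + n) (n + u - k + 1) := h1
      _ ≤ lam ^ k * (((n + u - k + 1 : ℕ) : ℝ) / (r + n : ℕ)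
            * (Real.exp (r + n : ℕ) / √(r + n : ℕ))) := by gcongr
      _ ≤ _ := by
          push_cast
          gcongr <;> linarith [(Nat.cast_nonneg r : (0 : ℝ) ≤ r)]
  rw [Real.exp_add] at h4
  have he := Real.exp_pos (r : ℝ)
  push_cast at h4 ⊢
  rw [mul_div_assoc', div_le_iff₀ (by positivity)] at h4
  refine le_of_mul_le_mul_right (h4.trans (le_of_eq ?_)) he
  field_simp

end

/-- The set of dyadic scales occupied by the divisors of `m`. -/
def divisorScales (m : ℕ) : Finset ℕ := m.divisors.image (Nat.log 2)

theorem card_divisorScales_le_card_divisors (m : ℕ) :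
    (divisorScales m).card ≤ m.divisors.card := Finset.card_image_le

theorem card_divisorScales_le_log (m : ℕ) : (divisorScales m).card ≤ Nat.log 2 m + 1 := by
  refine (Finset.card_le_card (t := Finset.range (Nat.log 2 m + 1)) fun i hi => ?_).trans
    (Finset.card_range _).le
  obtain ⟨d, hd, rfl⟩ := Finset.mem_image.1 hi
  rw [Finset.mem_range, Nat.lt_succ_iff]
  exact Nat.log_mono_right (Nat.divisor_le hd)

theorem log_two_mul {a b : ℕ} (ha : a ≠ 0) (hb : b ≠ 0) :
    Nat.log 2 (a * b) = Nat.log 2 a + Nat.log 2 b ∨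
      Nat.log 2 (a * b) = Nat.log 2 a + Nat.log 2 b + 1 := by
  have h1 : Nat.log 2 a + Nat.log 2 b ≤ Nat.log 2 (a * b) := by
    rw [Nat.le_log_iff_pow_le one_lt_two (mul_ne_zero ha hb), pow_add]
    exact Nat.mul_le_mul (Nat.pow_log_le_self 2 ha) (Nat.pow_log_le_self 2 hb)
  have h2 : Nat.log 2 (a * b) < Nat.log 2 a + Nat.log 2 b + 2 := by
    rw [Nat.log_lt_iff_lt_pow one_lt_two (mul_ne_zero ha hb)]
    calc a * b < 2 ^ (Nat.log 2 a + 1) * 2 ^ (Nat.log 2 b + 1) :=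
          Nat.mul_lt_mul'' (Nat.lt_pow_succ_log_self one_lt_two a)
            (Nat.lt_pow_succ_log_self one_lt_two b)
      _ = _ := by ring
  omega

theorem card_divisorScales_mul_le {a b : ℕ} (ha : a ≠ 0) (hb : b ≠ 0) :
    (divisorScales (a * b)).card ≤ 2 * (divisorScales a).card * (divisorScales b).card := by
  have hsub : divisorScales (a * b) ⊆
      (Finset.range 2 ×ˢ (divisorScales a ×ˢ divisorScales b)).image
        fun z => z.2.1 + z.2.2 + z.1 := by
    intro i hi
    obtain ⟨d, hd, rfl⟩ := Finset.mem_image.1 hi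
    obtain ⟨d₁, d₂, h₁, h₂, rfl⟩ := exists_dvd_and_dvd_of_dvd_mul (Nat.dvd_of_mem_divisors hd)
    have e₁ : Nat.log 2 d₁ ∈ divisorScales a :=
      Finset.mem_image_of_mem _ (Nat.mem_divisors.2 ⟨h₁, ha⟩)
    have e₂ : Nat.log 2 d₂ ∈ divisorScales b :=
      Finset.mem_image_of_mem _ (Nat.mem_divisors.2 ⟨h₂, hb⟩)
    rw [Finset.mem_image]
    rcases log_two_mul (ne_zero_of_dvd_ne_zero ha h₁) (ne_zero_of_dvd_ne_zero hb h₂) with h | h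
    · exact ⟨(0, Nat.log 2 d₁, Nat.log 2 d₂), by simp [e₁, e₂], by simp [h]⟩
    · exact ⟨(1, Nat.log 2 d₁, Nat.log 2 d₂), by simp [e₁, e₂], by simp [h]⟩
  refine (Finset.card_le_card hsub).trans (Finset.card_image_le.trans (le_of_eq ?_))
  rw [Finset.card_product, Finset.card_product, Finset.card_range, mul_assoc]

theorem prod_primes_ne_zero {s : Finset ℕ} (hs : ∀ p ∈ s, p.Prime) : ∏ p ∈ s, p ≠ 0 :=
  Finset.prod_ne_zero_iff.2 fun p hp => (hs p hp).ne_zero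

theorem card_divisors_prod_primes_le {s : Finset ℕ} (hs : ∀ p ∈ s, p.Prime) :
    (∏ p ∈ s, p).divisors.card ≤ 2 ^ s.card := by
  induction s using Finset.induction_on with
  | empty => simp
  | insert a s ha ih =>
    rw [Finset.prod_insert ha, Finset.card_insert_of_notMem ha, Nat.divisors_mul, pow_succ']
    refine Finset.card_mul_le.trans (Nat.mul_le_mul ?_ (ih fun p hp => hs p (by simp [hp])))
    rw [(hs a (by simp)).divisors]
    exact Finset.card_le_two

theorem card_divisorScales_prod_primes_le {s : Finset ℕ} (hs : ∀ p ∈ s, p.Prime) :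
    (divisorScales (∏ p ∈ s, p)).card ≤ 2 ^ s.card :=
  (card_divisorScales_le_card_divisors _).trans (card_divisors_prod_primes_le hs)

theorem natLog_two_le (m : ℕ) (hm : m ≠ 0) : (Nat.log 2 m : ℝ) ≤ 2 * Real.log m := by
  have h : ((2 ^ Nat.log 2 m : ℕ) : ℝ) ≤ m := by exact_mod_cast Nat.pow_log_le_self 2 hm
  have h' := Real.log_le_log (by positivity) h
  push_cast at h'
  rw [Real.log_pow] at h'
  nlinarith [Real.log_two_gt_d9, (Nat.cast_nonneg (Nat.log 2 m) : (0 : ℝ) ≤ _)]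

theorem card_divisorScales_prod_primes_le_of_log_le {s Q : Finset ℕ} (hs : ∀ p ∈ s, p.Prime)
    {b : ℝ} (hQ : ∀ p ∈ Q, Real.log p ≤ b) :
    ((divisorScales (∏ p ∈ s, p)).card : ℝ)
      ≤ 2 * 2 ^ (s.card - (s ∩ Q).card) * (2 * ((s ∩ Q).card * b) + 1) := by
  have h0 : (∏ p ∈ s ∩ Q, p) * ∏ p ∈ s \ Q, p = ∏ p ∈ s, p := by
    rw [mul_comm, ← Finset.prod_union (Finset.disjoint_sdiff_inter s Q),
      Finset.sdiff_union_inter]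
  have hs1 : ∀ p ∈ s ∩ Q, p.Prime := fun p hp => hs p (Finset.mem_inter.1 hp).1
  have hs2 : ∀ p ∈ s \ Q, p.Prime := fun p hp => hs p (Finset.mem_sdiff.1 hp).1
  have h1 := card_divisorScales_mul_le (prod_primes_ne_zero hs1) (prod_primes_ne_zero hs2)
  rw [h0] at h1
  have h2 := card_divisorScales_prod_primes_le hs2
  have hcard := Finset.card_sdiff_add_card_inter s Q
  rw [show (s \ Q).card = s.card - (s ∩ Q).card by omega] at h2
  have h3 : ((divisorScales (∏ p ∈ s ∩ Q, p)).card : ℝ) ≤ 2 * ((s ∩ Q).card * b) + 1 := by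
    have h4 : ((divisorScales (∏ p ∈ s ∩ Q, p)).card : ℝ)
        ≤ (Nat.log 2 (∏ p ∈ s ∩ Q, p) : ℕ) + 1 := by
      exact_mod_cast card_divisorScales_le_log _
    have h5 := natLog_two_le _ (prod_primes_ne_zero hs1)
    have h6 : Real.log ((∏ p ∈ s ∩ Q, p : ℕ) : ℝ) ≤ (s ∩ Q).card * b := by
      push_cast
      rw [Real.log_prod fun p hp => by exact_mod_cast (hs1 p hp).ne_zero, ← nsmul_eq_mul]
      exact Finset.sum_le_card_nsmul _ _ _ fun p hp => hQ p (Finset.mem_inter.1 hp).2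
    linarith
  calc ((divisorScales (∏ p ∈ s, p)).card : ℝ)
      ≤ 2 * (divisorScales (∏ p ∈ s ∩ Q, p)).card * (divisorScales (∏ p ∈ s \ Q, p)).card := by
        exact_mod_cast h1
    _ ≤ 2 * (2 * ((s ∩ Q).card * b) + 1) * 2 ^ (s.card - (s ∩ Q).card) := by
        gcongr
        · linarith [(Nat.cast_nonneg (divisorScales (∏ p ∈ s ∩ Q, p)).card : (0 : ℝ) ≤ _)]
        · exact_mod_cast h2
    _ = _ := by ring

theorem sum_cells_le {P : ℕ → Finset ℕ} (hP0 : P 0 = ∅) {w : ℕ → ℝ} (hw : ∀ p, 0 ≤ w p)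
    {lam : ℝ} (hc : ∀ t, ∑ p ∈ P (t + 1) \ P t, w p ≤ lam) (n : ℕ) :
    ∑ p ∈ P n, w p ≤ n * lam := by
  induction n with
  | zero => simp [hP0]
  | succ n ih =>
    have h : ∑ p ∈ P (n + 1), w p ≤ ∑ p ∈ P (n + 1) \ P n, w p + ∑ p ∈ P n, w p := by
      rw [← Finset.sum_union Finset.sdiff_disjoint]
      refine Finset.sum_le_sum_of_subset_of_nonneg ?_ fun p _ _ => hw p
      rw [Finset.sdiff_union_self_eq_union]
      exact Finset.subset_union_left
    push_cast
    linarith [hc n]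

theorem add_mul_pow_sub_le (u w : ℕ) :
    ((w + u + 1 : ℕ) : ℝ) * (3 / 4 : ℝ) ^ w ≤ 7 * (u + 1) * (6 / 7 : ℝ) ^ w := by
  have h1 : ((w + u + 1 : ℕ) : ℝ) ≤ (u + 1) * (w + 1) := by
    push_cast
    nlinarith [mul_nonneg (Nat.cast_nonneg (α := ℝ) w) (Nat.cast_nonneg (α := ℝ) u)]
  have h2 : 1 + (w : ℝ) * (1 / 7) ≤ (1 + 1 / 7) ^ w :=
    one_add_mul_le_pow (by norm_num) w
  have h3 : (6 / 7 : ℝ) ^ w = (1 + 1 / 7) ^ w * (3 / 4) ^ w := by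
    rw [← mul_pow]; norm_num
  have h4 : (w : ℝ) + 1 ≤ 7 * (1 + 1 / 7) ^ w := by linarith
  rw [h3]
  calc _ ≤ ((u + 1) * (w + 1) : ℝ) * (3 / 4) ^ w := by gcongr
    _ ≤ ((u + 1) * (7 * (1 + 1 / 7) ^ w) : ℝ) * (3 / 4) ^ w := by gcongr
    _ = _ := by ring

theorem sum_pow_sub_le (n u : ℕ) :
    ∑ k ∈ Finset.range (n + u + 1), (6 / 7 : ℝ) ^ (n - k) ≤ 8 * (u + 1) := by
  rw [add_assoc, Finset.sum_range_add]
  have h1 : ∑ k ∈ Finset.range n, (6 / 7 : ℝ) ^ (n - k) ≤ 7 := by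
    have h2 : ∑ k ∈ Finset.range n, (6 / 7 : ℝ) ^ (n - k) ≤ ∑ k ∈ Finset.range n, (6 / 7 : ℝ) ^ k := by
      rw [← Finset.sum_range_reflect]
      refine Finset.sum_le_sum fun k hk => ?_
      rw [Finset.mem_range] at hk
      exact pow_le_pow_of_le_one (by norm_num) (by norm_num) (by omega)
    refine h2.trans ?_
    rw [geom_sum_eq (by norm_num)]
    have : (0 : ℝ) ≤ (6 / 7) ^ n := by positivity
    rw [div_le_iff_of_neg (by norm_num)]
    linarith
  have h2 : ∑ k ∈ Finset.range (u + 1), (6 / 7 : ℝ) ^ (n - (n + k)) = u + 1 := by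
    simp
  rw [h2]
  linarith [(Nat.cast_nonneg u : (0 : ℝ) ≤ u)]

/-- The contribution of the sets satisfying the barrier condition. -/
theorem sum_min_barrierSets_le {P : ℕ → Finset ℕ} (hP0 : P 0 = ∅) {w : ℕ → ℝ}
    (hw : ∀ p, 0 ≤ w p) (hc : ∀ t, ∑ p ∈ P (t + 1) \ P t, w p ≤ Real.log 2) {u n : ℕ}
    (hn : 0 < n) {B : ℝ} (hB : 1 ≤ B) :
    ∑ k ∈ Finset.range (n + u + 1), ∑ s ∈ barrierSets P u n k,
        min (2 ^ k) (B * 2 ^ n) * ∏ p ∈ s, w p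
      ≤ 1344 * B * (u + 1) ^ 5 * ((2 * Real.log 2) ^ n * (Real.exp n / (n * √n))) := by
  have hl2 := Real.log_two_gt_d9
  have hl2' := Real.log_two_lt_d9
  have hterm : ∀ k ∈ Finset.range (n + u + 1),
      ∑ s ∈ barrierSets P u n k, min (2 ^ k) (B * 2 ^ n) * ∏ p ∈ s, w p
        ≤ (B * (2 * Real.log 2) ^ n * (7 * (u + 1)) * (24 * (u + 1 : ℝ) ^ 3)
            * (Real.exp n / (n * √n))) * (6 / 7 : ℝ) ^ (n - k) := by
    intro k hk
    have hk' : k ≤ n + u := by simpa [Nat.lt_succ_iff] using hk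
    rw [← Finset.mul_sum]
    have h1 := sum_barrierSets_le hP0 hw (by linarith) hc hn hk'
    have h2 : min (2 ^ k) (B * 2 ^ n) * (Real.log 2 ^ k * ((n + u - k + 1 : ℕ) : ℝ))
        ≤ B * (2 * Real.log 2) ^ n * (7 * (u + 1)) * (6 / 7 : ℝ) ^ (n - k) := by
      rcases le_or_gt k n with hkn | hkn
      · obtain ⟨d, rfl⟩ := Nat.exists_eq_add_of_le hkn
        have e1 : k + d - k = d := by omega
        have e2 : k + d + u - k + 1 = d + u + 1 := by omega
        rw [e1, e2]
        calc _ ≤ 2 ^ k * (Real.log 2 ^ k * ((d + u + 1 : ℕ) : ℝ)) := by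
              gcongr; exact min_le_left _ _
          _ = (2 * Real.log 2) ^ k * 1 ^ d * ((d + u + 1 : ℕ) : ℝ) := by
              rw [mul_pow, one_pow]; ring
          _ ≤ (2 * Real.log 2) ^ k * (2 * Real.log 2 * (3 / 4)) ^ d * ((d + u + 1 : ℕ) : ℝ) := by
              gcongr; linarith
          _ = (2 * Real.log 2) ^ (k + d) * (((d + u + 1 : ℕ) : ℝ) * (3 / 4) ^ d) := by
              rw [pow_add, mul_pow _ (3 / 4 : ℝ) d]; ring
          _ ≤ (2 * Real.log 2) ^ (k + d) * (7 * (u + 1) * (6 / 7) ^ d) :=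
              mul_le_mul_of_nonneg_left (add_mul_pow_sub_le u d) (by positivity)
          _ ≤ B * ((2 * Real.log 2) ^ (k + d) * (7 * (u + 1) * (6 / 7) ^ d)) :=
              le_mul_of_one_le_left (by positivity) hB
          _ = _ := by ring
      · have e1 : n - k = 0 := by omega
        have e2 : ((n + u - k + 1 : ℕ) : ℝ) ≤ u + 1 := by
          exact_mod_cast (by omega : n + u - k + 1 ≤ u + 1)
        rw [e1]
        calc _ ≤ B * 2 ^ n * (Real.log 2 ^ n * (u + 1)) := by
              refine mul_le_mul (min_le_right _ _) (mul_le_mul ?_ e2 (by positivity)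
                (by positivity)) (by positivity) (by positivity)
              exact pow_le_pow_of_le_one (by linarith) (by linarith) hkn.le
          _ = B * (2 * Real.log 2) ^ n * (u + 1) := by rw [mul_pow]; ring
          _ ≤ B * (2 * Real.log 2) ^ n * (7 * (u + 1)) := by
              gcongr; linarith [(Nat.cast_nonneg u : (0 : ℝ) ≤ u)]
          _ = _ := by simp
    calc _ ≤ min (2 ^ k) (B * 2 ^ n) * (Real.log 2 ^ k * ((n + u - k + 1 : ℕ) : ℝ)
            * (24 * (u + 1 : ℝ) ^ 3) * (Real.exp n / (n * √n))) := by gcongr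
      _ = min (2 ^ k) (B * 2 ^ n) * (Real.log 2 ^ k * ((n + u - k + 1 : ℕ) : ℝ))
            * (24 * (u + 1 : ℝ) ^ 3) * (Real.exp n / (n * √n)) := by ring
      _ ≤ (B * (2 * Real.log 2) ^ n * (7 * (u + 1)) * (6 / 7 : ℝ) ^ (n - k))
            * (24 * (u + 1 : ℝ) ^ 3) * (Real.exp n / (n * √n)) := by gcongr
      _ = _ := by ring
  refine (Finset.sum_le_sum hterm).trans ?_
  rw [← Finset.mul_sum]
  calc _ ≤ (B * (2 * Real.log 2) ^ n * (7 * (u + 1)) * (24 * (u + 1 : ℝ) ^ 3)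
            * (Real.exp n / (n * √n))) * (8 * (u + 1)) := by
        gcongr
        exact sum_pow_sub_le n u
    _ = _ := by ring

theorem le_mul_of_le_two_pow_of_le {x b B : ℝ} {k n : ℕ} (hx : 0 ≤ x) (hb : 1 ≤ b) (hB : 1 ≤ B)
    (hn : 0 < n) (h1 : x ≤ b * 2 ^ k / n ^ 4) (h2 : x ≤ B * 2 ^ n) :
    x ≤ b * B * (2 * Real.log 2) ^ n * (1 / Real.log 2) ^ k / (n * √n) := by
  have hl2 := Real.log_two_gt_d9
  have hl2' := Real.log_two_lt_d9
  have hn' : (1 : ℝ) ≤ n := by exact_mod_cast hn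
  set θ : ℝ := -Real.log (Real.log 2) / Real.log 2 with hθ
  have hlog : Real.log (Real.log 2) ≤ -(Real.log 2 / 2) := by
    have h3 : Real.log 2 ^ 2 ≤ (2 : ℝ)⁻¹ := by
      norm_num1 at hl2'; nlinarith
    have h4 := Real.log_le_log (by positivity) h3
    rw [Real.log_pow, Real.log_inv] at h4
    push_cast at h4
    linarith
  have hθ1 : 1 / 2 ≤ θ := by
    rw [hθ, le_div_iff₀ (by linarith)]; linarith
  have hθ2 : θ ≤ 1 := by
    rw [hθ, div_le_one (by linarith)]
    have h3 := Real.one_sub_inv_le_log_of_pos (x := Real.log 2) (by linarith)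
    have h4 : (Real.log 2)⁻¹ ≤ 3 / 2 := by
      rw [inv_le_comm₀ (by linarith) (by norm_num)]; norm_num; linarith
    linarith
  have h2θ : (2 : ℝ) ^ θ = 1 / Real.log 2 := by
    rw [Real.rpow_def_of_pos (by norm_num), hθ, mul_div_cancel₀ _ (by linarith), Real.exp_neg,
      Real.exp_log (by linarith), one_div]
  have h2θ' : (2 : ℝ) ^ (1 - θ) = 2 * Real.log 2 := by
    rw [Real.rpow_sub (by norm_num), h2θ, Real.rpow_one]; field_simp
  have hx' : x = x ^ θ * x ^ (1 - θ) := by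
    rcases hx.eq_or_lt with h | h
    · rw [← h, Real.zero_rpow (by linarith), zero_mul]
    · rw [← Real.rpow_add h]; simp
  have a1 : x ^ θ ≤ b * (1 / Real.log 2) ^ k / (n * √n) := by
    calc x ^ θ ≤ (b * 2 ^ k / n ^ 4) ^ θ := Real.rpow_le_rpow hx h1 (by linarith)
      _ = b ^ θ * (1 / Real.log 2) ^ k / ((n : ℝ) ^ 4) ^ θ := by
          rw [Real.div_rpow (by positivity) (by positivity),
            Real.mul_rpow (by positivity) (by positivity), ← h2θ,
            ← Real.rpow_natCast (2 : ℝ) k, ← Real.rpow_natCast ((2 : ℝ) ^ θ) k,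
            ← Real.rpow_mul (by norm_num), ← Real.rpow_mul (by norm_num), mul_comm θ]
      _ ≤ _ := by
          have e1 : b ^ θ ≤ b := Real.rpow_le_self_of_one_le hb hθ2
          have e2 : (n : ℝ) * √n ≤ ((n : ℝ) ^ 4) ^ θ := by
            calc (n : ℝ) * √n ≤ n * n := by
                  gcongr; exact Real.sqrt_le_iff.2 ⟨by linarith, by nlinarith⟩
              _ = ((n : ℝ) ^ 4) ^ (1 / 2 : ℝ) := by
                  rw [← Real.sqrt_eq_rpow, show (n : ℝ) ^ 4 = (n * n) ^ 2 by ring,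
                    Real.sqrt_sq (by positivity)]
              _ ≤ _ := Real.rpow_le_rpow_of_exponent_le (one_le_pow₀ hn') hθ1
          gcongr
  have a2 : x ^ (1 - θ) ≤ B * (2 * Real.log 2) ^ n := by
    calc x ^ (1 - θ) ≤ (B * 2 ^ n) ^ (1 - θ) := Real.rpow_le_rpow hx h2 (by linarith)
      _ = B ^ (1 - θ) * (2 * Real.log 2) ^ n := by
          rw [Real.mul_rpow (by positivity) (by positivity), ← h2θ',
            ← Real.rpow_natCast (2 : ℝ) n, ← Real.rpow_natCast ((2 : ℝ) ^ (1 - θ)) n,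
            ← Real.rpow_mul (by norm_num), ← Real.rpow_mul (by norm_num), mul_comm (1 - θ)]
      _ ≤ _ := by
          gcongr
          exact Real.rpow_le_self_of_one_le hB (by linarith)
  rw [hx']
  calc _ ≤ (b * (1 / Real.log 2) ^ k / (n * √n)) * (B * (2 * Real.log 2) ^ n) := by gcongr
    _ = _ := by ring

theorem mul_two_pow_le_of_barrier {n t j ℓ : ℕ} (hn : 0 < n) (ht : t ≤ n)
    (hℓ : ℓ = Nat.log 2 n + 1) (hj : t + 5 * ℓ < j) : j * 2 ^ t * n ^ 4 ≤ 7 * 2 ^ j := by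
  obtain ⟨i, rfl⟩ := Nat.exists_eq_add_of_le (Nat.succ_le_of_lt hj)
  have h1 : n ≤ 2 ^ ℓ := hℓ ▸ (Nat.lt_pow_succ_log_self one_lt_two n).le
  have h2 : n ^ 5 ≤ 2 ^ (5 * ℓ) := by
    rw [mul_comm, pow_mul]; exact Nat.pow_le_pow_left h1 5
  have h3 : ℓ ≤ n := by
    have := Nat.log_lt_self 2 hn.ne'
    omega
  have h4 : i + 1 ≤ 2 ^ i := Nat.lt_two_pow_self
  have h5 : (t + 5 * ℓ).succ + i ≤ 7 * n * 2 ^ i := by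
    calc (t + 5 * ℓ).succ + i ≤ 7 * n * (i + 1) := by
          have h6 : (t + 5 * ℓ).succ ≤ 7 * n := by omega
          have h7 : i ≤ 7 * n * i := Nat.le_mul_of_pos_left i (by omega)
          rw [mul_add, mul_one]
          omega
      _ ≤ _ := Nat.mul_le_mul_left _ h4
  calc ((t + 5 * ℓ).succ + i) * 2 ^ t * n ^ 4 ≤ (7 * n * 2 ^ i) * 2 ^ t * n ^ 4 := by gcongr
    _ = 7 * (n ^ 5 * (2 ^ i * 2 ^ t)) := by ring
    _ ≤ 7 * (2 ^ (5 * ℓ) * (2 ^ i * 2 ^ t)) := by gcongr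
    _ ≤ 7 * 2 ^ ((t + 5 * ℓ).succ + i) := by
        rw [← pow_add, ← pow_add]
        exact Nat.mul_le_mul_left 7 (Nat.pow_le_pow_right (by norm_num) (by omega))

theorem sum_divisorScales_primeSets_le {P : ℕ → Finset ℕ} (hP0 : P 0 = ∅)
    (hPp : ∀ t, ∀ p ∈ P t, p.Prime) {K : ℝ} (hK : 1 ≤ K)
    (hlog : ∀ t, ∀ p ∈ P t, Real.log p ≤ K * 2 ^ t)
    (hc : ∀ t, ∑ p ∈ P (t + 1) \ P t, (p : ℝ)⁻¹ ≤ Real.log 2) {n : ℕ} (hn : 0 < n)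
    {B : ℝ} (hB : 1 ≤ B) {F : Finset (Finset ℕ)} (hF : ∀ s ∈ F, s ⊆ P n)
    (hFB : ∀ s ∈ F, ((divisorScales (∏ p ∈ s, p)).card : ℝ) ≤ B * 2 ^ n) :
    ∑ s ∈ F, ((divisorScales (∏ p ∈ s, p)).card : ℝ) * ∏ p ∈ s, (p : ℝ)⁻¹
      ≤ 11000000 * K * B * (Nat.log 2 n + 1) ^ 5
        * ((2 * Real.log 2) ^ n * (Real.exp n / (n * √n))) := by
  classical
  have hl2 := Real.log_two_gt_d9
  have hw : ∀ p : ℕ, 0 ≤ (p : ℝ)⁻¹ := fun p => by positivity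
  have hprod : ∀ s : Finset ℕ, 0 ≤ ∏ p ∈ s, (p : ℝ)⁻¹ := fun s =>
    Finset.prod_nonneg fun p _ => hw p
  set ℓ := Nat.log 2 n + 1 with hℓ
  set u := 5 * ℓ with hu
  have hn' : (0 : ℝ) < n := by exact_mod_cast hn
  have hprimes : ∀ s ∈ F, ∀ p ∈ s, p.Prime := fun s hs p hp => hPp n p (hF s hs hp)
  rw [← Finset.sum_filter_add_sum_filter_not F fun s => ∀ i ≤ n, (s ∩ P i).card ≤ i + u]
  have hgood : ∑ s ∈ F with ∀ i ≤ n, (s ∩ P i).card ≤ i + u,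
      ((divisorScales (∏ p ∈ s, p)).card : ℝ) * ∏ p ∈ s, (p : ℝ)⁻¹
        ≤ 1344 * B * (u + 1) ^ 5 * ((2 * Real.log 2) ^ n * (Real.exp n / (n * √n))) := by
    refine le_trans ?_ (sum_min_barrierSets_le hP0 hw hc hn hB)
    rw [Finset.sum_sigma' (Finset.range (n + u + 1)) (fun k => barrierSets P u n k)
      fun k s => min (2 ^ k) (B * 2 ^ n) * ∏ p ∈ s, (p : ℝ)⁻¹]
    refine sum_le_sum_of_injOn (fun s => ⟨s.card, s⟩) ?_ ?_ ?_ ?_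
    · intro s hs
      rw [Finset.mem_filter] at hs
      have h1 := hs.2 n le_rfl
      rw [Finset.inter_eq_left.2 (hF s hs.1)] at h1
      simp only [Finset.mem_sigma, Finset.mem_range, mem_barrierSets]
      exact ⟨by omega, hF s hs.1, trivial, hs.2⟩
    · intro s _ s' _ h
      simp only [Sigma.mk.injEq, heq_eq_eq] at h
      exact h.2
    · intro s hs
      have hsF := (Finset.mem_filter.1 hs).1
      refine mul_le_mul_of_nonneg_right (le_min ?_ (hFB s hsF)) (hprod s)
      exact_mod_cast card_divisorScales_prod_primes_le (hprimes s hsF)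
    · intro z _
      exact mul_nonneg (le_min (by positivity) (by positivity)) (hprod _)
  have hbad : ∑ s ∈ F with ¬ ∀ i ≤ n, (s ∩ P i).card ≤ i + u,
      ((divisorScales (∏ p ∈ s, p)).card : ℝ) * ∏ p ∈ s, (p : ℝ)⁻¹
        ≤ 42 * K * B * ((2 * Real.log 2) ^ n * (Real.exp n / (n * √n))) := by
    have hterm : ∀ s ∈ F.filter fun s => ¬ ∀ i ≤ n, (s ∩ P i).card ≤ i + u,
        ((divisorScales (∏ p ∈ s, p)).card : ℝ) * ∏ p ∈ s, (p : ℝ)⁻¹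
          ≤ (42 * K * B * (2 * Real.log 2) ^ n / (n * √n))
            * ∏ p ∈ s, (1 / Real.log 2 * (p : ℝ)⁻¹) := by
      intro s hs
      obtain ⟨hsF, hnot⟩ := Finset.mem_filter.1 hs
      push Not at hnot
      obtain ⟨t, ht, hj⟩ := hnot
      set j := (s ∩ P t).card with hjdef
      have h1 := card_divisorScales_prod_primes_le_of_log_le (hprimes s hsF) (hlog t)
      rw [← hjdef] at h1
      have hjs : j ≤ s.card := Finset.card_le_card Finset.inter_subset_left
      have hj1 : (1 : ℝ) ≤ j := by exact_mod_cast (by omega : 1 ≤ j)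
      have h2 : (j : ℝ) * 2 ^ t * n ^ 4 ≤ 7 * 2 ^ j := by
        exact_mod_cast mul_two_pow_le_of_barrier hn ht hℓ hj
      have h3 : ((divisorScales (∏ p ∈ s, p)).card : ℝ) ≤ (42 * K) * 2 ^ s.card / n ^ 4 := by
        rw [le_div_iff₀ (by positivity)]
        have h4 : (1 : ℝ) ≤ K * (j * 2 ^ t) := by
          have : (1 : ℝ) ≤ 2 ^ t := one_le_pow₀ (by norm_num)
          nlinarith [mul_le_mul hj1 this (by norm_num) (by linarith)]
        calc _ ≤ (2 * 2 ^ (s.card - j) * (2 * (j * (K * 2 ^ t)) + 1)) * (n : ℝ) ^ 4 := by gcongr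
          _ ≤ (2 * 2 ^ (s.card - j) * (3 * (K * (j * 2 ^ t)))) * (n : ℝ) ^ 4 := by
              gcongr; linarith
          _ = 6 * K * 2 ^ (s.card - j) * (j * 2 ^ t * (n : ℝ) ^ 4) := by ring
          _ ≤ 6 * K * 2 ^ (s.card - j) * (7 * 2 ^ j) := by gcongr
          _ = 42 * K * (2 ^ (s.card - j) * 2 ^ j) := by ring
          _ = _ := by rw [← pow_add, Nat.sub_add_cancel hjs]
      have h5 := le_mul_of_le_two_pow_of_le (Nat.cast_nonneg _) (by linarith) hB hn h3
        (hFB s hsF)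
      rw [Finset.prod_mul_distrib, Finset.prod_const]
      calc _ ≤ (42 * K * B * (2 * Real.log 2) ^ n * (1 / Real.log 2) ^ s.card / (n * √n))
            * ∏ p ∈ s, (p : ℝ)⁻¹ := mul_le_mul_of_nonneg_right h5 (hprod s)
        _ = _ := by ring
    refine (Finset.sum_le_sum hterm).trans ?_
    rw [← Finset.mul_sum]
    have hexp : ∑ s ∈ F with ¬ ∀ i ≤ n, (s ∩ P i).card ≤ i + u,
        ∏ p ∈ s, (1 / Real.log 2 * (p : ℝ)⁻¹) ≤ Real.exp n := by
      have hnn : ∀ p : ℕ, 0 ≤ 1 / Real.log 2 * (p : ℝ)⁻¹ := fun p => by positivity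
      calc _ ≤ ∑ s ∈ (P n).powerset, ∏ p ∈ s, (1 / Real.log 2 * (p : ℝ)⁻¹) := by
            refine Finset.sum_le_sum_of_subset_of_nonneg (fun s hs => ?_)
              fun s _ _ => Finset.prod_nonneg fun p _ => hnn p
            exact Finset.mem_powerset.2 (hF s (Finset.mem_filter.1 hs).1)
        _ = ∏ p ∈ P n, (1 + 1 / Real.log 2 * (p : ℝ)⁻¹) := (Finset.prod_one_add _).symm
        _ ≤ ∏ p ∈ P n, Real.exp (1 / Real.log 2 * (p : ℝ)⁻¹) :=
            Finset.prod_le_prod (fun p _ => by linarith [hnn p]) fun p _ => by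
              rw [add_comm]; exact Real.add_one_le_exp _
        _ = Real.exp (1 / Real.log 2 * ∑ p ∈ P n, (p : ℝ)⁻¹) := by
            rw [← Real.exp_sum, Finset.mul_sum]
        _ ≤ _ := by
            rw [Real.exp_le_exp, one_div, inv_mul_le_iff₀ (by linarith), mul_comm]
            exact sum_cells_le hP0 hw hc n
    calc _ ≤ (42 * K * B * (2 * Real.log 2) ^ n / (n * √n)) * Real.exp n := by gcongr
      _ = _ := by ring
  refine (add_le_add hgood hbad).trans ?_
  rw [← add_mul]
  gcongr
  have hℓ1 : (1 : ℝ) ≤ ℓ := by exact_mod_cast (by omega : 1 ≤ ℓ)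
  have hu1 : (u : ℝ) + 1 ≤ 6 * ℓ := by rw [hu]; push_cast; linarith
  have hℓ5 : (1 : ℝ) ≤ (ℓ : ℝ) ^ 5 := one_le_pow₀ hℓ1
  have e : ((Nat.log 2 n : ℕ) : ℝ) + 1 = ℓ := by rw [hℓ]; push_cast; ring
  rw [e]
  calc 1344 * B * ((u : ℝ) + 1) ^ 5 + 42 * K * B
      ≤ 1344 * B * (6 * ℓ) ^ 5 + 42 * K * B * ℓ ^ 5 := by
        exact add_le_add (by gcongr) (le_mul_of_one_le_right (by positivity) hℓ5)
    _ = (10450944 * 1 + 42 * K) * B * ℓ ^ 5 := by ring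
    _ ≤ (10450944 * K + 42 * K) * B * ℓ ^ 5 := by gcongr
    _ ≤ _ := by
        have : 10450944 * K + 42 * K ≤ 11000000 * K := by linarith
        gcongr

open ArithmeticFunction in
theorem sum_vonMangoldt_mul_floor (N : ℕ) :
    ∑ d ∈ Finset.Ioc 0 N, vonMangoldt d * ((N / d : ℕ) : ℝ) = Real.log (N.factorial) := by
  rw [← ArithmeticFunction.sum_Ioc_mul_zeta_eq_sum vonMangoldt N]
  induction N with
  | zero => simp
  | succ k ih =>
    rw [Finset.sum_Ioc_succ_top (by omega), ih, Nat.factorial_succ, Nat.cast_mul,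
      Real.log_mul (by positivity) (by positivity), vonMangoldt_mul_zeta]
    simp [add_comm]

theorem log_sub_one_le_sum_vonMangoldt_div {N : ℕ} (hN : 1 ≤ N) :
    Real.log N - 1 ≤ ∑ d ∈ Finset.Ioc 0 N, ArithmeticFunction.vonMangoldt d / d := by
  have hN' : (0 : ℝ) < N := by exact_mod_cast hN
  have h1 : (N : ℝ) * Real.log N - N ≤ Real.log N.factorial := by
    have := Stirling.le_log_factorial_stirling (n := N) (by omega)
    have h2 : 0 ≤ Real.log N := Real.log_natCast_nonneg N
    have h3 : 0 ≤ Real.log (2 * Real.pi) := Real.log_nonneg (by linarith [Real.pi_gt_three])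
    linarith
  rw [← sum_vonMangoldt_mul_floor] at h1
  have h2 : ∑ d ∈ Finset.Ioc 0 N, ArithmeticFunction.vonMangoldt d * ((N / d : ℕ) : ℝ)
      ≤ N * ∑ d ∈ Finset.Ioc 0 N, ArithmeticFunction.vonMangoldt d / d := by
    rw [Finset.mul_sum]
    refine Finset.sum_le_sum fun d _ => ?_
    calc _ ≤ ArithmeticFunction.vonMangoldt d * ((N : ℝ) / d) :=
          mul_le_mul_of_nonneg_left Nat.cast_div_le ArithmeticFunction.vonMangoldt_nonneg
      _ = _ := by ring
  nlinarith

theorem sum_vonMangoldt_div_le {N : ℕ} (hN : 1 ≤ N) :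
    ∑ d ∈ Finset.Ioc 0 N, ArithmeticFunction.vonMangoldt d / d
      ≤ Real.log N + (Real.log 4 + 4) := by
  have hN' : (0 : ℝ) < N := by exact_mod_cast hN
  have h1 : Real.log N.factorial ≤ N * Real.log N := by
    rw [← Real.log_pow]
    exact Real.log_le_log (by positivity) (by exact_mod_cast Nat.factorial_le_pow N)
  rw [← sum_vonMangoldt_mul_floor] at h1
  have h3 := Chebyshev.psi_le_const_mul_self hN'.le
  rw [Chebyshev.psi, Nat.floor_natCast] at h3
  have h2 : N * ∑ d ∈ Finset.Ioc 0 N, ArithmeticFunction.vonMangoldt d / d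
      ≤ ∑ d ∈ Finset.Ioc 0 N, ArithmeticFunction.vonMangoldt d * ((N / d : ℕ) : ℝ)
        + ∑ d ∈ Finset.Ioc 0 N, ArithmeticFunction.vonMangoldt d := by
    rw [Finset.mul_sum, ← Finset.sum_add_distrib]
    refine Finset.sum_le_sum fun d _ => ?_
    calc _ = ArithmeticFunction.vonMangoldt d * ((N : ℝ) / d) := by ring
      _ ≤ ArithmeticFunction.vonMangoldt d * (((N / d : ℕ) : ℝ) + 1) := by
          refine mul_le_mul_of_nonneg_left ?_ ArithmeticFunction.vonMangoldt_nonneg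
          rw [← Nat.floor_div_eq_div (K := ℝ)]
          exact (Nat.lt_floor_add_one _).le
      _ = _ := by ring
  nlinarith

theorem sum_vonMangoldt_div_log_le {u v : ℕ} (hu : 2 ≤ u) (huv : u ≤ v) :
    ∑ d ∈ Finset.Ioc u v, ArithmeticFunction.vonMangoldt d / (d * Real.log d)
      ≤ Real.log (Real.log v) - Real.log (Real.log u) + (Real.log 4 + 5) / Real.log u := by
  set A : ℕ → ℝ := fun N => ∑ d ∈ Finset.Ioc 0 N, ArithmeticFunction.vonMangoldt d / d with hA
  suffices h : ∑ d ∈ Finset.Ioc u v, ArithmeticFunction.vonMangoldt d / (d * Real.log d)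
      ≤ Real.log (Real.log v) - Real.log (Real.log u) + (Real.log 4 + 5) / Real.log u
        + (A v - Real.log v - (Real.log 4 + 4)) / Real.log v by
    have h1 := sum_vonMangoldt_div_le (by omega : 1 ≤ v)
    have h2 : (A v - Real.log v - (Real.log 4 + 4)) / Real.log v ≤ 0 :=
      div_nonpos_of_nonpos_of_nonneg (by simp only [hA]; linarith) (Real.log_natCast_nonneg v)
    linarith
  induction v, huv using Nat.le_induction with
  | base =>
    have h1 := log_sub_one_le_sum_vonMangoldt_div (by omega : 1 ≤ u)
    have h2 : 0 ≤ (A u - Real.log u + 1) / Real.log u :=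
      div_nonneg (by simp only [hA]; linarith) (Real.log_natCast_nonneg u)
    simp only [Finset.Ioc_self, Finset.sum_empty, sub_self, zero_add]
    rw [← add_div]
    convert h2 using 2
    ring
  | succ v hv ih =>
    have hv2 : (2 : ℝ) ≤ v := by exact_mod_cast hu.trans hv
    have hx : 0 < Real.log v := Real.log_pos (by linarith)
    have hxy : Real.log v ≤ Real.log ((v + 1 : ℕ) : ℝ) :=
      Real.log_le_log (by linarith) (by push_cast; linarith)
    have hy := hx.trans_le hxy
    rw [Finset.sum_Ioc_succ_top (by omega)]
    have hAs : A (v + 1) = A v + ArithmeticFunction.vonMangoldt (v + 1) / ((v + 1 : ℕ) : ℝ) := by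
      simp only [hA]
      rw [Finset.sum_Ioc_succ_top (by omega)]
    have h0 := sum_vonMangoldt_div_le (by omega : 1 ≤ v)
    change A v ≤ _ at h0
    have h1 : (A v - Real.log v - (Real.log 4 + 4)) / Real.log v
        ≤ (A v - Real.log v - (Real.log 4 + 4)) / Real.log ((v + 1 : ℕ) : ℝ) := by
      have := div_le_div_of_nonneg_left (c := Real.log v)
        (by linarith : 0 ≤ -(A v - Real.log v - (Real.log 4 + 4))) hx hxy
      rw [neg_div, neg_div] at this
      linarith
    have h2 := Real.add_one_le_exp
      (Real.log (Real.log v) - Real.log (Real.log ((v + 1 : ℕ) : ℝ)))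
    rw [Real.exp_sub, Real.exp_log hx, Real.exp_log hy] at h2
    have h3 : ArithmeticFunction.vonMangoldt (v + 1) / (((v + 1 : ℕ) : ℝ)
        * Real.log ((v + 1 : ℕ) : ℝ)) = (A (v + 1) - A v) / Real.log ((v + 1 : ℕ) : ℝ) := by
      rw [hAs, ← div_div]; congr 1; ring
    have h4 : Real.log ((v + 1 : ℕ) : ℝ) / Real.log ((v + 1 : ℕ) : ℝ) = 1 := div_self hy.ne'
    rw [h3]
    simp only [sub_div, add_div] at *
    linarith

theorem sum_inv_primes_le {u v : ℕ} (hu : 2 ≤ u) (huv : u ≤ v) :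
    ∑ p ∈ Finset.Ioc u v with p.Prime, (p : ℝ)⁻¹
      ≤ Real.log (Real.log v) - Real.log (Real.log u) + (Real.log 4 + 5) / Real.log u := by
  refine le_trans ?_ (sum_vonMangoldt_div_log_le hu huv)
  rw [Finset.sum_filter]
  refine Finset.sum_le_sum fun p hp => ?_
  have hp1 : (1 : ℝ) < p := by exact_mod_cast (by have := Finset.mem_Ioc.1 hp; omega : 1 < p)
  have hl := Real.log_pos hp1
  split_ifs with h
  · rw [ArithmeticFunction.vonMangoldt_apply_prime h]
    field_simp
    rfl
  · exact div_nonneg ArithmeticFunction.vonMangoldt_nonneg (by positivity)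

theorem sub_one_le_log_floor_exp {x : ℝ} (hx : 0 ≤ x) : x - 1 ≤ Real.log ⌊Real.exp x⌋₊ := by
  have h1 : 1 ≤ Real.exp x := Real.one_le_exp hx
  have h2 : 1 ≤ ⌊Real.exp x⌋₊ := Nat.one_le_floor_iff _ |>.2 h1
  have h3 : (1 : ℝ) ≤ ⌊Real.exp x⌋₊ := by exact_mod_cast h2
  have h4 := Nat.lt_floor_add_one (Real.exp x)
  rw [Real.le_log_iff_exp_le (by linarith), Real.exp_sub, div_le_iff₀ (Real.exp_pos _)]
  have := Real.add_one_le_exp 1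
  nlinarith

theorem sum_inv_primes_floor_exp_le {x y : ℝ} (hx : 2 ≤ x) (hxy : x ≤ y) :
    ∑ p ∈ Finset.Ioc ⌊Real.exp x⌋₊ ⌊Real.exp y⌋₊ with p.Prime, (p : ℝ)⁻¹
      ≤ Real.log y - Real.log x + (Real.log 4 + 6) / (x - 1) := by
  have hu : 2 ≤ ⌊Real.exp x⌋₊ := Nat.le_floor (by
    have := Real.add_one_le_exp x
    push_cast; linarith)
  have huv : ⌊Real.exp x⌋₊ ≤ ⌊Real.exp y⌋₊ := Nat.floor_mono (Real.exp_le_exp.2 hxy)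
  refine (sum_inv_primes_le hu huv).trans ?_
  have h1 := sub_one_le_log_floor_exp (by linarith : 0 ≤ x)
  have h2 : Real.log ⌊Real.exp y⌋₊ ≤ y := by
    have h3 : (0 : ℝ) < ⌊Real.exp y⌋₊ := by exact_mod_cast (by omega : 0 < ⌊Real.exp y⌋₊)
    rw [Real.log_le_iff_le_exp h3]
    exact Nat.floor_le (Real.exp_pos _).le
  have h4 := sub_one_le_log_floor_exp (by linarith : 0 ≤ y)
  have h5 : Real.log (Real.log ⌊Real.exp y⌋₊) ≤ Real.log y := Real.log_le_log (by linarith) h2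
  have h6 : Real.log (x - 1) ≤ Real.log (Real.log ⌊Real.exp x⌋₊) :=
    Real.log_le_log (by linarith) h1
  have h7 : Real.log x - Real.log (x - 1) ≤ 1 / (x - 1) := by
    have := Real.log_le_sub_one_of_pos (x := x / (x - 1)) (div_pos (by linarith) (by linarith))
    rw [Real.log_div (by linarith) (by linarith)] at this
    refine this.trans (le_of_eq ?_)
    have : x - 1 ≠ 0 := by linarith
    field_simp
    ring
  have hl4 : 0 ≤ Real.log 4 := Real.log_nonneg (by norm_num)
  have h8 : (Real.log 4 + 5) / Real.log ⌊Real.exp x⌋₊ ≤ (Real.log 4 + 5) / (x - 1) := by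
    gcongr
    linarith
  have h9 : (Real.log 4 + 6) / (x - 1) = (Real.log 4 + 5) / (x - 1) + 1 / (x - 1) := by
    rw [← add_div]; ring
  linarith

theorem exists_primeCells : ∃ (K : ℝ) (Y : ℕ) (P : ℕ → Finset ℕ), 1 ≤ K ∧ P 0 = ∅ ∧
    (∀ t, ∀ p ∈ P t, p.Prime) ∧ (∀ t, ∀ p ∈ P t, Real.log p ≤ K * 2 ^ t) ∧
    (∀ t, ∑ p ∈ P (t + 1) \ P t, (p : ℝ)⁻¹ ≤ Real.log 2) ∧
    ∀ t p, p.Prime → Y < p → Real.log p ≤ 2 ^ t → p ∈ P t := by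
  have hl4 : 0 ≤ Real.log 4 := Real.log_nonneg (by norm_num)
  set κ : ℝ := 2 * (Real.log 4 + 6) + 1 with hκ
  set y : ℕ → ℝ := fun t => κ * 2 ^ t * Real.exp ((2 ^ t)⁻¹) with hy
  have hpow : ∀ t : ℕ, (1 : ℝ) ≤ 2 ^ t := fun t => one_le_pow₀ (by norm_num)
  have hexp : ∀ t : ℕ, 1 ≤ Real.exp ((2 ^ t : ℝ)⁻¹) := fun t => Real.one_le_exp (by positivity)
  have hylow : ∀ t, κ * 2 ^ t ≤ y t := fun t =>
    le_mul_of_one_le_right (by positivity) (hexp t)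
  have hystep : ∀ t, Real.log (y (t + 1)) - Real.log (y t) = Real.log 2 - (2 ^ (t + 1))⁻¹ := by
    intro t
    have hlog : ∀ t : ℕ, Real.log (y t) = Real.log κ + t * Real.log 2 + (2 ^ t)⁻¹ := by
      intro t
      simp only [hy]
      rw [Real.log_mul (by positivity) (by positivity), Real.log_mul (by positivity)
        (by positivity), Real.log_exp, Real.log_pow]
    rw [hlog, hlog, pow_succ]
    push_cast
    have := hpow t
    field_simp
    ring
  have hl2 := Real.log_two_gt_d9
  have hypos : ∀ t, 0 < y t := fun t => by positivity
  have hymono : ∀ t, y t ≤ y (t + 1) := by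
    intro t
    rw [← Real.log_le_log_iff (hypos _) (hypos _)]
    have h1 := hystep t
    have h2 : ((2 : ℝ) ^ (t + 1))⁻¹ ≤ 1 / 2 := by
      rw [pow_succ, mul_inv, one_div]
      exact mul_le_of_le_one_left (by norm_num) (inv_le_one_of_one_le₀ (hpow t))
    linarith
  have hymono' : Monotone y := monotone_nat_of_le_succ hymono
  refine ⟨κ * Real.exp 1, ⌊Real.exp (y 0)⌋₊,
    fun t => (Finset.Ioc ⌊Real.exp (y 0)⌋₊ ⌊Real.exp (y t)⌋₊).filter Nat.Prime, ?_, by simp,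
    fun t p hp => (Finset.mem_filter.1 hp).2, fun t p hp => ?_, fun t => ?_,
    fun t p hp hp1 hp2 => ?_⟩
  · have := Real.add_one_le_exp 1
    nlinarith
  · have hp' := (Finset.mem_Ioc.1 (Finset.mem_filter.1 hp).1).2
    have hp0 : (0 : ℝ) < p := by exact_mod_cast (Finset.mem_filter.1 hp).2.pos
    calc Real.log p ≤ y t := by
          rw [Real.log_le_iff_le_exp hp0]
          exact (Nat.le_floor_iff (Real.exp_pos _).le).1 hp'
      _ ≤ κ * 2 ^ t * Real.exp 1 := by
          simp only [hy]
          gcongr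
          exact inv_le_one_of_one_le₀ (hpow t)
      _ = _ := by ring
  · have hy2 : 2 * (Real.log 4 + 6) * 2 ^ t ≤ y t - 1 := by
      have := hylow t
      have := hpow t
      rw [hκ] at *
      nlinarith
    have h1 : 2 ≤ y t := by
      have := hpow t
      nlinarith
    calc _ ≤ ∑ p ∈ Finset.Ioc ⌊Real.exp (y t)⌋₊ ⌊Real.exp (y (t + 1))⌋₊ with p.Prime,
          (p : ℝ)⁻¹ := by
          refine Finset.sum_le_sum_of_subset_of_nonneg (fun p hp => ?_)
            fun p _ _ => by positivity
          simp only [Finset.mem_sdiff, Finset.mem_filter, Finset.mem_Ioc] at hp ⊢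
          refine ⟨⟨?_, hp.1.1.2⟩, hp.1.2⟩
          by_contra! h
          exact hp.2 ⟨⟨hp.1.1.1, h⟩, hp.1.2⟩
      _ ≤ _ := sum_inv_primes_floor_exp_le h1 (hymono t)
      _ = Real.log 2 - (2 ^ (t + 1))⁻¹ + (Real.log 4 + 6) / (y t - 1) := by rw [hystep]
      _ ≤ Real.log 2 - (2 ^ (t + 1))⁻¹ + (Real.log 4 + 6) / (2 * (Real.log 4 + 6) * 2 ^ t) := by
          gcongr
      _ = _ := by
          have h6 : Real.log 4 + 6 ≠ 0 := by linarith
          rw [pow_succ]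
          field_simp
          ring
  · have hp0 : (0 : ℝ) < p := by exact_mod_cast hp.pos
    refine Finset.mem_filter.2 ⟨Finset.mem_Ioc.2 ⟨hp1, ?_⟩, hp⟩
    rw [Nat.le_floor_iff (Real.exp_pos _).le, ← Real.log_le_iff_le_exp hp0]
    refine hp2.trans (le_trans ?_ (hylow t))
    exact le_mul_of_one_le_left (by positivity) (by rw [hκ]; linarith)

theorem natLog_two_sq_add_one_le {b : ℕ} (hb : 1 ≤ b) :
    ((Nat.log 2 (b ^ 2) + 1 : ℕ) : ℝ) ≤ 9 * (b : ℝ) ^ (1 / 2 : ℝ) := by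
  have hb' : (1 : ℝ) ≤ b := by exact_mod_cast hb
  have h1 := natLog_two_le (b ^ 2) (by positivity)
  have h2 : Real.log b ≤ (b : ℝ) ^ (1 / 2 : ℝ) / (1 / 2) :=
    Real.log_le_rpow_div (by linarith) (by norm_num)
  have h3 : 1 ≤ (b : ℝ) ^ (1 / 2 : ℝ) := Real.one_le_rpow hb' (by norm_num)
  push_cast at h1 ⊢
  rw [Real.log_pow] at h1
  push_cast at h1
  linarith

theorem exists_sum_divisorScales_sq_le : ∃ C : ℝ, ∀ s : Finset ℕ,
    ∑ b ∈ s, ((divisorScales (b ^ 2)).card : ℝ) / ((b ^ 2 : ℕ) : ℝ) ≤ C := by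
  have hs : Summable fun b : ℕ => 9 * (b : ℝ) ^ (-(3 / 2) : ℝ) :=
    (Real.summable_nat_rpow.2 (by norm_num)).mul_left 9
  refine ⟨∑' b : ℕ, 9 * (b : ℝ) ^ (-(3 / 2) : ℝ), fun s => ?_⟩
  refine le_trans (Finset.sum_le_sum fun b _ => ?_)
    (hs.sum_le_tsum s fun b _ => by positivity)
  rcases Nat.eq_zero_or_pos b with rfl | hb
  · norm_num
  · have hb' : (0 : ℝ) < b := by exact_mod_cast hb
    have h1 : ((divisorScales (b ^ 2)).card : ℝ) ≤ 9 * (b : ℝ) ^ (1 / 2 : ℝ) :=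
      le_trans (by exact_mod_cast card_divisorScales_le_log (b ^ 2)) (natLog_two_sq_add_one_le hb)
    rw [div_le_iff₀ (by positivity)]
    refine h1.trans (le_of_eq ?_)
    push_cast
    rw [mul_assoc, ← Real.rpow_natCast, ← Real.rpow_add hb']
    norm_num

theorem exists_sq_mul_smooth_mul_rough (Y m : ℕ) :
    ∃ x : ℕ × Finset ℕ × Finset ℕ, x.1 ^ 2 * ((∏ p ∈ x.2.1, p) * ∏ p ∈ x.2.2, p) = m ∧
      (∀ p ∈ x.2.1, p.Prime ∧ p ≤ Y) ∧ ∀ p ∈ x.2.2, p.Prime ∧ Y < p := by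
  obtain ⟨a, b, hab, ha⟩ := Nat.sq_mul_squarefree m
  refine ⟨(b, a.primeFactors.filter (· ≤ Y), a.primeFactors.filter fun p => ¬ p ≤ Y),
    ?_, fun p hp => ?_, fun p hp => ?_⟩
  · rw [Finset.prod_filter_mul_prod_filter_not, Nat.prod_primeFactors_of_squarefree ha, hab]
  · rw [Finset.mem_filter] at hp
    exact ⟨Nat.prime_of_mem_primeFactors hp.1, hp.2⟩
  · rw [Finset.mem_filter] at hp
    exact ⟨Nat.prime_of_mem_primeFactors hp.1, not_le.1 hp.2⟩

theorem card_divisorScales_mul_mul_div_le {b s r : ℕ} (h : b * (s * r) ≠ 0) :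
    ((divisorScales (b * (s * r))).card : ℝ) / ((b * (s * r) : ℕ) : ℝ)
      ≤ 4 * (((divisorScales b).card : ℝ) / b * (((divisorScales s).card : ℝ) / s
        * (((divisorScales r).card : ℝ) / r))) := by
  obtain ⟨hb, hs, hr⟩ : b ≠ 0 ∧ s ≠ 0 ∧ r ≠ 0 := by simpa using h
  have h2 : (divisorScales (b * (s * r))).card
      ≤ 4 * ((divisorScales b).card * ((divisorScales s).card * (divisorScales r).card)) := by
    calc _ ≤ 2 * (divisorScales b).card * (divisorScales (s * r)).card :=
          card_divisorScales_mul_le hb (mul_ne_zero hs hr)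
      _ ≤ 2 * (divisorScales b).card * (2 * (divisorScales s).card * (divisorScales r).card) :=
          Nat.mul_le_mul_left _ (card_divisorScales_mul_le hs hr)
      _ = _ := by ring
  calc _ ≤ ((4 * ((divisorScales b).card * ((divisorScales s).card
        * (divisorScales r).card)) : ℕ) : ℝ) / ((b * (s * r) : ℕ) : ℝ) := by
        gcongr
    _ = _ := by
        push_cast
        ring

theorem log_le_two_pow_of_lt {p H n : ℕ} (hp : 0 < p) (hpH : p < 2 ^ H) (hH : H ≤ 2 ^ n) :
    Real.log p ≤ 2 ^ n := by
  have hl2 := Real.log_two_lt_d9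
  have hl2' := Real.log_two_gt_d9
  calc Real.log p ≤ Real.log ((2 : ℝ) ^ H) :=
        Real.log_le_log (by exact_mod_cast hp) (by exact_mod_cast hpH.le)
    _ = H * Real.log 2 := Real.log_pow _ _
    _ ≤ (2 : ℝ) ^ n * 1 := by
        have : (H : ℝ) ≤ 2 ^ n := by exact_mod_cast hH
        gcongr
        linarith
    _ = _ := mul_one _

theorem sum_divisorScales_div_le_mul {Y H : ℕ} {Q : Finset ℕ}
    (hQ : ∀ p, p.Prime → Y < p → p < 2 ^ H → p ∈ Q) :
    ∑ m ∈ Finset.Ioo 0 (2 ^ H), ((divisorScales m).card : ℝ) / m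
      ≤ 4 * ((∑ b ∈ Finset.range (2 ^ H),
          ((divisorScales (b ^ 2)).card : ℝ) / ((b ^ 2 : ℕ) : ℝ))
        * ((∑ s ∈ (Finset.range (Y + 1)).powerset,
          ((divisorScales (∏ p ∈ s, p)).card : ℝ) / ((∏ p ∈ s, p : ℕ) : ℝ))
        * ∑ s ∈ Q.powerset with ∏ p ∈ s, p < 2 ^ H,
          ((divisorScales (∏ p ∈ s, p)).card : ℝ) / ((∏ p ∈ s, p : ℕ) : ℝ))) := by
  choose! φ hφ1 hφ2 hφ3 using exists_sq_mul_smooth_mul_rough Y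
  rw [Finset.sum_mul_sum, ← Finset.sum_product', Finset.sum_mul_sum, ← Finset.sum_product',
    Finset.mul_sum]
  have hm0 : ∀ m ∈ Finset.Ioo 0 (2 ^ H), m ≠ 0 := fun m hm => (Finset.mem_Ioo.1 hm).1.ne'
  refine sum_le_sum_of_injOn φ (fun m hm => ?_) (fun m hm m' hm' h => ?_) (fun m hm => ?_)
    fun x _ => by positivity
  · have h0 := hm0 m hm
    have hlt := (Finset.mem_Ioo.1 hm).2
    have h1 := hφ1 m
    have hb : (φ m).1 ^ 2 ≤ m := Nat.le_of_dvd h0.bot_lt (Dvd.intro _ h1)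
    have hs : ∏ p ∈ (φ m).2.2, p ≤ m := Nat.le_of_dvd h0.bot_lt
      (Dvd.intro_left ((φ m).1 ^ 2 * ∏ p ∈ (φ m).2.1, p) (by rw [mul_assoc]; exact h1))
    simp only [Finset.mem_product, Finset.mem_range, Finset.mem_filter, Finset.mem_powerset]
    refine ⟨((Nat.le_self_pow two_ne_zero _).trans hb).trans_lt hlt, fun p hp => ?_,
      fun p hp => ?_, hs.trans_lt hlt⟩
    · exact Finset.mem_range.2 (Nat.lt_succ_of_le (hφ2 m p hp).2)
    · obtain ⟨hp1, hp2⟩ := hφ3 m p hp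
      exact hQ p hp1 hp2 (((Nat.le_of_dvd
        (prod_primes_ne_zero fun q hq => (hφ3 m q hq).1).bot_lt
        (Finset.dvd_prod_of_mem _ hp)).trans hs).trans_lt hlt)
  · rw [← hφ1 m, ← hφ1 m', h]
  · have h0 := hm0 m hm
    have h1 := hφ1 m
    rw [← h1] at h0
    have h2 := card_divisorScales_mul_mul_div_le h0
    rw [h1] at h2
    exact h2

theorem sum_rough_divisorScales_div_le {P : ℕ → Finset ℕ} (hP0 : P 0 = ∅)
    (hPp : ∀ t, ∀ p ∈ P t, p.Prime) {K : ℝ} (hK : 1 ≤ K)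
    (hlog : ∀ t, ∀ p ∈ P t, Real.log p ≤ K * 2 ^ t)
    (hc : ∀ t, ∑ p ∈ P (t + 1) \ P t, (p : ℝ)⁻¹ ≤ Real.log 2) {H n : ℕ} (hn : 0 < n)
    (hH : H ≤ 2 ^ n) :
    ∑ s ∈ (P n).powerset with ∏ p ∈ s, p < 2 ^ H,
      ((divisorScales (∏ p ∈ s, p)).card : ℝ) / ((∏ p ∈ s, p : ℕ) : ℝ)
        ≤ 11000000 * K * ((Nat.log 2 n + 1) ^ 5
          * ((2 * Real.log 2) ^ n * (Real.exp n / (n * √n)))) := by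
  have hB : ∀ s ∈ (P n).powerset.filter fun s => ∏ p ∈ s, p < 2 ^ H,
      ((divisorScales (∏ p ∈ s, p)).card : ℝ) ≤ 1 * 2 ^ n := by
    intro s hs
    obtain ⟨hs1, hs2⟩ := Finset.mem_filter.1 hs
    have h0 : ∏ p ∈ s, p ≠ 0 := prod_primes_ne_zero fun p hp =>
      hPp n p (Finset.mem_powerset.1 hs1 hp)
    have h2 : Nat.log 2 (∏ p ∈ s, p) < H := Nat.log_lt_of_lt_pow h0 hs2
    have h3 : (divisorScales (∏ p ∈ s, p)).card ≤ 2 ^ n :=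
      ((card_divisorScales_le_log (∏ p ∈ s, p)).trans h2).trans hH
    rw [one_mul]
    exact_mod_cast h3
  have hT := sum_divisorScales_primeSets_le hP0 hPp hK hlog hc hn le_rfl
    (fun s hs => Finset.mem_powerset.1 (Finset.mem_filter.1 hs).1) hB
  refine le_trans (le_of_eq (Finset.sum_congr rfl fun s _ => ?_)) (hT.trans (le_of_eq ?_))
  · push_cast
    rw [div_eq_mul_inv, Finset.prod_inv_distrib]
  · ring

theorem exists_sum_divisorScales_div_le : ∃ C : ℝ, 0 < C ∧ ∀ H n : ℕ, 0 < n → H ≤ 2 ^ n →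
    ∑ m ∈ Finset.Ioo 0 (2 ^ H), ((divisorScales m).card : ℝ) / m
      ≤ C * ((Nat.log 2 n + 1) ^ 5 * ((2 * Real.log 2) ^ n * (Real.exp n / (n * √n)))) := by
  obtain ⟨K, Y, P, hK, hP0, hPp, hlog, hcell, hcover⟩ := exists_primeCells
  obtain ⟨C₁, hC₁⟩ := exists_sum_divisorScales_sq_le
  obtain ⟨C₂, hC₂⟩ : ∃ C₂ : ℝ, C₂ = ∑ s ∈ (Finset.range (Y + 1)).powerset,
    ((divisorScales (∏ p ∈ s, p)).card : ℝ) / ((∏ p ∈ s, p : ℕ) : ℝ) := ⟨_, rfl⟩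
  have hC₂0 : 0 ≤ C₂ := hC₂ ▸ Finset.sum_nonneg fun s _ => by positivity
  have hC₁0 : 0 ≤ C₁ := by simpa using hC₁ ∅
  refine ⟨4 * (C₁ * (C₂ * (11000000 * K))) + 1, by positivity, fun H n hn hH => ?_⟩
  have hl2 := Real.log_two_gt_d9
  have hT := sum_rough_divisorScales_div_le hP0 hPp hK hlog hcell hn hH
  have hT0 : 0 ≤ ((Nat.log 2 n : ℝ) + 1) ^ 5
    * ((2 * Real.log 2) ^ n * (Real.exp n / (n * √n))) := by positivity
  generalize ((Nat.log 2 n : ℝ) + 1) ^ 5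
    * ((2 * Real.log 2) ^ n * (Real.exp n / (n * √n))) = T at hT hT0 ⊢
  refine (sum_divisorScales_div_le_mul (Y := Y) (Q := P n) fun p hp hpY hpH =>
    hcover n p hp hpY (log_le_two_pow_of_lt hp.pos hpH hH)).trans ?_
  rw [← hC₂]
  have hS0 : 0 ≤ ∑ s ∈ (P n).powerset with ∏ p ∈ s, p < 2 ^ H,
    ((divisorScales (∏ p ∈ s, p)).card : ℝ) / ((∏ p ∈ s, p : ℕ) : ℝ) :=
    Finset.sum_nonneg fun s _ => by positivity
  have h1 := hC₁ (Finset.range (2 ^ H))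
  calc _ ≤ 4 * (C₁ * (C₂ * (11000000 * K * T))) := by
        refine mul_le_mul_of_nonneg_left ?_ (by norm_num)
        exact mul_le_mul h1 (mul_le_mul_of_nonneg_left hT hC₂0) (by positivity) hC₁0
    _ = 4 * (C₁ * (C₂ * (11000000 * K))) * T := by ring
    _ ≤ _ := by
        gcongr
        linarith

theorem log_two_mul_two_sub_erdosC :
    Real.log 2 * (2 - erdosC) = Real.log 2 + 1 + Real.log (Real.log 2) := by
  have hl2 := Real.log_two_gt_d9
  have : Real.log 2 ≠ 0 := by linarith
  unfold erdosC
  field_simp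
  ring

theorem two_sub_erdosC_pos : 0 < 2 - erdosC := by
  have hl2 := Real.log_two_gt_d9
  have h1 := Real.one_sub_inv_le_log_of_pos (by linarith : 0 < Real.log 2)
  have h2 : (Real.log 2)⁻¹ ≤ 3 / 2 := by
    rw [inv_le_comm₀ (by linarith) (by norm_num)]
    linarith
  have h3 := log_two_mul_two_sub_erdosC
  by_contra! h
  nlinarith [mul_nonneg_of_nonpos_of_nonpos (neg_nonpos.2 (by linarith : 0 ≤ Real.log 2)) h]

theorem two_mul_log_two_pow_mul_exp (n : ℕ) :
    (2 * Real.log 2) ^ n * Real.exp n = ((2 : ℝ) ^ n) ^ (2 - erdosC) := by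
  have hl2 : 0 < Real.log 2 := by linarith [Real.log_two_gt_d9]
  rw [Real.rpow_def_of_pos (by positivity), Real.log_pow, mul_assoc,
    log_two_mul_two_sub_erdosC, Real.exp_nat_mul, Real.exp_add, Real.exp_add,
    Real.exp_log (by norm_num), Real.exp_log hl2, ← mul_one (n : ℝ), Real.exp_nat_mul,
    ← mul_pow]
  congr 1
  ring

theorem natLog_two_add_one_pow_five_le {δ : ℝ} (hδ : 0 < δ) {n : ℕ} (hn : 1 ≤ n) :
    ((Nat.log 2 n : ℝ) + 1) ^ 5 ≤ (10 / δ + 1) ^ 5 * (n : ℝ) ^ δ := by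
  have hn' : (1 : ℝ) ≤ n := by exact_mod_cast hn
  have h1 := natLog_two_le n (by omega)
  have h2 : Real.log n ≤ (n : ℝ) ^ (δ / 5) / (δ / 5) :=
    Real.log_le_rpow_div (by linarith) (by positivity)
  have h3 : 1 ≤ (n : ℝ) ^ (δ / 5) := Real.one_le_rpow hn' (by positivity)
  have h4 : (n : ℝ) ^ δ = ((n : ℝ) ^ (δ / 5)) ^ 5 := by
    rw [← Real.rpow_natCast, ← Real.rpow_mul (by linarith)]
    congr 1
    push_cast
    ring
  rw [h4, ← mul_pow]
  refine pow_le_pow_left₀ (by positivity) ?_ 5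
  calc (Nat.log 2 n : ℝ) + 1 ≤ 2 * ((n : ℝ) ^ (δ / 5) / (δ / 5)) + (n : ℝ) ^ (δ / 5) := by
        linarith
    _ = _ := by field_simp; ring

theorem exists_sum_divisorScales_div_le_rpow {δ : ℝ} (hδ : 0 < δ) (hδ' : δ < 3 / 2) :
    ∃ C : ℝ, 0 < C ∧ ∀ H : ℕ, 2 ≤ H →
      ∑ m ∈ Finset.Ioo 0 (2 ^ H), ((divisorScales m).card : ℝ) / m
        ≤ C * ((H : ℝ) ^ (2 - erdosC) * Real.log H ^ (δ - 3 / 2)) := by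
  obtain ⟨C, hC, h⟩ := exists_sum_divisorScales_div_le
  have hc := two_sub_erdosC_pos
  refine ⟨C * ((10 / δ + 1) ^ 5 * 2 ^ (2 - erdosC)), by positivity, fun H hH => ?_⟩
  have hH' : (2 : ℝ) ≤ H := by exact_mod_cast hH
  set n := Nat.log 2 H + 1 with hn
  have hn0 : (0 : ℝ) < n := by exact_mod_cast (by omega : 0 < n)
  have h1 : H ≤ 2 ^ n := (Nat.lt_pow_succ_log_self one_lt_two H).le
  have h1' : (H : ℝ) ≤ 2 ^ n := by exact_mod_cast h1
  have h2 : (2 : ℝ) ^ n ≤ 2 * H := by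
    rw [hn, pow_succ, mul_comm]
    have : 2 ^ Nat.log 2 H ≤ H := Nat.pow_log_le_self 2 (by omega)
    exact mul_le_mul_of_nonneg_left (by exact_mod_cast this) (by norm_num)
  have hlogH : 0 < Real.log H := Real.log_pos (by linarith)
  have h3 : Real.log H ≤ n := by
    have h4 := Real.log_le_log (by linarith) h1'
    rw [Real.log_pow] at h4
    nlinarith [Real.log_two_lt_d9]
  refine (h H n (by omega) h1).trans ?_
  rw [mul_assoc C]
  refine mul_le_mul_of_nonneg_left ?_ hC.le
  have h5 : (n : ℝ) ^ δ / (n * √n) = (n : ℝ) ^ (δ - 3 / 2) := by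
    rw [Real.rpow_sub hn0, Real.sqrt_eq_rpow]
    congr 1
    nth_rewrite 1 [← Real.rpow_one (n : ℝ)]
    rw [← Real.rpow_add hn0]
    norm_num
  calc _ = ((Nat.log 2 n : ℝ) + 1) ^ 5 / (n * √n) * ((2 : ℝ) ^ n) ^ (2 - erdosC) := by
        rw [← two_mul_log_two_pow_mul_exp]
        ring
    _ ≤ ((10 / δ + 1) ^ 5 * (n : ℝ) ^ δ) / (n * √n) * (2 * H) ^ (2 - erdosC) := by
        have := natLog_two_add_one_pow_five_le hδ (by omega : 1 ≤ n)
        gcongr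
    _ = (10 / δ + 1) ^ 5 * 2 ^ (2 - erdosC) * (H ^ (2 - erdosC) * (n : ℝ) ^ (δ - 3 / 2)) := by
        rw [mul_div_assoc, h5, Real.mul_rpow (by norm_num) (by positivity)]
        ring
    _ ≤ _ := by
        gcongr ?_ * (?_ * ?_)
        exact Real.rpow_le_rpow_of_nonpos hlogH h3 (by linarith)

theorem sum_vonMangoldt_le {x : ℝ} {s : Finset ℕ} (hs : ∀ r ∈ s, 0 < r ∧ (r : ℝ) ≤ x)
    (hx : 0 ≤ x) : ∑ r ∈ s, ArithmeticFunction.vonMangoldt r ≤ (Real.log 4 + 4) * x := by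
  refine le_trans ?_ (Chebyshev.psi_le_const_mul_self hx)
  refine Finset.sum_le_sum_of_subset_of_nonneg (fun r hr => ?_)
    fun r _ _ => ArithmeticFunction.vonMangoldt_nonneg
  exact Finset.mem_Ioc.2 ⟨(hs r hr).1, Nat.le_floor (hs r hr).2⟩

theorem sum_vonMangoldt_div_le_card_divisorScales {i m : ℕ} {s : Finset ℕ}
    (hs : ∀ r ∈ s, ∃ d ∈ m.divisors, 2 ^ i ≤ d * r ∧ d * r < 2 ^ (i + 1)) :
    ∑ r ∈ s, ArithmeticFunction.vonMangoldt r / r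
      ≤ 4 * (Real.log 4 + 4) * (divisorScales m).card := by
  choose! d hd1 hd2 hd3 using hs
  have hmaps : ∀ r ∈ s, Nat.log 2 (d r) ∈ divisorScales m := fun r hr =>
    Finset.mem_image_of_mem _ (hd1 r hr)
  rw [← Finset.sum_fiberwise_of_maps_to hmaps]
  refine (Finset.sum_le_card_nsmul _ _ (4 * (Real.log 4 + 4)) fun ℓ _ => ?_).trans
    (le_of_eq (by rw [nsmul_eq_mul, mul_comm]))
  have hb : ∀ r ∈ s.filter fun r => Nat.log 2 (d r) = ℓ,
      0 < r ∧ (2 : ℝ) ^ i ≤ 2 ^ (ℓ + 1) * r ∧ (2 : ℝ) ^ ℓ * r ≤ 2 ^ (i + 1) := by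
    intro r hr
    obtain ⟨hr', rfl⟩ := Finset.mem_filter.1 hr
    clear hr
    have h2 := hd2 r hr'
    have h3 := hd3 r hr'
    have hd0 : d r ≠ 0 := (Nat.pos_of_mem_divisors (hd1 r hr')).ne'
    refine ⟨Nat.pos_of_ne_zero fun h => ?_, ?_, ?_⟩
    · rw [h, mul_zero] at h2
      exact absurd h2 (by simp)
    · exact_mod_cast h2.trans (Nat.mul_le_mul_right r (Nat.lt_pow_succ_log_self one_lt_two _).le)
    · exact_mod_cast (Nat.mul_le_mul_right r (Nat.pow_log_le_self 2 hd0)).trans h3.le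
  have h1 := sum_vonMangoldt_le (s := s.filter fun r => Nat.log 2 (d r) = ℓ)
    (x := 2 ^ (i + 1) / 2 ^ ℓ) (fun r hr => ⟨(hb r hr).1, by
      rw [le_div_iff₀ (by positivity), mul_comm]; exact (hb r hr).2.2⟩) (by positivity)
  calc _ ≤ ∑ r ∈ s with Nat.log 2 (d r) = ℓ,
        ArithmeticFunction.vonMangoldt r * (2 ^ (ℓ + 1) / 2 ^ i) := by
        refine Finset.sum_le_sum fun r hr => ?_
        have hr0 : (0 : ℝ) < r := by exact_mod_cast (hb r hr).1
        rw [div_eq_mul_inv]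
        refine mul_le_mul_of_nonneg_left ?_ ArithmeticFunction.vonMangoldt_nonneg
        rw [inv_le_iff_one_le_mul₀ hr0, div_mul_eq_mul_div, one_le_div (by positivity)]
        exact (hb r hr).2.1
    _ ≤ (Real.log 4 + 4) * (2 ^ (i + 1) / 2 ^ ℓ) * (2 ^ (ℓ + 1) / 2 ^ i) := by
        rw [← Finset.sum_mul]
        gcongr
    _ = _ := by
        rw [pow_succ, pow_succ]
        field_simp
        ring

/-- The products `d * e` with `d ∈ [2 ^ i, 2 ^ (i + 1))` and `e ∈ [2 ^ j, 2 ^ (j + 1))`. -/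
def dyadicProducts (i j : ℕ) : Finset ℕ :=
  (Finset.Ico (2 ^ i) (2 ^ (i + 1)) ×ˢ Finset.Ico (2 ^ j) (2 ^ (j + 1))).image fun x => x.1 * x.2

theorem card_dyadicProducts_le (i j : ℕ) : (dyadicProducts i j).card ≤ 2 ^ (i + j) := by
  refine Finset.card_image_le.trans (le_of_eq ?_)
  have h : ∀ k, 2 ^ (k + 1) - 2 ^ k = 2 ^ k := fun k => by rw [pow_succ]; omega
  rw [Finset.card_product, Nat.card_Ico, Nat.card_Ico, h, h, pow_add]

theorem exists_of_mem_dyadicProducts {i j n : ℕ} (hn : n ∈ dyadicProducts i j) :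
    ∃ d e, d * e = n ∧ (2 ^ i ≤ d ∧ d < 2 ^ (i + 1)) ∧ 2 ^ j ≤ e ∧ e < 2 ^ (j + 1) := by
  obtain ⟨x, hx, rfl⟩ := Finset.mem_image.1 hn
  simp only [Finset.mem_product, Finset.mem_Ico] at hx
  exact ⟨x.1, x.2, rfl, hx⟩

theorem mul_log_two_le_sum_vonMangoldt_divisors {i d : ℕ} (h : 2 ^ i ≤ d) :
    i * Real.log 2 ≤ ∑ r ∈ d.divisors, ArithmeticFunction.vonMangoldt r := by
  rw [ArithmeticFunction.vonMangoldt_sum, ← Real.log_pow]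
  exact Real.log_le_log (by positivity) (by exact_mod_cast h)

theorem mul_card_dyadicProducts_le (i j : ℕ) :
    (i * Real.log 2) * (j * Real.log 2) * (dyadicProducts i j).card
      ≤ 4 * (Real.log 4 + 4) ^ 2 * 2 ^ (i + j + 2)
        * ∑ m ∈ Finset.Ioo 0 (2 ^ (i + j + 2)), ((divisorScales m).card : ℝ) / m := by
  classical
  have hl4 : 0 ≤ Real.log 4 := Real.log_nonneg (by norm_num)
  have hl2 : 0 ≤ Real.log 2 := Real.log_nonneg (by norm_num)
  have hΛ : ∀ r, 0 ≤ ArithmeticFunction.vonMangoldt r := fun r =>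
    ArithmeticFunction.vonMangoldt_nonneg
  set W := i + j + 2 with hW
  choose! d e hde hd he using fun n (hn : n ∈ dyadicProducts i j) =>
    exists_of_mem_dyadicProducts hn
  set R : ℕ → Finset ℕ := fun m => (Finset.Ico 1 (2 ^ W)).filter fun r =>
    ∃ d ∈ m.divisors, 2 ^ i ≤ d * r ∧ d * r < 2 ^ (i + 1) with hR
  set S : ℕ → ℕ → Finset ℕ := fun m r =>
    (Finset.Ico 1 (2 ^ W)).filter fun s => m * r * s ≤ 2 ^ W with hS
  calc (i * Real.log 2) * (j * Real.log 2) * (dyadicProducts i j).card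
      ≤ ∑ n ∈ dyadicProducts i j, (∑ r ∈ (d n).divisors, ArithmeticFunction.vonMangoldt r)
          * ∑ s ∈ (e n).divisors, ArithmeticFunction.vonMangoldt s := by
        rw [mul_comm, ← nsmul_eq_mul]
        refine Finset.card_nsmul_le_sum _ _ _ fun n hn => ?_
        exact mul_le_mul (mul_log_two_le_sum_vonMangoldt_divisors (hd n hn).1)
          (mul_log_two_le_sum_vonMangoldt_divisors (he n hn).1) (by positivity)
          (Finset.sum_nonneg fun r _ => hΛ r)
    _ = ∑ x ∈ (dyadicProducts i j).sigma fun n => (d n).divisors ×ˢ (e n).divisors,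
          ArithmeticFunction.vonMangoldt x.2.1 * ArithmeticFunction.vonMangoldt x.2.2 := by
        rw [Finset.sum_sigma]
        refine Finset.sum_congr rfl fun n _ => ?_
        rw [Finset.sum_mul_sum, Finset.sum_product]
    _ ≤ ∑ y ∈ (Finset.Ioo 0 (2 ^ W)).sigma fun m => (R m).sigma fun r => S m r,
          ArithmeticFunction.vonMangoldt y.2.1 * ArithmeticFunction.vonMangoldt y.2.2 := by
        refine sum_le_sum_of_injOn
          (fun x => ⟨x.1 / (x.2.1 * x.2.2), x.2.1, x.2.2⟩) ?_ ?_ (fun x _ => le_rfl)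
          fun y _ => mul_nonneg (hΛ _) (hΛ _)
        · rintro ⟨n, r, s⟩ hx
          simp only [Finset.mem_sigma, Finset.mem_product, Nat.mem_divisors] at hx
          obtain ⟨hn, ⟨⟨a, ha⟩, hd0⟩, ⟨b, hb⟩, he0⟩ := hx
          have hr0 : r ≠ 0 := by rintro rfl; simp at ha; exact hd0 ha
          have hs0 : s ≠ 0 := by rintro rfl; simp at hb; exact he0 hb
          have ha0 : a ≠ 0 := by rintro rfl; simp at ha; exact hd0 ha
          have hb0 : b ≠ 0 := by rintro rfl; simp at hb; exact he0 hb
          have hnab : n = r * s * (a * b) := by rw [← hde n hn, ha, hb]; ring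
          have hm : n / (r * s) = a * b := by
            rw [hnab]; exact Nat.mul_div_cancel_left _ (by positivity)
          have hnW : n < 2 ^ W := by
            rw [← hde n hn, hW, show i + j + 2 = (i + 1) + (j + 1) by ring, pow_add]
            exact Nat.mul_lt_mul'' (hd n hn).2 (he n hn).2
          have hdvd : ∀ k, k ∣ n → k < 2 ^ W := fun k hk =>
            (Nat.le_of_dvd (by rw [hnab]; positivity) hk).trans_lt hnW
          simp only [Finset.mem_sigma, hm, hR, hS, Finset.mem_filter, Finset.mem_Ico,
            Finset.mem_Ioo, Nat.one_le_iff_ne_zero]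
          refine ⟨⟨by positivity, hdvd _ ⟨r * s, by rw [hnab]; ring⟩⟩,
            ⟨⟨hr0, hdvd _ ⟨s * (a * b), by rw [hnab]; ring⟩⟩, a, ?_, ?_, ?_⟩,
            ⟨hs0, hdvd _ ⟨r * (a * b), by rw [hnab]; ring⟩⟩, ?_⟩
          · exact Nat.mem_divisors.2 ⟨Dvd.intro _ rfl, mul_ne_zero ha0 hb0⟩
          · rw [mul_comm, ← ha]; exact (hd n hn).1
          · rw [mul_comm, ← ha]; exact (hd n hn).2
          · rw [show a * b * r * s = n by rw [hnab]; ring]; exact hnW.le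
        · rintro ⟨n, r, s⟩ hx ⟨n', r', s'⟩ hx' h
          simp only [Finset.mem_coe, Finset.mem_sigma, Finset.mem_product,
            Nat.mem_divisors] at hx hx'
          simp only [Sigma.mk.injEq, heq_eq_eq] at h
          obtain ⟨h1, rfl, rfl⟩ := h
          have hd1 : r * s ∣ n := by
            rw [← hde n hx.1]; exact Nat.mul_dvd_mul hx.2.1.1 hx.2.2.1
          have hd2 : r * s ∣ n' := by
            rw [← hde n' hx'.1]; exact Nat.mul_dvd_mul hx'.2.1.1 hx'.2.2.1
          rw [Nat.div_left_inj hd1 hd2] at h1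
          rw [h1]
    _ = ∑ m ∈ Finset.Ioo 0 (2 ^ W), ∑ r ∈ R m, ArithmeticFunction.vonMangoldt r
          * ∑ s ∈ S m r, ArithmeticFunction.vonMangoldt s := by
        rw [Finset.sum_sigma]
        refine Finset.sum_congr rfl fun m _ => ?_
        rw [Finset.sum_sigma]
        exact Finset.sum_congr rfl fun r _ => by rw [Finset.mul_sum]
    _ ≤ ∑ m ∈ Finset.Ioo 0 (2 ^ W), ((Real.log 4 + 4) * 2 ^ W / m)
          * ∑ r ∈ R m, ArithmeticFunction.vonMangoldt r / r := by
        refine Finset.sum_le_sum fun m hm => ?_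
        rw [Finset.mul_sum]
        refine Finset.sum_le_sum fun r hr => ?_
        have hm0 : (0 : ℝ) < m := by exact_mod_cast (Finset.mem_Ioo.1 hm).1
        have hr0 : (0 : ℝ) < r := by
          exact_mod_cast (Finset.mem_Ico.1 (Finset.mem_filter.1 hr).1).1
        have h1 := sum_vonMangoldt_le (s := S m r) (x := 2 ^ W / (m * r)) (fun s hs => by
          obtain ⟨h2, h3⟩ := Finset.mem_filter.1 hs
          refine ⟨(Finset.mem_Ico.1 h2).1, ?_⟩
          rw [le_div_iff₀ (by positivity), mul_comm]
          exact_mod_cast h3) (by positivity)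
        calc _ ≤ ArithmeticFunction.vonMangoldt r * ((Real.log 4 + 4) * (2 ^ W / (m * r))) :=
              mul_le_mul_of_nonneg_left h1 (hΛ r)
          _ = _ := by field_simp
    _ ≤ ∑ m ∈ Finset.Ioo 0 (2 ^ W), ((Real.log 4 + 4) * 2 ^ W / m)
          * (4 * (Real.log 4 + 4) * (divisorScales m).card) := by
        refine Finset.sum_le_sum fun m _ => ?_
        refine mul_le_mul_of_nonneg_left ?_ (by positivity)
        exact sum_vonMangoldt_div_le_card_divisorScales fun r hr => (Finset.mem_filter.1 hr).2
    _ = _ := by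
        rw [Finset.mul_sum]
        exact Finset.sum_congr rfl fun m _ => by ring

/-- The density `h ^ (-c) (log h) ^ (δ - 3 / 2)` of the multiplication table at scale `2 ^ h`. -/
noncomputable def tableDensity (δ : ℝ) (h : ℕ) : ℝ :=
  (h : ℝ) ^ (-erdosC) * Real.log h ^ (δ - 3 / 2)

theorem tableDensity_pos {δ : ℝ} {h : ℕ} (hh : 2 ≤ h) : 0 < tableDensity δ h := by
  have hh' : (2 : ℝ) ≤ h := by exact_mod_cast hh
  have hlog : 0 < Real.log h := Real.log_pos (by linarith)
  unfold tableDensity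
  positivity

theorem exists_pow_le_mul_pow (k : ℕ) {b : ℝ} (hb : 1 < b) :
    ∃ C : ℝ, 0 < C ∧ ∀ n : ℕ, (n : ℝ) ^ k ≤ C * b ^ n := by
  obtain ⟨C, hC⟩ := (tendsto_pow_const_div_const_pow_of_one_lt k hb).bddAbove_range
  refine ⟨max C 1, by positivity, fun n => ?_⟩
  rw [← div_le_iff₀ (by positivity)]
  exact (hC (Set.mem_range_self n)).trans (le_max_left _ _)

theorem exists_one_le_mul_tableDensity_mul_pow {δ : ℝ} (hδ : 0 < δ) (hδ' : δ < 3 / 2) :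
    ∃ C : ℝ, 0 < C ∧ ∀ h : ℕ, 2 ≤ h → ∀ k : ℕ, h ≤ 2 * k →
      1 ≤ C * tableDensity δ h * (5 / 4) ^ k := by
  obtain ⟨C, hC, hb⟩ := exists_pow_le_mul_pow 4 (by norm_num : (1 : ℝ) < 5 / 4)
  refine ⟨C * 2 ^ 4, by positivity, fun h hh k hk => ?_⟩
  have hh' : (2 : ℝ) ≤ h := by exact_mod_cast hh
  have hh0 : (0 : ℝ) < h := by linarith
  have hlog : 0 < Real.log h := Real.log_pos (by linarith)
  have h1 : (h : ℝ) ^ (δ - 3 / 2) ≤ Real.log h ^ (δ - 3 / 2) :=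
    Real.rpow_le_rpow_of_nonpos hlog ((Real.log_le_sub_one_of_pos hh0).trans (by linarith))
      (by linarith)
  have h2 : (h : ℝ) ^ (-4 : ℝ) ≤ tableDensity δ h := by
    calc (h : ℝ) ^ (-4 : ℝ) ≤ (h : ℝ) ^ (-erdosC + (δ - 3 / 2)) := by
          refine Real.rpow_le_rpow_of_exponent_le (by linarith) ?_
          linarith [two_sub_erdosC_pos]
      _ = (h : ℝ) ^ (-erdosC) * (h : ℝ) ^ (δ - 3 / 2) := Real.rpow_add hh0 _ _
      _ ≤ _ := mul_le_mul_of_nonneg_left h1 (by positivity)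
  have h3 : (h : ℝ) ^ (-4 : ℝ) = ((h : ℝ) ^ 4)⁻¹ := by
    rw [Real.rpow_neg hh0.le]
    norm_cast
  have hk' : (h : ℝ) ≤ 2 * k := by exact_mod_cast hk
  calc (1 : ℝ) = ((h : ℝ) ^ 4) * ((h : ℝ) ^ 4)⁻¹ := (mul_inv_cancel₀ (by positivity)).symm
    _ ≤ (2 * k) ^ 4 * tableDensity δ h := by rw [← h3]; gcongr
    _ = 2 ^ 4 * tableDensity δ h * (k : ℝ) ^ 4 := by ring
    _ ≤ 2 ^ 4 * tableDensity δ h * (C * (5 / 4) ^ k) := by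
        have := tableDensity_pos (δ := δ) hh
        gcongr
        exact hb k
    _ = _ := by ring

theorem exists_card_dyadicProducts_le_of_le {δ : ℝ} (hδ : 0 < δ) (hδ' : δ < 3 / 2) :
    ∃ C : ℝ, 0 < C ∧ ∀ h : ℕ, 2 ≤ h → ∀ i ≤ h, ∀ j ≤ h, h ≤ 2 * i → h ≤ 2 * j →
      ((dyadicProducts i j).card : ℝ) ≤ C * tableDensity δ h * 2 ^ (i + j) := by
  obtain ⟨C, hC, hsum⟩ := exists_sum_divisorScales_div_le_rpow hδ hδ'
  have hc := two_sub_erdosC_pos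
  have hl2 := Real.log_two_gt_d9
  have hl4 : 0 ≤ Real.log 4 := Real.log_nonneg (by norm_num)
  refine ⟨64 * (Real.log 4 + 4) ^ 2 * C * 3 ^ (2 - erdosC) / Real.log 2 ^ 2, by positivity,
    fun h hh i hi j hj hi' hj' => ?_⟩
  have hh' : (2 : ℝ) ≤ h := by exact_mod_cast hh
  have hlog : 0 < Real.log h := Real.log_pos (by linarith)
  have h1 := mul_card_dyadicProducts_le i j
  have h2 : ∑ m ∈ Finset.Ioo 0 (2 ^ (i + j + 2)), ((divisorScales m).card : ℝ) / m
      ≤ C * 3 ^ (2 - erdosC) * ((h : ℝ) ^ 2 * tableDensity δ h) := by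
    calc _ ≤ ∑ m ∈ Finset.Ioo 0 (2 ^ (3 * h)), ((divisorScales m).card : ℝ) / m := by
          refine Finset.sum_le_sum_of_subset_of_nonneg (fun m hm => ?_) fun m _ _ => by positivity
          rw [Finset.mem_Ioo] at hm ⊢
          refine ⟨hm.1, hm.2.trans_le ?_⟩
          exact Nat.pow_le_pow_right two_pos (by omega)
      _ ≤ _ := hsum (3 * h) (by omega)
      _ ≤ C * ((3 * h) ^ (2 - erdosC) * Real.log h ^ (δ - 3 / 2)) := by
          push_cast
          gcongr ?_ * (?_ * ?_)
          refine Real.rpow_le_rpow_of_nonpos hlog ?_ (by linarith)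
          exact Real.log_le_log (by linarith) (by linarith)
      _ = _ := by
          rw [Real.mul_rpow (by norm_num) (by linarith), tableDensity, sub_eq_add_neg 2,
            Real.rpow_add (x := (h : ℝ)) (by linarith)]
          norm_cast
          ring
  have hi2 : (h : ℝ) / 2 ≤ i := by
    have : (h : ℝ) ≤ 2 * i := by exact_mod_cast hi'
    linarith
  have hj2 : (h : ℝ) / 2 ≤ j := by
    have : (h : ℝ) ≤ 2 * j := by exact_mod_cast hj'
    linarith
  have h3 : (h : ℝ) ^ 2 * (Real.log 2 ^ 2 / 4 * (dyadicProducts i j).card)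
      ≤ (h : ℝ) ^ 2 * (16 * (Real.log 4 + 4) ^ 2 * 2 ^ (i + j) * (C * 3 ^ (2 - erdosC)
        * tableDensity δ h)) := by
    calc _ = (h / 2 * Real.log 2) * (h / 2 * Real.log 2) * (dyadicProducts i j).card := by ring
      _ ≤ (i * Real.log 2) * (j * Real.log 2) * (dyadicProducts i j).card := by gcongr
      _ ≤ _ := h1
      _ ≤ 4 * (Real.log 4 + 4) ^ 2 * 2 ^ (i + j + 2)
          * (C * 3 ^ (2 - erdosC) * ((h : ℝ) ^ 2 * tableDensity δ h)) := by gcongr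
      _ = _ := by rw [pow_add 2 (i + j) 2]; ring
  have h4 := le_of_mul_le_mul_left h3 (by positivity)
  have h5 : 0 < Real.log 2 ^ 2 / 4 := by positivity
  calc _ ≤ (16 * (Real.log 4 + 4) ^ 2 * 2 ^ (i + j) * (C * 3 ^ (2 - erdosC)
        * tableDensity δ h)) / (Real.log 2 ^ 2 / 4) := by
        rw [le_div_iff₀ h5, mul_comm]; exact h4
    _ = _ := by field_simp; ring

theorem exists_card_dyadicProducts_le {δ : ℝ} (hδ : 0 < δ) (hδ' : δ < 3 / 2) :
    ∃ C : ℝ, 0 < C ∧ ∀ h : ℕ, 2 ≤ h → ∀ i ≤ h, ∀ j ≤ h,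
      ((dyadicProducts i j).card : ℝ)
        ≤ C * tableDensity δ h * (2 ^ (i + j) * (5 / 4) ^ (h - i + (h - j))) := by
  obtain ⟨C₁, hC₁, h1⟩ := exists_card_dyadicProducts_le_of_le hδ hδ'
  obtain ⟨C₂, hC₂, h2⟩ := exists_one_le_mul_tableDensity_mul_pow hδ hδ'
  refine ⟨C₁ + C₂, by positivity, fun h hh i hi j hj => ?_⟩
  have hD := tableDensity_pos (δ := δ) hh
  by_cases hij : h ≤ 2 * i ∧ h ≤ 2 * j
  · refine (h1 h hh i hi j hj hij.1 hij.2).trans ?_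
    have h3 : (1 : ℝ) ≤ (5 / 4) ^ (h - i + (h - j)) := one_le_pow₀ (by norm_num)
    gcongr
    · linarith
    · exact le_mul_of_one_le_right (by positivity) h3
  · have h3 : ((dyadicProducts i j).card : ℝ) ≤ 2 ^ (i + j) := by
      exact_mod_cast card_dyadicProducts_le i j
    have h4 := h2 h hh (h - i + (h - j)) (by omega)
    calc _ ≤ (2 : ℝ) ^ (i + j) * 1 := by rwa [mul_one]
      _ ≤ 2 ^ (i + j) * (C₂ * tableDensity δ h * (5 / 4) ^ (h - i + (h - j))) := by gcongr
      _ = C₂ * tableDensity δ h * (2 ^ (i + j) * (5 / 4) ^ (h - i + (h - j))) := by ring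
      _ ≤ _ := by
          gcongr
          linarith

/-- The `α ∈ [1 / K, K]` for which `α a b` is within `η` of `c d` for some positive integers
`a, b, c, d < 2 ^ (h + 1)`. -/
def nearProducts (K : ℝ) (h : ℕ) (η : ℝ) : Set ℝ :=
  {α | α ∈ Set.Icc K⁻¹ K ∧ ∃ a b c d : ℕ, (0 < a ∧ a < 2 ^ (h + 1)) ∧ (0 < b ∧ b < 2 ^ (h + 1)) ∧
    (0 < c ∧ c < 2 ^ (h + 1)) ∧ (0 < d ∧ d < 2 ^ (h + 1)) ∧
    |α * ((a * b : ℕ) : ℝ) - ((c * d : ℕ) : ℝ)| ≤ η}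

theorem sum_sqrt_two_pow_mul_le (h : ℕ) :
    ∑ i ∈ Finset.range (h + 1), √2 ^ i * (5 / 4) ^ (h - i) ≤ 10 * √2 ^ h := by
  have hs : (7 / 5 : ℝ) ≤ √2 := Real.le_sqrt_of_sq_le (by norm_num)
  calc _ ≤ ∑ i ∈ Finset.range (h + 1), √2 ^ h * (9 / 10) ^ (h - i) := by
        refine Finset.sum_le_sum fun i hi => ?_
        have hi' : i ≤ h := Nat.lt_succ_iff.1 (Finset.mem_range.1 hi)
        calc √2 ^ i * (5 / 4) ^ (h - i) ≤ √2 ^ i * (√2 * (9 / 10)) ^ (h - i) := by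
              gcongr
              linarith
          _ = √2 ^ (i + (h - i)) * (9 / 10) ^ (h - i) := by rw [mul_pow, pow_add]; ring
          _ = _ := by rw [Nat.add_sub_cancel' hi']
    _ = √2 ^ h * ∑ i ∈ Finset.range (h + 1), (9 / 10) ^ i := by
        rw [← Finset.mul_sum]
        congr 1
        exact Finset.sum_range_reflect (fun i => (9 / 10 : ℝ) ^ i) (h + 1)
    _ ≤ √2 ^ h * 10 := by
        gcongr
        rw [geom_sum_eq (by norm_num)]
        have : (0 : ℝ) ≤ (9 / 10) ^ (h + 1) := by positivity
        rw [div_le_iff_of_neg (by norm_num)]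
        linarith
    _ = _ := mul_comm _ _

theorem measureReal_near_le {K η : ℝ} (hK : 1 ≤ K) (hη : 0 < η) (hη' : η ≤ 1) {i j k l p q : ℕ}
    (hp : p ∈ dyadicProducts i j) (hq : q ∈ dyadicProducts k l) :
    volume.real {α : ℝ | α ∈ Set.Icc K⁻¹ K ∧ |α * p - q| ≤ η}
      ≤ 16 * K * η / (√2 ^ (i + j) * √2 ^ (k + l)) := by
  obtain ⟨a, b, rfl, ha, hb⟩ := exists_of_mem_dyadicProducts hp
  obtain ⟨c, d, rfl, hc, hd⟩ := exists_of_mem_dyadicProducts hq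
  set A := {α : ℝ | α ∈ Set.Icc K⁻¹ K ∧ |α * ((a * b : ℕ) : ℝ) - ((c * d : ℕ) : ℝ)| ≤ η} with hA
  rcases A.eq_empty_or_nonempty with h | ⟨α, hα, hαη⟩
  · rw [h, measureReal_empty]
    positivity
  set p := a * b with hpdef
  set q := c * d with hqdef
  have hs2 : √2 ^ 2 = 2 := Real.sq_sqrt (by norm_num)
  have hp1 : (2 : ℝ) ^ (i + j) ≤ p := by
    rw [pow_add]; exact_mod_cast Nat.mul_le_mul ha.1 hb.1
  have hp2 : (p : ℝ) ≤ 4 * 2 ^ (i + j) := by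
    have : p ≤ 2 ^ (i + 1) * 2 ^ (j + 1) := Nat.mul_le_mul ha.2.le hb.2.le
    calc (p : ℝ) ≤ 2 ^ (i + 1) * 2 ^ (j + 1) := by exact_mod_cast this
      _ = _ := by ring
  have hq1 : (2 : ℝ) ^ (k + l) ≤ q := by
    rw [pow_add]; exact_mod_cast Nat.mul_le_mul hc.1 hd.1
  have hpow1 : (1 : ℝ) ≤ 2 ^ (i + j) := one_le_pow₀ (by norm_num)
  have hp0 : (0 : ℝ) < p := by linarith
  have hqp : (q : ℝ) ≤ 2 * K * p := by
    have h1 := (abs_le.1 hαη).1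
    have h2 : α * p ≤ K * p := mul_le_mul_of_nonneg_right hα.2 hp0.le
    have h3 : 1 ≤ K * p := by nlinarith
    linarith
  have hs : √2 ^ (k + l) ≤ 8 * K * √2 ^ (i + j) := by
    rw [← pow_le_pow_iff_left₀ (by positivity) (by positivity) two_ne_zero]
    calc (√2 ^ (k + l)) ^ 2 = 2 ^ (k + l) := by rw [← pow_mul, mul_comm, pow_mul, hs2]
      _ ≤ 8 * K * 2 ^ (i + j) := by nlinarith
      _ ≤ (8 * K) ^ 2 * 2 ^ (i + j) := by
          gcongr
          nlinarith
      _ = (8 * K * √2 ^ (i + j)) ^ 2 := by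
          rw [mul_pow _ (√2 ^ (i + j)), ← pow_mul √2, mul_comm (i + j) 2, pow_mul √2, hs2]
  have hsub : A ⊆ Set.Icc ((q - η) / p) ((q + η) / p) := by
    rintro β ⟨_, hβ⟩
    rw [abs_le] at hβ
    constructor
    · rw [div_le_iff₀ hp0]; linarith
    · rw [le_div_iff₀ hp0]; linarith
  calc volume.real A ≤ volume.real (Set.Icc ((q - η) / p) ((q + η) / p)) :=
        measureReal_mono hsub (by simp)
    _ = 2 * η / p := by
        rw [Real.volume_real_Icc_of_le (by gcongr; linarith)]
        ring
    _ ≤ 2 * η / 2 ^ (i + j) := by gcongr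
    _ = 2 * η / (√2 ^ (i + j) * √2 ^ (i + j)) := by rw [← mul_pow, Real.mul_self_sqrt (by norm_num)]
    _ ≤ _ := by
        rw [div_le_div_iff₀ (by positivity) (by positivity)]
        calc 2 * η * (√2 ^ (i + j) * √2 ^ (k + l))
            ≤ 2 * η * (√2 ^ (i + j) * (8 * K * √2 ^ (i + j))) := by gcongr
          _ = _ := by ring

theorem exists_measureReal_nearProducts_le {δ : ℝ} (hδ : 0 < δ) (hδ' : δ < 3 / 2) {K : ℝ}
    (hK : 1 ≤ K) : ∃ C : ℝ, 0 < C ∧ ∀ h : ℕ, 2 ≤ h → ∀ η : ℝ, 0 < η → η ≤ 1 →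
      volume (nearProducts K h η) ≤ ENNReal.ofReal (C * η * 4 ^ h * tableDensity δ h ^ 2) := by
  obtain ⟨C, hC, hcard⟩ := exists_card_dyadicProducts_le hδ hδ'
  refine ⟨160000 * K * C ^ 2, by positivity, fun h hh η hη hη' => ?_⟩
  have hD := tableDensity_pos (δ := δ) hh
  set A : ℕ → ℕ → Set ℝ := fun p q => {α : ℝ | α ∈ Set.Icc K⁻¹ K ∧ |α * p - q| ≤ η} with hA
  set R := Finset.range (h + 1) with hR
  set U : (ℕ × ℕ) × ℕ × ℕ → Set ℝ := fun x =>
    ⋃ y ∈ dyadicProducts x.1.1 x.1.2 ×ˢ dyadicProducts x.2.1 x.2.2, A y.1 y.2 with hU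
  have hUIcc : ⋃ x ∈ (R ×ˢ R) ×ˢ R ×ˢ R, U x ⊆ Set.Icc K⁻¹ K := by
    refine Set.iUnion₂_subset fun x _ => Set.iUnion₂_subset fun y _ => fun α hα => hα.1
  have hfin : volume (⋃ x ∈ (R ×ˢ R) ×ˢ R ×ˢ R, U x) ≠ ⊤ :=
    ((measure_mono hUIcc).trans_lt (by simp)).ne
  have hsub : nearProducts K h η ⊆ ⋃ x ∈ (R ×ˢ R) ×ˢ R ×ˢ R, U x := by
    rintro α ⟨hα, a, b, c, d, ha, hb, hc, hd, habs⟩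
    have hlog : ∀ a : ℕ, 0 < a ∧ a < 2 ^ (h + 1) → Nat.log 2 a ∈ R ∧
        a ∈ Finset.Ico (2 ^ Nat.log 2 a) (2 ^ (Nat.log 2 a + 1)) := fun a ha =>
      ⟨Finset.mem_range.2 (Nat.log_lt_of_lt_pow ha.1.ne' ha.2),
        Finset.mem_Ico.2 ⟨Nat.pow_log_le_self 2 ha.1.ne', Nat.lt_pow_succ_log_self one_lt_two a⟩⟩
    refine Set.mem_iUnion₂.2 ⟨((Nat.log 2 a, Nat.log 2 b), Nat.log 2 c, Nat.log 2 d), ?_,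
      Set.mem_iUnion₂.2 ⟨(a * b, c * d), ?_, hα, habs⟩⟩
    · simp only [Finset.mem_product]
      exact ⟨⟨(hlog a ha).1, (hlog b hb).1⟩, (hlog c hc).1, (hlog d hd).1⟩
    · exact Finset.mem_product.2
        ⟨Finset.mem_image.2 ⟨(a, b), Finset.mem_product.2 ⟨(hlog a ha).2, (hlog b hb).2⟩, rfl⟩,
          Finset.mem_image.2 ⟨(c, d), Finset.mem_product.2 ⟨(hlog c hc).2, (hlog d hd).2⟩, rfl⟩⟩
  set w : ℕ → ℝ := fun i => √2 ^ i * (5 / 4) ^ (h - i) with hw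
  have hw0 : ∀ i, 0 ≤ w i := fun i => by positivity
  have hUx : ∀ x ∈ (R ×ˢ R) ×ˢ R ×ˢ R, volume.real (U x)
      ≤ 16 * K * η * C ^ 2 * tableDensity δ h ^ 2
        * (w x.1.1 * w x.1.2 * (w x.2.1 * w x.2.2)) := by
    rintro ⟨⟨i, j⟩, k, l⟩ hx
    simp only [Finset.mem_product, hR, Finset.mem_range, Nat.lt_succ_iff] at hx
    have h1 := hcard h hh i hx.1.1 j hx.1.2
    have h2 := hcard h hh k hx.2.1 l hx.2.2
    have h3 : volume.real (U ((i, j), k, l))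
        ≤ ((dyadicProducts i j).card * (dyadicProducts k l).card)
          * (16 * K * η / (√2 ^ (i + j) * √2 ^ (k + l))) := by
      refine (measureReal_biUnion_finset_le _ _).trans ?_
      refine (Finset.sum_le_card_nsmul _ _ (16 * K * η / (√2 ^ (i + j) * √2 ^ (k + l)))
        fun y hy => ?_).trans (le_of_eq (by rw [nsmul_eq_mul, Finset.card_product]; push_cast; rfl))
      rw [Finset.mem_product] at hy
      exact measureReal_near_le hK hη hη' hy.1 hy.2
    have hpow : ∀ n : ℕ, (2 : ℝ) ^ n = √2 ^ n * √2 ^ n := fun n => by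
      rw [← mul_pow, Real.mul_self_sqrt (by norm_num)]
    calc _ ≤ _ := h3
      _ ≤ ((C * tableDensity δ h * (2 ^ (i + j) * (5 / 4) ^ (h - i + (h - j))))
          * (C * tableDensity δ h * (2 ^ (k + l) * (5 / 4) ^ (h - k + (h - l)))))
          * (16 * K * η / (√2 ^ (i + j) * √2 ^ (k + l))) := by gcongr
      _ = _ := by
          rw [hpow, hpow]
          simp only [hw, pow_add]
          field_simp
  have hreal : volume.real (⋃ x ∈ (R ×ˢ R) ×ˢ R ×ˢ R, U x)
      ≤ 160000 * K * C ^ 2 * η * 4 ^ h * tableDensity δ h ^ 2 := by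
    refine (measureReal_biUnion_finset_le _ _).trans ((Finset.sum_le_sum hUx).trans ?_)
    rw [← Finset.mul_sum]
    have hsum : ∑ x ∈ (R ×ˢ R) ×ˢ R ×ˢ R, (w x.1.1 * w x.1.2 * (w x.2.1 * w x.2.2))
        = (∑ i ∈ R, w i) ^ 4 := by
      rw [show (∑ i ∈ R, w i) ^ 4 = (∑ i ∈ R, w i) * (∑ i ∈ R, w i)
        * ((∑ i ∈ R, w i) * ∑ i ∈ R, w i) by ring, Finset.sum_mul_sum, ← Finset.sum_product',
        Finset.sum_mul_sum, ← Finset.sum_product']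
    have h0 : 0 ≤ ∑ i ∈ R, w i := Finset.sum_nonneg fun i _ => hw0 i
    have h4 : (√2 ^ h) ^ 4 = 4 ^ h := by
      rw [← pow_mul, mul_comm, pow_mul, show (4 : ℕ) = 2 * 2 by rfl, pow_mul √2,
        Real.sq_sqrt (by norm_num)]
      norm_num
    rw [hsum]
    calc _ ≤ 16 * K * η * C ^ 2 * tableDensity δ h ^ 2 * (10 * √2 ^ h) ^ 4 := by
          gcongr
          exact sum_sqrt_two_pow_mul_le h
      _ = _ := by rw [mul_pow 10, h4]; ring
  refine (measure_mono hsub).trans ?_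
  rw [← ofReal_measureReal hfin]
  exact ENNReal.ofReal_le_ofReal hreal

theorem one_le_L (x : ℝ) : 1 ≤ L x := le_max_left _ _

theorem L_mono {x y : ℝ} (hx : 0 < x) (hxy : x ≤ y) : L x ≤ L y :=
  max_le_max_left _ (Real.log_le_log hx hxy)

theorem L_eq_log {x : ℝ} (hx : Real.exp 1 ≤ x) : L x = Real.log x :=
  max_eq_right ((Real.le_log_iff_exp_le ((Real.exp_pos 1).trans_le hx)).2 hx)

theorem summable_inv_mul_L_rpow {ρ : ℝ} (hρ : 0 < ρ) :
    Summable fun h : ℕ => (h : ℝ)⁻¹ * L h ^ (-(1 + ρ)) := by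
  rw [← summable_condensed_iff_of_nonneg]
  · have hs := ((Real.summable_nat_rpow (p := -(1 + ρ))).2 (by linarith)).mul_left
      (Real.log 2 ^ (-(1 + ρ)))
    refine Summable.of_norm_bounded_eventually_nat hs ?_
    filter_upwards [eventually_ge_atTop 1] with k hk
    have hL : (1 : ℝ) ≤ L ((2 ^ k : ℕ) : ℝ) := one_le_L _
    have hlog2 := Real.log_pos one_lt_two
    have hk' : (1 : ℝ) ≤ k := by exact_mod_cast hk
    rw [Real.norm_of_nonneg (by positivity), ← mul_assoc]
    push_cast at hL ⊢
    rw [mul_inv_cancel₀ (by positivity), one_mul,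
      ← Real.mul_rpow hlog2.le (by positivity)]
    refine Real.rpow_le_rpow_of_nonpos (by positivity) ?_ (by linarith)
    refine le_trans (le_of_eq ?_) (le_max_right _ _)
    rw [Real.log_pow, mul_comm]
  · intro h
    have := one_le_L h
    positivity
  · intro m n hm hmn
    have hm' : (0 : ℝ) < m := by exact_mod_cast hm
    have hmn' : (m : ℝ) ≤ n := by exact_mod_cast hmn
    have := one_le_L m
    have := one_le_L n
    have h1 := L_mono hm' hmn'
    refine mul_le_mul (by gcongr) ?_ (by positivity) (by positivity)
    exact Real.rpow_le_rpow_of_nonpos (by positivity) h1 (by linarith)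

theorem erdosC_nonneg : 0 ≤ erdosC := by
  have h2 := Real.log_pos one_lt_two
  have := Real.log_le_sub_one_of_pos h2
  rw [erdosC, sub_nonneg, div_le_one h2]
  linarith

theorem erdosC_le_one : erdosC ≤ 1 := by
  have h2 := Real.log_pos one_lt_two
  have : -1 ≤ Real.log (Real.log 2) := by
    rw [Real.le_log_iff_exp_le h2]
    have h1 : Real.exp (-1) ≤ 1 / 2 := by
      rw [Real.exp_neg, one_div]
      exact inv_anti₀ two_pos (by linarith [Real.add_one_le_exp (1 : ℝ)])
    linarith [Real.log_two_gt_d9]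
  rw [erdosC, sub_le_self_iff]
  exact div_nonneg (by linarith) h2.le

/-- The gap `κ h ^ (2 c - 1) (log h) ^ (2 - c - ε) / 4 ^ h` at scale `2 ^ h`. -/
noncomputable def scaleGap (κ ε : ℝ) (h : ℕ) : ℝ :=
  κ * (h : ℝ) ^ (2 * erdosC - 1) * L h ^ (2 - erdosC - ε) / 4 ^ h

theorem scaleGap_pos {κ ε : ℝ} (hκ : 0 < κ) {h : ℕ} (hh : 0 < h) : 0 < scaleGap κ ε h := by
  have : (0 : ℝ) < h := by exact_mod_cast hh
  have := one_le_L h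
  unfold scaleGap
  positivity

theorem tendsto_scaleGap {κ ε : ℝ} (hκ : 0 < κ) (hε : 0 < ε) :
    Tendsto (scaleGap κ ε) atTop (nhds 0) := by
  have h0 := (tendsto_pow_const_div_const_pow_of_one_lt 3 (by norm_num : (1 : ℝ) < 4)).const_mul κ
  rw [mul_zero] at h0
  refine squeeze_zero' ?_ ?_ h0
  · filter_upwards [eventually_gt_atTop 0] with h hh using (scaleGap_pos hκ hh).le
  · filter_upwards [eventually_ge_atTop 1] with h hh
    have hh' : (1 : ℝ) ≤ h := by exact_mod_cast hh
    have hL := one_le_L h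
    have hL' : L h ≤ h := max_le hh' ((Real.log_le_sub_one_of_pos (by linarith)).trans (by linarith))
    have h1 : (h : ℝ) ^ (2 * erdosC - 1) ≤ h ^ (1 : ℝ) :=
      Real.rpow_le_rpow_of_exponent_le hh' (by linarith [erdosC_le_one])
    have h2 : L h ^ (2 - erdosC - ε) ≤ (h : ℝ) ^ (2 : ℝ) :=
      (Real.rpow_le_rpow_of_exponent_le hL (by linarith [erdosC_nonneg])).trans
        (Real.rpow_le_rpow (by linarith) hL' (by norm_num))
    rw [Real.rpow_one] at h1
    rw [Real.rpow_two] at h2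
    rw [scaleGap, ← mul_div_assoc, mul_assoc]
    gcongr κ * ?_ / _
    calc _ ≤ (h : ℝ) * h ^ 2 := by gcongr
      _ = _ := by ring

theorem ae_eventually_notMem_nearProducts {κ ε K : ℝ} (hκ : 0 < κ) (hε : 0 < ε) (hε' : ε ≤ 1)
    (hK : 1 ≤ K) :
    ∀ᵐ α ∂(volume : Measure ℝ), ∀ᶠ h : ℕ in atTop, α ∉ nearProducts K h (scaleGap κ ε h) := by
  obtain ⟨C, hC, hvol⟩ := exists_measureReal_nearProducts_le (δ := ε / 4) (by linarith)
    (by linarith) hK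
  obtain ⟨H, hH⟩ := eventually_atTop.1
    ((tendsto_scaleGap hκ hε).eventually_le_const zero_lt_one)
  set s : ℕ → Set ℝ := fun h =>
    if max H 3 ≤ h then nearProducts K h (scaleGap κ ε h) else ∅ with hs
  have hsum : Summable fun h : ℕ => C * κ * ((h : ℝ)⁻¹ * L h ^ (-(1 + ε / 2))) :=
    (summable_inv_mul_L_rpow (by linarith)).mul_left _
  have hle : ∀ h, volume (s h) ≤ ENNReal.ofReal (C * κ * ((h : ℝ)⁻¹ * L h ^ (-(1 + ε / 2)))) := by
    intro h
    rw [hs]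
    dsimp only
    split_ifs with hh
    · have hh1 : H ≤ h := (le_max_left _ _).trans hh
      have hh3 : 3 ≤ h := (le_max_right _ _).trans hh
      have hh3' : (3 : ℝ) ≤ h := by exact_mod_cast hh3
      have hL := one_le_L h
      have hLlog : L h = Real.log h :=
        L_eq_log (by linarith [Real.exp_one_lt_d9])
      have hL0 : 0 < L h := by linarith
      have hh0 : (0 : ℝ) < h := by linarith
      refine (hvol h (by omega) _ (scaleGap_pos hκ (by omega)) (hH h hh1)).trans
        (ENNReal.ofReal_le_ofReal ?_)
      calc C * scaleGap κ ε h * 4 ^ h * tableDensity (ε / 4) h ^ 2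
          = C * κ * (((h : ℝ) ^ (2 * erdosC - 1) * (h : ℝ) ^ (-erdosC) * (h : ℝ) ^ (-erdosC))
            * (L h ^ (2 - erdosC - ε) * L h ^ (ε / 4 - 3 / 2) * L h ^ (ε / 4 - 3 / 2))) := by
            rw [scaleGap, tableDensity, ← hLlog]
            field_simp
        _ = C * κ * ((h : ℝ)⁻¹ * L h ^ (-1 - erdosC - ε / 2)) := by
            rw [← Real.rpow_add hh0, ← Real.rpow_add hh0, ← Real.rpow_add hL0,
              ← Real.rpow_add hL0, ← Real.rpow_neg_one (h : ℝ)]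
            ring_nf
        _ ≤ _ := by
            gcongr
            linarith [erdosC_nonneg]
    · simp
  have hne : ∑' h, volume (s h) ≠ ⊤ :=
    ne_top_of_le_ne_top hsum.tsum_ofReal_ne_top (ENNReal.tsum_le_tsum hle)
  filter_upwards [ae_eventually_notMem hne] with α hα
  filter_upwards [hα, eventually_ge_atTop (max H 3)] with h h1 h2
  simpa only [hs, if_pos h2] using h1

theorem rpow_le_rpow_abs_mul_rpow {A x y p : ℝ} (hA : 1 ≤ A) (hx : 0 < x) (hy : 0 < y)
    (hxy : x ≤ A * y) (hyx : y ≤ A * x) : x ^ p ≤ A ^ |p| * y ^ p := by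
  have hA0 : 0 < A := by linarith
  rcases le_total 0 p with hp | hp
  · rw [abs_of_nonneg hp, ← Real.mul_rpow hA0.le hy.le]
    exact Real.rpow_le_rpow hx.le hxy hp
  · rw [abs_of_nonpos hp, Real.rpow_neg hA0.le, ← Real.inv_rpow hA0.le,
      ← Real.mul_rpow (by positivity) hy.le]
    refine Real.rpow_le_rpow_of_nonpos (by positivity) ?_ hp
    rwa [inv_mul_le_iff₀ hA0]

theorem L_le_mul_L {A x y : ℝ} (hA : 1 ≤ A) (hx : 0 < x) (hy : 0 < y) (hxy : x ≤ A * y) :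
    L x ≤ (1 + L A) * L y := by
  have h1 := one_le_L A
  have h2 := one_le_L y
  refine (L_mono hx hxy).trans (max_le (by nlinarith) ?_)
  rw [Real.log_mul (by positivity) hy.ne']
  have h3 : Real.log A ≤ L A := le_max_right _ _
  have h4 : Real.log y ≤ L y := le_max_right _ _
  nlinarith

theorem exists_le_scaleGap (ε : ℝ) (r : ℕ) : ∃ κ : ℝ, 0 < κ ∧ ∀ N : ℕ, 4 ≤ N →
    L N ^ (2 * erdosC) * LL N ^ (2 - erdosC - ε) / (3 * (N : ℝ) * L N)
      ≤ scaleGap κ ε (Nat.log 4 N + r + 2) := by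
  set A : ℝ := r + 3 with hAdef
  have hA : 1 ≤ A := by rw [hAdef]; linarith [Nat.cast_nonneg (α := ℝ) r]
  set B : ℝ := 1 + L A with hBdef
  have hB : 1 ≤ B := by linarith [one_le_L A]
  refine ⟨A ^ |2 * erdosC - 1| * B ^ |2 - erdosC - ε| * 4 ^ (r + 2), by positivity, fun N hN => ?_⟩
  set g := Nat.log 4 N with hg
  have hN' : (4 : ℝ) ≤ N := by exact_mod_cast hN
  have hN0 : (0 : ℝ) < N := by linarith
  have hg1 : (1 : ℝ) ≤ g := by
    exact_mod_cast (Nat.le_log_iff_pow_le (by norm_num) (by omega)).2 (by simpa using hN)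
  have hlow : (4 : ℝ) ^ g ≤ N := by exact_mod_cast Nat.pow_log_le_self 4 (by omega)
  have hupp : (N : ℝ) ≤ 4 ^ (g + 1) := by
    exact_mod_cast (Nat.lt_pow_succ_log_self (by norm_num) N).le
  have hlog4 : Real.log 4 = 2 * Real.log 2 := by
    rw [show (4 : ℝ) = 2 ^ 2 by norm_num, Real.log_pow]; norm_num
  have hl1 := Real.log_two_gt_d9
  have hl2 := Real.log_two_lt_d9
  have hLlow : (g : ℝ) ≤ L N := by
    refine le_trans ?_ (le_max_right _ _)
    have := Real.log_le_log (by positivity) hlow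
    rw [Real.log_pow] at this
    nlinarith
  have hLupp : L N ≤ 2 * (g + 1) := by
    refine max_le (by linarith) ?_
    have := Real.log_le_log hN0 hupp
    rw [Real.log_pow] at this
    push_cast at this
    nlinarith
  have hL1 := one_le_L N
  have hLL1 : 1 ≤ LL N := one_le_L _
  have hr : (0 : ℝ) ≤ r := Nat.cast_nonneg r
  set h := g + r + 2 with hh
  have hhR : (h : ℝ) = g + r + 2 := by rw [hh]; push_cast; ring
  have hh0 : (0 : ℝ) < h := by linarith
  have hLh := one_le_L h
  have h1 : L N ≤ A * h := by rw [hhR, hAdef]; nlinarith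
  have h2 : (h : ℝ) ≤ A * L N := by
    have : (h : ℝ) ≤ A * g := by rw [hhR, hAdef]; nlinarith
    nlinarith
  have h3 : L N ^ (2 * erdosC - 1) ≤ A ^ |2 * erdosC - 1| * (h : ℝ) ^ (2 * erdosC - 1) :=
    rpow_le_rpow_abs_mul_rpow hA (by linarith) hh0 h1 h2
  have h4 : LL N ^ (2 - erdosC - ε) ≤ B ^ |2 - erdosC - ε| * L h ^ (2 - erdosC - ε) :=
    rpow_le_rpow_abs_mul_rpow hB (by linarith) (by linarith)
      (L_le_mul_L hA (by linarith) hh0 h1) (L_le_mul_L hA hh0 (by linarith) h2)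
  calc L N ^ (2 * erdosC) * LL N ^ (2 - erdosC - ε) / (3 * (N : ℝ) * L N)
      = L N ^ (2 * erdosC - 1) * LL N ^ (2 - erdosC - ε) / (3 * N) := by
        rw [Real.rpow_sub_one (by positivity)]
        field_simp
    _ ≤ (A ^ |2 * erdosC - 1| * (h : ℝ) ^ (2 * erdosC - 1))
        * (B ^ |2 - erdosC - ε| * L h ^ (2 - erdosC - ε)) / 4 ^ g := by
        gcongr
        linarith
    _ = _ := by
        rw [scaleGap, hh, show g + r + 2 = g + (r + 2) by ring, pow_add 4 g]
        field_simp

theorem billiard_injective {α : ℝ} (hα : Irrational α) {m n m' n' : ℕ}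
    (h : α * (m : ℝ) ^ 2 + (n : ℝ) ^ 2 = α * (m' : ℝ) ^ 2 + (n' : ℝ) ^ 2) : m = m' ∧ n = n' := by
  have hm : m = m' := by
    by_contra hne
    have h1 : ((m : ℤ) ^ 2 - (m' : ℤ) ^ 2) ≠ 0 := by
      intro h0
      apply hne
      have : m ^ 2 = m' ^ 2 := by exact_mod_cast sub_eq_zero.1 h0
      exact Nat.pow_left_injective two_ne_zero this
    refine (hα.mul_intCast h1).ne_int ((n' : ℤ) ^ 2 - (n : ℤ) ^ 2) ?_
    push_cast
    linarith
  subst hm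
  have : n ^ 2 = n' ^ 2 := by exact_mod_cast add_left_cancel h
  exact ⟨rfl, Nat.pow_left_injective two_ne_zero this⟩

theorem IsSpectrumEnum.le_of_lt_sq {α K : ℝ} {lam : ℕ → ℝ} (hlam : IsSpectrumEnum α lam)
    (hα : Irrational α) (hK : 0 ≤ K) (hαK : α ≤ K) {M k : ℕ} (hk : 1 ≤ k) (hkM : k ≤ M ^ 2) :
    lam k ≤ (K + 1) * M ^ 2 := by
  obtain ⟨hmono, -, hset⟩ := hlam
  by_contra! hlt
  have key : ∀ p ∈ Finset.Icc 1 M ×ˢ Finset.Icc 1 M, ∃ j ∈ Finset.Ico 1 k,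
      lam j = α * (p.1 : ℝ) ^ 2 + (p.2 : ℝ) ^ 2 := by
    rintro ⟨m, n⟩ hp
    simp only [Finset.mem_product, Finset.mem_Icc] at hp
    obtain ⟨j, hj, hj'⟩ := hset.ge ⟨m, n, hp.1.1, hp.2.1, rfl⟩
    refine ⟨j, Finset.mem_Ico.2 ⟨hj, ?_⟩, hj'⟩
    by_contra! hkj
    have h1 : lam k ≤ lam j := by
      rcases hkj.eq_or_lt with rfl | hkj
      · exact le_rfl
      · exact (hmono k j hk hkj).le
    have hm : (m : ℝ) ^ 2 ≤ M ^ 2 := by gcongr; exact hp.1.2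
    have hn : (n : ℝ) ^ 2 ≤ M ^ 2 := by gcongr; exact hp.2.2
    have hKm : α * (m : ℝ) ^ 2 ≤ K * M ^ 2 := by gcongr
    linarith
  choose! f hf hf' using key
  have hinj : Set.InjOn f (Finset.Icc 1 M ×ˢ Finset.Icc 1 M : Finset (ℕ × ℕ)) := by
    intro p hp q hq hpq
    have := (hf' p hp).symm.trans ((congrArg lam hpq).trans (hf' q hq))
    exact Prod.ext_iff.2 (billiard_injective hα this)
  have := Finset.card_le_card_of_injOn f (fun p hp => hf p hp) hinj
  simp only [Finset.card_product, Nat.card_Icc, Nat.card_Ico, Nat.add_sub_cancel] at this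
  rw [← sq] at this
  omega

theorem lt_billiard_gap {α K η : ℝ} {h m n m' n' : ℕ} (hK : 1 ≤ K) (hα : α ∈ Set.Icc K⁻¹ K)
    (hη : η < K⁻¹) (hnear : α ∉ nearProducts K h η) (hm : 1 ≤ m ∧ m < 2 ^ h)
    (hn : 1 ≤ n ∧ n < 2 ^ h) (hm' : 1 ≤ m' ∧ m' < 2 ^ h) (hn' : 1 ≤ n' ∧ n' < 2 ^ h)
    (hlt : α * (m : ℝ) ^ 2 + (n : ℝ) ^ 2 < α * (m' : ℝ) ^ 2 + (n' : ℝ) ^ 2) :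
    η < (α * (m' : ℝ) ^ 2 + (n' : ℝ) ^ 2) - (α * (m : ℝ) ^ 2 + (n : ℝ) ^ 2) := by
  have hK1 : K⁻¹ ≤ 1 := inv_le_one_of_one_le₀ hK
  have hα0 : 0 < α := (inv_pos.2 (by linarith)).trans_le hα.1
  have hsq : ∀ {a b : ℕ}, a ≤ b → (a : ℝ) ^ 2 ≤ b ^ 2 := fun hab => by gcongr
  have hsq' : ∀ {a b : ℕ}, a < b → (a : ℝ) ^ 2 + 1 ≤ b ^ 2 := fun hab => by
    exact_mod_cast Nat.succ_le_of_lt (Nat.pow_lt_pow_left hab two_ne_zero)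
  have hfac : ∀ {a b : ℕ}, a ≤ b → (((b - a) * (b + a) : ℕ) : ℝ) = b ^ 2 - a ^ 2 := fun hab => by
    rw [Nat.cast_mul, Nat.cast_sub hab]
    push_cast
    ring
  have hpow : 2 ^ (h + 1) = 2 * 2 ^ h := by ring
  have hfar : ∀ {a b c d : ℕ}, (0 < a ∧ a < 2 ^ (h + 1)) → (0 < b ∧ b < 2 ^ (h + 1)) →
      (0 < c ∧ c < 2 ^ (h + 1)) → (0 < d ∧ d < 2 ^ (h + 1)) →
      η < |α * ((a * b : ℕ) : ℝ) - ((c * d : ℕ) : ℝ)| := fun ha hb hc hd => by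
    by_contra! hle
    exact hnear ⟨hα, _, _, _, _, ha, hb, hc, hd, hle⟩
  rcases lt_trichotomy m m' with hmm | rfl | hmm
  · rcases le_or_gt n n' with hnn | hnn
    · have := mul_le_mul_of_nonneg_left (hsq' hmm) hα0.le
      linarith [hsq hnn, hα.1]
    · have := hfar (a := m' - m) (b := m' + m) (c := n - n') (d := n + n')
        (by omega) (by omega) (by omega) (by omega)
      rw [hfac hmm.le, hfac hnn.le, abs_of_pos (by linarith)] at this
      linarith
  · have hnn : n < n' := by
      by_contra! hnn
      linarith [hsq hnn]
    linarith [hsq' hnn]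
  · have hnn : n < n' := by
      by_contra! hnn
      linarith [hsq hnn, mul_le_mul_of_nonneg_left (hsq hmm.le) hα0.le]
    have := hfar (a := m - m') (b := m + m') (c := n' - n) (d := n' + n)
      (by omega) (by omega) (by omega) (by omega)
    rw [hfac hmm.le, hfac hnn.le, abs_of_neg (by linarith)] at this
    linarith

theorem lt_bDeltaMin {α K η : ℝ} {lam : ℕ → ℝ} {r N : ℕ} (hlam : IsSpectrumEnum α lam)
    (hirr : Irrational α) (hK : 1 ≤ K) (hr : K * (K + 1) ≤ 4 ^ r) (hα : α ∈ Set.Icc K⁻¹ K)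
    (hN : 1 ≤ N) (hη : η < K⁻¹) (hnear : α ∉ nearProducts K (Nat.log 4 N + r + 2) η) :
    η < bDeltaMin lam N := by
  set g := Nat.log 4 N with hg
  have hα0 : 0 < α := (inv_pos.2 (by linarith)).trans_le hα.1
  have hNg : N + 1 ≤ (2 ^ (g + 1)) ^ 2 := by
    rw [← pow_mul, mul_comm, pow_mul]
    exact Nat.lt_pow_succ_log_self (by norm_num) N
  have hrep : ∀ k : ℕ, 1 ≤ k → k ≤ N + 1 → ∃ m n : ℕ, (1 ≤ m ∧ m < 2 ^ (g + r + 2)) ∧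
      (1 ≤ n ∧ n < 2 ^ (g + r + 2)) ∧ lam k = α * (m : ℝ) ^ 2 + (n : ℝ) ^ 2 := by
    intro k hk hkN
    obtain ⟨m, n, hm, hn, hmn⟩ := hlam.2.2.le ⟨k, hk, rfl⟩
    have hle := hlam.le_of_lt_sq hirr (by linarith) hα.2 hk (hkN.trans hNg)
    rw [hmn] at hle
    push_cast at hle
    have hbound : ∀ a : ℕ, (a : ℝ) ^ 2 ≤ K * ((K + 1) * (2 ^ (g + 1)) ^ 2) →
        a < 2 ^ (g + r + 2) := by
      intro a ha
      have h1 : (a : ℝ) ^ 2 ≤ (2 ^ (g + r + 1)) ^ 2 := by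
        calc (a : ℝ) ^ 2 ≤ K * (K + 1) * (2 ^ (g + 1)) ^ 2 := by rw [mul_assoc]; exact ha
          _ ≤ 4 ^ r * (2 ^ (g + 1)) ^ 2 := by gcongr
          _ = _ := by
            rw [show (4 : ℝ) = 2 ^ 2 by norm_num, ← pow_mul, ← pow_mul, ← pow_mul, ← pow_add]
            ring_nf
      have h2 : a ^ 2 ≤ (2 ^ (g + r + 1)) ^ 2 := by exact_mod_cast h1
      exact ((Nat.pow_le_pow_iff_left two_ne_zero).1 h2).trans_lt (Nat.pow_lt_pow_right one_lt_two (by omega))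
    refine ⟨m, n, ⟨hm, hbound m ?_⟩, ⟨hn, hbound n ?_⟩, hmn⟩
    · have h1 : 1 ≤ K * α := by
        have := mul_le_mul_of_nonneg_left hα.1 (by linarith : 0 ≤ K)
        rwa [mul_inv_cancel₀ (by linarith)] at this
      calc (m : ℝ) ^ 2 ≤ K * α * m ^ 2 := le_mul_of_one_le_left (by positivity) h1
        _ = K * (α * m ^ 2) := mul_assoc _ _ _
        _ ≤ _ := by
          refine mul_le_mul_of_nonneg_left ?_ (by linarith)
          linarith [sq_nonneg (n : ℝ)]
    · have : 0 ≤ α * (m : ℝ) ^ 2 := by positivity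
      refine le_trans ?_ (le_mul_of_one_le_left (by positivity) hK)
      linarith
  have hmem : bDeltaMin lam N ∈ {x : ℝ | ∃ k : ℕ, 1 ≤ k ∧ k ≤ N ∧ x = lam (k + 1) - lam k} := by
    refine Set.Nonempty.csInf_mem ⟨_, 1, le_rfl, hN, rfl⟩ ?_
    refine ((Set.finite_Icc 1 N).image fun k => lam (k + 1) - lam k).subset ?_
    rintro x ⟨k, hk, hkN, rfl⟩
    exact ⟨k, ⟨hk, hkN⟩, rfl⟩
  obtain ⟨k, hk, hkN, hx⟩ := hmem
  obtain ⟨m, n, hm, hn, hmn⟩ := hrep k hk (by omega)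
  obtain ⟨m', n', hm', hn', hmn'⟩ := hrep (k + 1) (by omega) (by omega)
  have hlt := hlam.1 k (k + 1) hk (Nat.lt_succ_self k)
  rw [hx]
  rw [hmn, hmn'] at hlt ⊢
  exact lt_billiard_gap hK hα hη hnear hm hn hm' hn' hlt

theorem LL_rpow_mono {x a b : ℝ} (hab : a ≤ b) : LL x ^ a ≤ LL x ^ b :=
  Real.rpow_le_rpow_of_exponent_le (one_le_L _) hab

theorem ae_irrational : ∀ᵐ α ∂(volume : Measure ℝ), Irrational α :=
  (Set.countable_range ((↑) : ℚ → ℝ)).ae_notMem volume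

theorem stmt14 (ε : ℝ) (hε : 0 < ε) :
    ∀ᵐ α ∂(volume : Measure ℝ), 0 < α →
      ∀ lam : ℕ → ℝ, IsSpectrumEnum α lam →
        ∃ N₀ : ℕ, ∀ N ≥ N₀,
          bDeltaMin lam N >
            (L N) ^ (2 * erdosC) * (LL N) ^ (2 - erdosC - ε) /
              (3 * (N : ℝ) * L N) := by
  have hex : ∀ k : ℕ, ∃ r : ℕ, ((k : ℝ) + 1) * (k + 1 + 1) ≤ 4 ^ r := fun k =>
    (pow_unbounded_of_one_lt _ (by norm_num)).imp fun _ h => h.le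
  choose r hr using hex
  choose κ hκ hcomp using fun k => exists_le_scaleGap (min ε 1) (r k)
  have hmin : 0 < min ε 1 := lt_min hε one_pos
  filter_upwards [ae_irrational, ae_all_iff.2 fun k : ℕ =>
    ae_eventually_notMem_nearProducts (hκ k) hmin (min_le_right _ _)
      (by linarith [Nat.cast_nonneg (α := ℝ) k] : (1 : ℝ) ≤ k + 1)] with α hirr hnear hα0 lam hlam
  obtain ⟨k, hk⟩ := exists_nat_ge (max α α⁻¹)
  have hK : (1 : ℝ) ≤ k + 1 := by linarith [Nat.cast_nonneg (α := ℝ) k]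
  have hαK : α ∈ Set.Icc ((k : ℝ) + 1)⁻¹ (k + 1) := by
    refine ⟨?_, by linarith [le_max_left α α⁻¹]⟩
    rw [inv_le_comm₀ (by linarith) hα0]
    linarith [le_max_right α α⁻¹]
  have hscale : Tendsto (fun N => Nat.log 4 N + r k + 2) atTop atTop :=
    tendsto_atTop.2 fun b => by
      filter_upwards [eventually_ge_atTop (4 ^ b)] with N hN
      have := Nat.le_log_of_pow_le (by norm_num : 1 < 4) hN
      omega
  refine eventually_atTop.1 ?_
  filter_upwards [hscale.eventually (hnear k), eventually_ge_atTop 4,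
    hscale.eventually ((tendsto_scaleGap (hκ k) hmin).eventually_lt_const
      (inv_pos.2 (by linarith : (0 : ℝ) < k + 1)))] with N h1 hN h2
  refine lt_of_le_of_lt ?_ (lt_bDeltaMin hlam hirr hK (hr k) hαK (by omega) h2 h1)
  refine le_trans ?_ (hcomp k N hN)
  have := one_le_L N
  gcongr _ * ?_ / _
  exact LL_rpow_mono (by linarith [min_le_left ε 1])
end

section
/- For every ε > 0 there exists k₀ such that the following holds for every even integer k ≥ k₀ and every sequence (z_n)_{n≥1} of distinct positive integers: for all integers n with 2^{k/2} < n ≤ 2^k, the Lebesgue measure of S_n* = [0,1] ∩ ⋃_{0 ≤ a ≤ z_n, every prime p dividing gcd(a, z_n) satisfies p > 4^k} (a/z_n − ψ(n)/z_n, a/z_n + ψ(n)/z_n), where ψ(n) = 1/(2n+1), satisfies λ(S_n*) ≥ (1 − ε) / (n · e^γ · log(4^k)), where γ is the Euler–Mascheroni constant. -/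
open MeasureTheory Filter

/-- `ψ(n) = 1/(2n+1)`. -/
noncomputable def psi (n : ℕ) : ℝ := 1 / (2 * (n : ℝ) + 1)

/-- The set `S_n* = [0,1] ∩ ⋃ { (a/z_n − ψ(n)/z_n, a/z_n + ψ(n)/z_n) :
0 ≤ a ≤ z_n, every prime `p` dividing `gcd(a, z_n)` satisfies `p > 4^k` }`. -/
def Sstar (z : ℕ → ℕ) (k n : ℕ) : Set ℝ :=
  Set.Icc 0 1 ∩
    ⋃ (a : ℕ) (_ : a ≤ z n) (_ : ∀ p : ℕ, p.Prime → p ∣ Nat.gcd a (z n) → 4 ^ k < p),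
      Set.Ioo ((a : ℝ) / (z n : ℝ) - psi n / (z n : ℝ))
        ((a : ℝ) / (z n : ℝ) + psi n / (z n : ℝ))

/-- The contribution `-log (1 - 1/p)` of a prime `p` to the logarithm of Mertens' product. -/
noncomputable def mertensWeight (p : ℕ) : ℝ := -Real.log (1 - (p : ℝ)⁻¹)

/-- `-log (1 - x) ≤ x + 2 x ^ 2` for `x ≤ 1/2`. -/
lemma neg_log_one_sub_le {x : ℝ} (hx : x ≤ 2⁻¹) :
    -Real.log (1 - x) ≤ x + 2 * x ^ 2 := by
  have hpos : 0 < 1 - x := by linarith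
  have := Real.one_sub_inv_le_log_of_pos hpos
  have h2 : (1 - x)⁻¹ - 1 ≤ x + 2 * x ^ 2 := by
    rw [sub_le_iff_le_add, inv_le_iff_one_le_mul₀ hpos]
    nlinarith [mul_nonneg (sq_nonneg x) (by linarith : (0 : ℝ) ≤ 1 - 2 * x)]
  linarith

lemma le_neg_log_one_sub {x : ℝ} (hx : x ≤ 2⁻¹) : x ≤ -Real.log (1 - x) := by
  have := Real.log_le_sub_one_of_pos (x := 1 - x) (by linarith)
  linarith

lemma inv_natCast_le_half {p : ℕ} (hp : 2 ≤ p) : (p : ℝ)⁻¹ ≤ 2⁻¹ :=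
  inv_anti₀ (by norm_num) (by exact_mod_cast hp)

lemma inv_le_mertensWeight {p : ℕ} (hp : 2 ≤ p) : (p : ℝ)⁻¹ ≤ mertensWeight p :=
  le_neg_log_one_sub (inv_natCast_le_half hp)

lemma mertensWeight_nonneg {p : ℕ} (hp : 2 ≤ p) : 0 ≤ mertensWeight p :=
  le_trans (by positivity) (inv_le_mertensWeight hp)

lemma mertensWeight_le {p : ℕ} (hp : 2 ≤ p) :
    mertensWeight p ≤ (p : ℝ)⁻¹ + 2 * ((p : ℝ)⁻¹) ^ 2 :=
  neg_log_one_sub_le (inv_natCast_le_half hp)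

lemma mertensWeight_le_two_div {p : ℕ} (hp : 2 ≤ p) : mertensWeight p ≤ 2 * (p : ℝ)⁻¹ := by
  have h := mertensWeight_le hp
  have h1 := inv_natCast_le_half hp
  have h0 : (0 : ℝ) ≤ (p : ℝ)⁻¹ := by positivity
  nlinarith

lemma log_factorial_eq_sum (N : ℕ) :
    Real.log (N.factorial : ℝ) =
      ∑ p ∈ N.primesLE, (N.factorial.factorization p : ℝ) * Real.log p := by
  have h1 : N.factorial.primeFactors = N.primesLE := by
    ext p
    simp only [Nat.mem_primeFactors, Nat.mem_primesLE]
    constructor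
    · rintro ⟨hp, hd, -⟩
      exact ⟨(hp.dvd_factorial).1 hd, hp⟩
    · rintro ⟨hd, hp⟩
      exact ⟨hp, (hp.dvd_factorial).2 hd, N.factorial_ne_zero⟩
  have h2 := Nat.prod_factorization_pow_eq_self N.factorial_ne_zero
  rw [Nat.prod_factorization_eq_prod_primeFactors, h1] at h2
  conv_lhs => rw [← h2]
  push_cast
  rw [Real.log_prod]
  · simp
  · intro p hp
    have := (Nat.mem_primesLE.1 hp).2.pos
    positivity

lemma factorization_factorial_mul_pred_le {p : ℕ} (hp : p.Prime) (N : ℕ) :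
    (N.factorial.factorization p : ℝ) * ((p : ℝ) - 1) ≤ N := by
  have := Fact.mk hp
  have h := sub_one_mul_padicValNat_factorial (p := p) N
  rw [← Nat.factorization_def _ hp] at h
  have h3 : (p - 1) * N.factorial.factorization p ≤ N := by omega
  have h4 : (((p - 1 : ℕ) : ℝ)) * (N.factorial.factorization p : ℝ) ≤ N := by exact_mod_cast h3
  rw [Nat.cast_sub hp.one_le] at h4
  push_cast at h4
  linarith

lemma div_sub_one_le_factorization_factorial {p N : ℕ} (hp : p.Prime) (hpN : p ≤ N) :
    (N : ℝ) / p - 1 ≤ N.factorial.factorization p := by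
  have h := Nat.factorization_factorial hp (Nat.lt_succ_self (Nat.log p N))
  have h1 : N / p ≤ N.factorial.factorization p := by
    rw [h]
    have : N / p ^ 1 ≤ ∑ i ∈ Finset.Ico 1 (Nat.log p N).succ, N / p ^ i :=
      Finset.single_le_sum (f := fun i => N / p ^ i) (fun _ _ => Nat.zero_le _)
        (by
          rw [Finset.mem_Ico]
          exact ⟨le_rfl, Nat.succ_lt_succ (Nat.log_pos hp.one_lt hpN)⟩)
    simpa using this
  have h2 : (N : ℝ) / p < (N / p : ℕ) + 1 := by
    rw [div_lt_iff₀ (by exact_mod_cast hp.pos)]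
    have := Nat.lt_div_mul_add (a := N) hp.pos
    have h3 : N < (N / p + 1) * p := by linarith
    exact_mod_cast h3
  have h3 : ((N / p : ℕ) : ℝ) ≤ N.factorial.factorization p := by exact_mod_cast h1
  linarith

lemma sum_log_mul_inv_sq_bounded :
    ∃ K : ℝ, 0 ≤ K ∧ ∀ N : ℕ, ∑ p ∈ N.primesLE, Real.log p * (2 * ((p : ℝ)⁻¹) ^ 2) ≤ K := by
  have hs : Summable fun n : ℕ => 4 * (n : ℝ) ^ (-(3 / 2) : ℝ) :=
    (Real.summable_nat_rpow.2 (by norm_num)).mul_left 4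
  refine ⟨∑' n : ℕ, 4 * (n : ℝ) ^ (-(3 / 2) : ℝ), tsum_nonneg fun n => by positivity,
    fun N => le_trans (Finset.sum_le_sum fun p hp => ?_)
      (hs.sum_le_tsum N.primesLE fun n _ => by positivity)⟩
  have hp0 : (0 : ℝ) < p := by exact_mod_cast (Nat.mem_primesLE.1 hp).2.pos
  have hl := Real.log_le_rpow_div (x := p) (ε := 1 / 2) hp0.le (by norm_num)
  have e : (p : ℝ) ^ (-(3 / 2) : ℝ) = (p : ℝ) ^ (1 / 2 : ℝ) * ((p : ℝ)⁻¹) ^ 2 := by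
    have : ((p : ℝ)⁻¹) ^ 2 = (p : ℝ) ^ (-2 : ℝ) := by
      rw [Real.rpow_neg hp0.le, inv_pow]
      norm_cast
    rw [this, ← Real.rpow_add hp0]
    norm_num
  rw [e]
  have h2 : (0 : ℝ) ≤ ((p : ℝ)⁻¹) ^ 2 := by positivity
  nlinarith

/-- **Mertens' first theorem** for the weights `-log (1 - 1/p)`. -/
lemma mertens_first :
    ∃ C : ℝ, 0 ≤ C ∧ ∀ N : ℕ, 1 ≤ N →
      |∑ p ∈ N.primesLE, mertensWeight p * Real.log p - Real.log N| ≤ C := by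
  obtain ⟨K, hK0, hK⟩ := sum_log_mul_inv_sq_bounded
  have hlog4 : 0 ≤ Real.log 4 := Real.log_nonneg (by norm_num)
  refine ⟨K + Real.log 4 + 1, by linarith, fun N hN => ?_⟩
  have hN0 : (0 : ℝ) < N := by exact_mod_cast hN
  have hprime : ∀ p ∈ N.primesLE, p.Prime := fun p hp => (Nat.mem_primesLE.1 hp).2
  have hlog : ∀ p ∈ N.primesLE, 0 ≤ Real.log p := fun p hp =>
    Real.log_nonneg (by exact_mod_cast (hprime p hp).one_le)
  set A := ∑ p ∈ N.primesLE, Real.log p * (p : ℝ)⁻¹ with hA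
  have hup : A ≤ Real.log N + Real.log 4 := by
    have h1 : ∑ p ∈ N.primesLE, ((N : ℝ) / p - 1) * Real.log p ≤ N * Real.log N := by
      calc _ ≤ ∑ p ∈ N.primesLE, (N.factorial.factorization p : ℝ) * Real.log p :=
            Finset.sum_le_sum fun p hp => mul_le_mul_of_nonneg_right
              (div_sub_one_le_factorization_factorial (hprime p hp) (Nat.mem_primesLE.1 hp).1)
              (hlog p hp)
        _ = Real.log (N.factorial : ℝ) := (log_factorial_eq_sum N).symm
        _ ≤ Real.log ((N : ℝ) ^ N) := Real.log_le_log (by exact_mod_cast N.factorial_pos)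
              (by exact_mod_cast N.factorial_le_pow)
        _ = _ := by rw [Real.log_pow]
    have h2 : ∑ p ∈ N.primesLE, ((N : ℝ) / p - 1) * Real.log p
        = N * A - Chebyshev.theta N := by
      rw [Chebyshev.theta_eq_sum_primesLE_log, hA, Finset.mul_sum, ← Finset.sum_sub_distrib]
      exact Finset.sum_congr rfl fun p _ => by ring
    have h3 := Chebyshev.theta_le_log4_mul_x hN0.le
    have : N * A ≤ N * (Real.log N + Real.log 4) := by linarith
    exact le_of_mul_le_mul_left this hN0
  have hlow : Real.log N - 1 ≤ A + K := by
    have h1 : Real.log (N.factorial : ℝ) ≤ N * (A + K) := by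
      rw [log_factorial_eq_sum]
      calc _ ≤ ∑ p ∈ N.primesLE, N * (Real.log p * (p : ℝ)⁻¹
              + Real.log p * (2 * ((p : ℝ)⁻¹) ^ 2)) := by
            refine Finset.sum_le_sum fun p hp => ?_
            have hp2 : (2 : ℝ) ≤ p := by exact_mod_cast (hprime p hp).two_le
            have h := factorization_factorial_mul_pred_le (hprime p hp) N
            have hi : 1 ≤ ((p : ℝ) - 1) * ((p : ℝ)⁻¹ + 2 * ((p : ℝ)⁻¹) ^ 2) := by
              have hpi : (p : ℝ) * (p : ℝ)⁻¹ = 1 := mul_inv_cancel₀ (by positivity)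
              have hh := inv_natCast_le_half (hprime p hp).two_le
              have h0 : (0 : ℝ) ≤ (p : ℝ)⁻¹ := by positivity
              have : ((p : ℝ) - 1) * ((p : ℝ)⁻¹ + 2 * ((p : ℝ)⁻¹) ^ 2)
                  = p * (p : ℝ)⁻¹ + 2 * (p * (p : ℝ)⁻¹) * (p : ℝ)⁻¹ - (p : ℝ)⁻¹
                    - 2 * ((p : ℝ)⁻¹) ^ 2 := by ring
              rw [this, hpi]
              nlinarith
            set s := (p : ℝ)⁻¹ + 2 * ((p : ℝ)⁻¹) ^ 2 with hs
            have hs0 : 0 ≤ s := by positivity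
            have hv : (N.factorial.factorization p : ℝ) ≤ N * s := by
              have hf0 : (0 : ℝ) ≤ N.factorial.factorization p := by positivity
              calc (N.factorial.factorization p : ℝ)
                  ≤ N.factorial.factorization p * (((p : ℝ) - 1) * s) :=
                    le_mul_of_one_le_right hf0 hi
                _ = (N.factorial.factorization p * ((p : ℝ) - 1)) * s := by ring
                _ ≤ N * s := mul_le_mul_of_nonneg_right h hs0
            calc _ ≤ N * s * Real.log p := mul_le_mul_of_nonneg_right hv (hlog p hp)
              _ = _ := by rw [hs]; ring
        _ = N * (A + ∑ p ∈ N.primesLE, Real.log p * (2 * ((p : ℝ)⁻¹) ^ 2)) := by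
            rw [← Finset.mul_sum, Finset.sum_add_distrib]
        _ ≤ _ := by gcongr; exact hK N
    have h2 : N * Real.log N - N ≤ Real.log (N.factorial : ℝ) := by
      have := Stirling.le_log_factorial_stirling (n := N) (by omega)
      have h3 : 0 ≤ Real.log N := Real.log_nonneg (by exact_mod_cast hN)
      have h4 : 0 ≤ Real.log (2 * Real.pi) :=
        Real.log_nonneg (by linarith [Real.pi_gt_three])
      linarith
    have : N * (Real.log N - 1) ≤ N * (A + K) := by linarith
    exact le_of_mul_le_mul_left this hN0
  have hSA : A ≤ ∑ p ∈ N.primesLE, mertensWeight p * Real.log p :=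
    Finset.sum_le_sum fun p hp => by
      rw [mul_comm]
      exact mul_le_mul_of_nonneg_right (inv_le_mertensWeight (hprime p hp).two_le) (hlog p hp)
  have hSA' : ∑ p ∈ N.primesLE, mertensWeight p * Real.log p ≤ A + K := by
    calc _ ≤ ∑ p ∈ N.primesLE, (Real.log p * (p : ℝ)⁻¹
              + Real.log p * (2 * ((p : ℝ)⁻¹) ^ 2)) :=
          Finset.sum_le_sum fun p hp => by
            rw [← mul_add, mul_comm]
            exact mul_le_mul_of_nonneg_left (mertensWeight_le (hprime p hp).two_le) (hlog p hp)
      _ = A + ∑ p ∈ N.primesLE, Real.log p * (2 * ((p : ℝ)⁻¹) ^ 2) := Finset.sum_add_distrib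
      _ ≤ _ := by gcongr; exact hK N
  rw [abs_le]
  constructor <;> linarith

/-- The primes in `(4 ^ m, 4 ^ (m + 1)]`. -/
def primeBlock (m : ℕ) : Finset ℕ := (Finset.Ioc (4 ^ m) (4 ^ (m + 1))).filter Nat.Prime

lemma mem_primeBlock {m p : ℕ} :
    p ∈ primeBlock m ↔ (4 ^ m < p ∧ p ≤ 4 ^ (m + 1)) ∧ p.Prime := by
  simp [primeBlock]

lemma sum_sum_primeBlock (f : ℕ → ℝ) (M : ℕ) :
    ∑ m ∈ Finset.range M, ∑ p ∈ primeBlock m, f p = ∑ p ∈ (4 ^ M).primesLE, f p := by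
  induction M with
  | zero =>
    have : Nat.primesLE (4 ^ 0) = ∅ := by decide
    rw [this]
    simp
  | succ M ih =>
    rw [Finset.sum_range_succ, ih, ← Finset.sum_union]
    · congr 1
      ext p
      have : 4 ^ M ≤ 4 ^ (M + 1) := Nat.pow_le_pow_right (by norm_num) (by omega)
      simp only [Finset.mem_union, Nat.mem_primesLE, mem_primeBlock]
      constructor
      · rintro (⟨h1, h2⟩ | ⟨⟨h1, h2⟩, h3⟩)
        · exact ⟨by omega, h2⟩
        · exact ⟨h2, h3⟩
      · rintro ⟨h1, h2⟩
        by_cases h : p ≤ 4 ^ M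
        · exact Or.inl ⟨h, h2⟩
        · exact Or.inr ⟨⟨by omega, h1⟩, h2⟩
    · rw [Finset.disjoint_left]
      intro p hp hp'
      have h1 := (Nat.mem_primesLE.1 hp).1
      have h2 := (mem_primeBlock.1 hp').1.1
      omega

/-- The sum of `-log (1 - 1/p)` over the primes in `(4 ^ m, 4 ^ (m + 1)]`. -/
noncomputable def blockSum (m : ℕ) : ℝ := ∑ p ∈ primeBlock m, mertensWeight p

lemma mertensWeight_nonneg_of_mem {m p : ℕ} (hp : p ∈ primeBlock m) : 0 ≤ mertensWeight p :=
  mertensWeight_nonneg (mem_primeBlock.1 hp).2.two_le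

lemma blockSum_nonneg (m : ℕ) : 0 ≤ blockSum m :=
  Finset.sum_nonneg fun _ hp => mertensWeight_nonneg_of_mem hp

lemma log_le_of_mem_primeBlock {m p : ℕ} (hp : p ∈ primeBlock m) :
    Real.log p ≤ (m + 1) * Real.log 4 := by
  have h := mem_primeBlock.1 hp
  have : Real.log p ≤ Real.log ((4 : ℝ) ^ (m + 1)) :=
    Real.log_le_log (by exact_mod_cast h.2.pos) (by exact_mod_cast h.1.2)
  rwa [Real.log_pow, Nat.cast_add_one] at this

lemma le_log_of_mem_primeBlock {m p : ℕ} (hp : p ∈ primeBlock m) :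
    m * Real.log 4 ≤ Real.log p := by
  have h := mem_primeBlock.1 hp
  have : Real.log ((4 : ℝ) ^ m) ≤ Real.log p :=
    Real.log_le_log (by positivity) (by exact_mod_cast h.1.1.le)
  rwa [Real.log_pow] at this

lemma log_four_pos : 0 < Real.log 4 := Real.log_pos (by norm_num)

/-- The sum of `-log (1 - 1/p) * log p` over the primes in `(4 ^ m, 4 ^ (m + 1)]`. -/
noncomputable def blockLogSum (m : ℕ) : ℝ := ∑ p ∈ primeBlock m, mertensWeight p * Real.log p

lemma sum_blockLogSum_bounded :
    ∃ C : ℝ, 0 ≤ C ∧ ∀ M : ℕ, |∑ m ∈ Finset.range M, (blockLogSum m - Real.log 4)| ≤ C := by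
  obtain ⟨C, hC0, hC⟩ := mertens_first
  refine ⟨C, hC0, fun M => ?_⟩
  have h := hC (4 ^ M) (Nat.one_le_pow _ _ (by norm_num))
  rw [Finset.sum_sub_distrib]
  unfold blockLogSum
  rw [sum_sum_primeBlock (fun p => mertensWeight p * Real.log p)]
  simpa using h

lemma mul_blockSum_le (m : ℕ) : m * Real.log 4 * blockSum m ≤ blockLogSum m := by
  unfold blockSum blockLogSum
  rw [Finset.mul_sum]
  refine Finset.sum_le_sum fun p hp => ?_
  rw [mul_comm]
  exact mul_le_mul_of_nonneg_left (le_log_of_mem_primeBlock hp) (mertensWeight_nonneg_of_mem hp)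

lemma blockLogSum_le (m : ℕ) : blockLogSum m ≤ (m + 1) * Real.log 4 * blockSum m := by
  unfold blockSum blockLogSum
  rw [Finset.mul_sum]
  refine Finset.sum_le_sum fun p hp => ?_
  rw [mul_comm]
  exact mul_le_mul_of_nonneg_right (log_le_of_mem_primeBlock hp) (mertensWeight_nonneg_of_mem hp)

lemma blockSum_le :
    ∃ K : ℝ, 0 ≤ K ∧ ∀ m : ℕ, blockSum m ≤ K / (m + 1) := by
  obtain ⟨C, hC0, hC⟩ := sum_blockLogSum_bounded
  have h4 := log_four_pos
  have h0 := blockSum_nonneg 0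
  refine ⟨blockSum 0 + 2 * ((Real.log 4 + 2 * C) / Real.log 4), by positivity, fun m => ?_⟩
  have hc : blockLogSum m ≤ Real.log 4 + 2 * C := by
    have h1 := abs_le.1 (hC (m + 1))
    have h2 := abs_le.1 (hC m)
    rw [Finset.sum_range_succ] at h1
    linarith [h1.2, h2.1]
  have hm : m * blockSum m ≤ (Real.log 4 + 2 * C) / Real.log 4 := by
    rw [le_div_iff₀ h4]
    linarith [mul_blockSum_le m]
  rw [le_div_iff₀ (by positivity)]
  rcases Nat.eq_zero_or_pos m with rfl | hpos
  · have : 0 ≤ (Real.log 4 + 2 * C) / Real.log 4 := by positivity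
    simp
    linarith
  · have h1 : (1 : ℝ) ≤ m := by exact_mod_cast hpos
    nlinarith [blockSum_nonneg m]

lemma cauchySeq_sum_blockSum_sub :
    CauchySeq fun M => ∑ m ∈ Finset.range M, (blockSum m - 1 / ((m : ℝ) + 1)) := by
  obtain ⟨C, hC0, hC⟩ := sum_blockLogSum_bounded
  obtain ⟨K, hK0, hK⟩ := blockSum_le
  have h4 := log_four_pos
  have hmain : CauchySeq fun M => ∑ m ∈ Finset.range M,
      (1 / ((m : ℝ) + 1)) • ((blockLogSum m - Real.log 4) / Real.log 4) := by
    refine Antitone.cauchySeq_series_mul_of_tendsto_zero_of_bounded (b := C / Real.log 4)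
      (fun a b hab => ?_) tendsto_one_div_add_atTop_nhds_zero_nat fun M => ?_
    · have : (a : ℝ) ≤ b := by exact_mod_cast hab
      gcongr
    · rw [← Finset.sum_div, Real.norm_eq_abs, abs_div, abs_of_pos h4]
      gcongr
      exact hC M
  have herr : Summable fun m : ℕ =>
      blockSum m - blockLogSum m / (((m : ℝ) + 1) * Real.log 4) := by
    have hs : Summable fun m : ℕ => K * (1 / ((m + 1 : ℕ) : ℝ) ^ 2) :=
      ((summable_nat_add_iff 1).2 (Real.summable_one_div_nat_pow.2 one_lt_two)).mul_left K
    refine Summable.of_nonneg_of_le (fun m => ?_) (fun m => ?_) hs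
    · rw [sub_nonneg, div_le_iff₀ (by positivity)]
      linarith [blockLogSum_le m]
    · have h1 : m * blockSum m / ((m : ℝ) + 1) ≤ blockLogSum m / (((m : ℝ) + 1) * Real.log 4) := by
        rw [div_le_div_iff₀ (by positivity) (by positivity)]
        have := mul_le_mul_of_nonneg_right (mul_blockSum_le m)
          (by positivity : (0 : ℝ) ≤ (m : ℝ) + 1)
        linarith
      have h2 : blockSum m - m * blockSum m / ((m : ℝ) + 1) = blockSum m / (m + 1) := by
        field_simp
        ring
      have h3 : blockSum m / (m + 1) ≤ K / (m + 1) / (m + 1) := by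
        gcongr
        exact hK m
      have h4 : K / ((m : ℝ) + 1) / (m + 1) = K * (1 / ((m + 1 : ℕ) : ℝ) ^ 2) := by
        push_cast
        field_simp
      linarith
  have := hmain.add herr.hasSum.tendsto_sum_nat.cauchySeq
  convert this using 2 with M
  simp only [Pi.add_apply]
  rw [← Finset.sum_add_distrib]
  refine Finset.sum_congr rfl fun m _ => ?_
  rw [smul_eq_mul]
  field_simp
  ring

section ZetaNearOne
open Topology

/-- The function `∑_p -log (1 - 1/p) * p ^ (-δ)`, asymptotically equal to `log ζ(1 + δ)`. -/
noncomputable def twistedMertensSum (δ : ℝ) : ℝ :=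
  ∑' p : ℕ, if p.Prime then mertensWeight p * (p : ℝ) ^ (-δ) else 0

/-- The logarithm of the Euler factor at `p` of `ζ(1 + δ)`, and zero when `p` is not prime. -/
noncomputable def logEulerFactor (δ : ℝ) (p : ℕ) : ℝ :=
  if p.Prime then -Real.log (1 - (p : ℝ)⁻¹ * (p : ℝ) ^ (-δ)) else 0

lemma natCast_rpow_neg_le_one {p : ℕ} (hp : p.Prime) {δ : ℝ} (hδ : 0 ≤ δ) :
    (p : ℝ) ^ (-δ) ≤ 1 :=
  Real.rpow_le_one_of_one_le_of_nonpos (by exact_mod_cast hp.one_le) (by linarith)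

lemma inv_mul_rpow_neg_le_half {p : ℕ} (hp : p.Prime) {δ : ℝ} (hδ : 0 ≤ δ) :
    (p : ℝ)⁻¹ * (p : ℝ) ^ (-δ) ≤ 2⁻¹ :=
  (mul_le_of_le_one_right (by positivity) (natCast_rpow_neg_le_one hp hδ)).trans
    (inv_natCast_le_half hp.two_le)

lemma inv_mul_rpow_neg {p : ℕ} (hp : p.Prime) (δ : ℝ) :
    (p : ℝ)⁻¹ * (p : ℝ) ^ (-δ) = (p : ℝ) ^ (-(1 + δ)) := by
  have hp0 : (0 : ℝ) < p := by exact_mod_cast hp.pos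
  rw [← Real.rpow_neg_one, ← Real.rpow_add hp0]
  ring_nf

lemma summable_logEulerFactor {δ : ℝ} (hδ : 0 < δ) : Summable (logEulerFactor δ) := by
  have hs : Summable fun n : ℕ => 2 * (n : ℝ) ^ (-(1 + δ)) :=
    (Real.summable_nat_rpow.2 (by linarith)).mul_left 2
  refine Summable.of_nonneg_of_le (fun p => ?_) (fun p => ?_) hs
  · unfold logEulerFactor
    split_ifs with hp
    · exact le_trans (by positivity) (le_neg_log_one_sub (inv_mul_rpow_neg_le_half hp hδ.le))
    · rfl
  · unfold logEulerFactor
    split_ifs with hp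
    · rw [← inv_mul_rpow_neg hp]
      have h := inv_mul_rpow_neg_le_half hp hδ.le
      have h0 : 0 ≤ (p : ℝ)⁻¹ * (p : ℝ) ^ (-δ) := by positivity
      have := neg_log_one_sub_le h
      nlinarith
    · positivity

/-- The completely multiplicative function `n ↦ n ^ (-s)`. -/
noncomputable def rpowNegHom (s : ℝ) (hs : s ≠ 0) : ℕ →*₀ ℝ where
  toFun n := (n : ℝ) ^ (-s)
  map_zero' := by simp [Real.zero_rpow (neg_ne_zero.2 hs)]
  map_one' := by simp
  map_mul' m n := by
    push_cast
    exact Real.mul_rpow (by positivity) (by positivity)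

lemma tsum_logEulerFactor {δ : ℝ} (hδ : 0 < δ) :
    ∑' p, logEulerFactor δ p = Real.log (∑' n : ℕ, 1 / (n : ℝ) ^ (1 + δ)) := by
  have hs : Summable fun n : ℕ => (n : ℝ) ^ (-(1 + δ)) :=
    Real.summable_nat_rpow.2 (by linarith)
  have hprod := EulerProduct.eulerProduct_completely_multiplicative
    (f := rpowNegHom (1 + δ) (by positivity)) (by simpa [rpowNegHom] using hs.norm)
  have hpos : 0 < ∑' n : ℕ, rpowNegHom (1 + δ) (by positivity) n :=
    hs.tsum_pos (fun n => by positivity) 1 (by simp)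
  have hlog := (Real.continuousAt_log hpos.ne').tendsto.comp hprod
  have hsum := (summable_logEulerFactor hδ).hasSum.tendsto_sum_nat
  refine tendsto_nhds_unique hsum ?_
  convert hlog using 2 with n
  · rw [Function.comp_apply, Real.log_prod, Nat.primesBelow, Finset.sum_filter]
    · refine Finset.sum_congr rfl fun p _ => ?_
      unfold logEulerFactor
      split_ifs with hp
      · rw [inv_mul_rpow_neg hp, Real.log_inv]
        rfl
      · rfl
    · intro p hp
      have hp := (Nat.mem_primesBelow.1 hp).2
      have h := inv_mul_rpow_neg_le_half hp hδ.le
      rw [inv_mul_rpow_neg hp] at h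
      have : (0 : ℝ) < 1 - (p : ℝ) ^ (-(1 + δ)) := by linarith
      exact inv_ne_zero this.ne'
  · refine congrArg _ (tsum_congr fun n => ?_)
    rw [one_div, ← Real.rpow_neg (by positivity)]
    rfl

lemma summable_twistedMertensSum {δ : ℝ} (hδ : 0 < δ) :
    Summable fun p : ℕ => if p.Prime then mertensWeight p * (p : ℝ) ^ (-δ) else 0 := by
  have hs : Summable fun n : ℕ => 2 * (n : ℝ) ^ (-(1 + δ)) :=
    (Real.summable_nat_rpow.2 (by linarith)).mul_left 2
  refine Summable.of_nonneg_of_le (fun p => ?_) (fun p => ?_) hs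
  · split_ifs with hp
    · exact mul_nonneg (mertensWeight_nonneg hp.two_le) (by positivity)
    · rfl
  · split_ifs with hp
    · rw [← inv_mul_rpow_neg hp, ← mul_assoc]
      exact mul_le_mul_of_nonneg_right (mertensWeight_le_two_div hp.two_le) (by positivity)
    · positivity

lemma tendsto_tsum_logEulerFactor_sub :
    Tendsto (fun δ : ℝ => ∑' p : ℕ, (logEulerFactor δ p -
      if p.Prime then mertensWeight p * (p : ℝ) ^ (-δ) else 0)) (𝓝[>] 0) (𝓝 0) := by
  have hb : Summable fun p : ℕ => 2 * (1 / (p : ℝ) ^ 2) :=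
    (Real.summable_one_div_nat_pow.2 one_lt_two).mul_left 2
  have key := tendsto_tsum_of_dominated_convergence (𝓕 := 𝓝[>] (0 : ℝ))
    (f := fun (δ : ℝ) (p : ℕ) => logEulerFactor δ p -
      if p.Prime then mertensWeight p * (p : ℝ) ^ (-δ) else 0)
    (g := fun _ => 0) hb ?_ ?_
  · simpa using key
  · intro p
    by_cases hp : p.Prime
    · have hp0 : (0 : ℝ) < p := by exact_mod_cast hp.pos
      have ht : Tendsto (fun δ : ℝ => (p : ℝ) ^ (-δ)) (𝓝[>] 0) (𝓝 1) := by
        have : ContinuousAt (fun δ : ℝ => (p : ℝ) ^ (-δ)) 0 :=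
          (Real.continuousAt_const_rpow hp0.ne').comp continuousAt_neg
        have h := this.tendsto.mono_left (nhdsWithin_le_nhds (s := Set.Ioi 0))
        simpa using h
      have hne : 1 - (p : ℝ)⁻¹ * 1 ≠ 0 := by
        have := inv_natCast_le_half hp.two_le
        rw [mul_one]
        linarith
      have h1 := ((((ht.const_mul (p : ℝ)⁻¹).const_sub 1).log hne).neg).sub
        (ht.const_mul (mertensWeight p))
      simp only [logEulerFactor, hp, if_true]
      convert h1 using 2
      simp [mertensWeight]
    · simp [logEulerFactor, hp]
  · filter_upwards [self_mem_nhdsWithin] with δ hδ p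
    have hδ0 : (0 : ℝ) ≤ δ := (Set.mem_Ioi.1 hδ).le
    by_cases hp : p.Prime
    · simp only [logEulerFactor, hp, if_true]
      have ht1 := natCast_rpow_neg_le_one hp hδ0
      have ht0 : 0 ≤ (p : ℝ) ^ (-δ) := by positivity
      have hx := inv_mul_rpow_neg_le_half hp hδ0
      have h1 := neg_log_one_sub_le hx
      have h2 := le_neg_log_one_sub hx
      have h3 := mertensWeight_le hp.two_le
      have h4 := inv_le_mertensWeight hp.two_le
      have e : 1 / (p : ℝ) ^ 2 = ((p : ℝ)⁻¹) ^ 2 := by simp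
      have hx0 : 0 ≤ (p : ℝ)⁻¹ := by positivity
      rw [Real.norm_eq_abs, abs_le, e]
      set t := (p : ℝ) ^ (-δ)
      set x := (p : ℝ)⁻¹
      have h5 := mul_le_mul_of_nonneg_right h3 ht0
      have h6 := mul_le_mul_of_nonneg_right h4 ht0
      have h7 : (x * t) ^ 2 ≤ x ^ 2 := by
        have : x * t ≤ x := mul_le_of_le_one_right hx0 ht1
        gcongr
      have h8 : 2 * x ^ 2 * t ≤ 2 * x ^ 2 := mul_le_of_le_one_right (by positivity) ht1
      constructor <;> linarith
    · simp [logEulerFactor, hp]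

lemma tendsto_twistedMertensSum_add_log :
    Tendsto (fun δ : ℝ => twistedMertensSum δ + Real.log δ) (𝓝[>] 0) (𝓝 0) := by
  have hshift : Tendsto (fun δ : ℝ => 1 + δ) (𝓝[>] 0) (𝓝[>] 1) := by
    refine tendsto_nhdsWithin_iff.2 ⟨?_, ?_⟩
    · have : Tendsto (fun δ : ℝ => 1 + δ) (𝓝 0) (𝓝 (1 + 0)) := tendsto_id.const_add 1
      rw [add_zero] at this
      exact this.mono_left nhdsWithin_le_nhds
    · filter_upwards [self_mem_nhdsWithin] with δ hδ
      simpa using hδ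
  have hz := tendsto_sub_mul_tsum_nat_rpow.comp hshift
  have hlog := hz.log one_ne_zero
  have := hlog.sub tendsto_tsum_logEulerFactor_sub
  rw [Real.log_one, sub_zero] at this
  refine this.congr' ?_
  filter_upwards [self_mem_nhdsWithin] with δ hδ
  have hδ0 : 0 < δ := hδ
  have hs : Summable fun n : ℕ => 1 / (n : ℝ) ^ (1 + δ) :=
    Real.summable_one_div_nat_rpow.2 (by linarith)
  have hpos : 0 < ∑' n : ℕ, 1 / (n : ℝ) ^ (1 + δ) :=
    hs.tsum_pos (fun n => by positivity) 1 (by simp)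
  rw [(summable_logEulerFactor hδ0).tsum_sub (summable_twistedMertensSum hδ0),
    tsum_logEulerFactor hδ0, Function.comp_apply, add_sub_cancel_left,
    Real.log_mul hδ0.ne' hpos.ne', twistedMertensSum]
  ring

end ZetaNearOne

section MertensThird
open Topology

lemma summable_blockSum_mul_pow {r : ℝ} (hr0 : 0 ≤ r) (hr1 : r < 1) :
    Summable fun m => blockSum m * r ^ m := by
  obtain ⟨K, hK0, hK⟩ := blockSum_le
  refine Summable.of_nonneg_of_le (fun m => mul_nonneg (blockSum_nonneg m) (by positivity))
    (fun m => ?_) ((summable_geometric_of_lt_one hr0 hr1).mul_left K)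
  refine mul_le_mul_of_nonneg_right ((hK m).trans ?_) (by positivity)
  exact div_le_self hK0 (by linarith [(Nat.cast_nonneg m : (0 : ℝ) ≤ m)])

lemma four_rpow_neg_pow (δ : ℝ) (m : ℕ) :
    ((4 : ℝ) ^ (-δ)) ^ m = ((4 : ℝ) ^ m) ^ (-δ) := by
  rw [← Real.rpow_natCast, ← Real.rpow_natCast, ← Real.rpow_mul (by norm_num),
    ← Real.rpow_mul (by norm_num), mul_comm]

lemma tendsto_sum_primesLE_twisted {δ : ℝ} (hδ : 0 < δ) :
    Tendsto (fun M : ℕ => ∑ p ∈ Nat.primesLE (4 ^ M), mertensWeight p * (p : ℝ) ^ (-δ)) atTop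
      (𝓝 (twistedMertensSum δ)) := by
  have h := (tendsto_add_atTop_iff_nat 1).2
    (summable_twistedMertensSum hδ).hasSum.tendsto_sum_nat
  have h' : Tendsto (fun N : ℕ => ∑ p ∈ N.primesLE, mertensWeight p * (p : ℝ) ^ (-δ)) atTop
      (𝓝 (twistedMertensSum δ)) := by
    refine h.congr fun N => ?_
    rw [Nat.primesLE, Nat.primesBelow, Finset.sum_filter]
  exact h'.comp (tendsto_pow_atTop_atTop_of_one_lt (by norm_num))

lemma twistedMertensSum_le {δ : ℝ} (hδ : 0 < δ) :
    twistedMertensSum δ ≤ ∑' m, blockSum m * ((4 : ℝ) ^ (-δ)) ^ m := by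
  have hr1 : (4 : ℝ) ^ (-δ) < 1 := Real.rpow_lt_one_of_one_lt_of_neg (by norm_num) (by linarith)
  refine le_of_tendsto_of_tendsto' (tendsto_sum_primesLE_twisted hδ)
    (summable_blockSum_mul_pow (by positivity) hr1).hasSum.tendsto_sum_nat fun M => ?_
  rw [← sum_sum_primeBlock (fun p => mertensWeight p * (p : ℝ) ^ (-δ))]
  refine Finset.sum_le_sum fun m _ => ?_
  rw [blockSum, Finset.sum_mul]
  refine Finset.sum_le_sum fun p hp =>
    mul_le_mul_of_nonneg_left ?_ (mertensWeight_nonneg_of_mem hp)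
  rw [four_rpow_neg_pow]
  exact Real.rpow_le_rpow_of_nonpos (by positivity)
    (by exact_mod_cast (mem_primeBlock.1 hp).1.1.le) (by linarith)

lemma le_twistedMertensSum {δ : ℝ} (hδ : 0 < δ) :
    (4 : ℝ) ^ (-δ) * ∑' m, blockSum m * ((4 : ℝ) ^ (-δ)) ^ m ≤ twistedMertensSum δ := by
  have hr1 : (4 : ℝ) ^ (-δ) < 1 := Real.rpow_lt_one_of_one_lt_of_neg (by norm_num) (by linarith)
  refine le_of_tendsto_of_tendsto'
    ((summable_blockSum_mul_pow (by positivity) hr1).hasSum.tendsto_sum_nat.const_mul _)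
    (tendsto_sum_primesLE_twisted hδ) fun M => ?_
  rw [← sum_sum_primeBlock (fun p => mertensWeight p * (p : ℝ) ^ (-δ)), Finset.mul_sum]
  refine Finset.sum_le_sum fun m _ => ?_
  rw [mul_left_comm, ← pow_succ', blockSum, Finset.sum_mul]
  refine Finset.sum_le_sum fun p hp =>
    mul_le_mul_of_nonneg_left ?_ (mertensWeight_nonneg_of_mem hp)
  rw [four_rpow_neg_pow]
  exact Real.rpow_le_rpow_of_nonpos (by exact_mod_cast (mem_primeBlock.1 hp).2.pos)
    (by exact_mod_cast (mem_primeBlock.1 hp).1.2) (by linarith)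

lemma tendsto_one_sub_four_rpow_div :
    Tendsto (fun δ : ℝ => (1 - (4 : ℝ) ^ (-δ)) / δ) (𝓝[>] 0) (𝓝 (Real.log 4)) := by
  have h : HasDerivAt (fun δ : ℝ => (4 : ℝ) ^ (-δ)) (-Real.log 4) 0 := by
    have := (hasDerivAt_neg (0 : ℝ)).const_rpow (by norm_num : (0 : ℝ) < 4)
    simpa using this
  have h2 := (h.tendsto_slope_zero_right).neg
  rw [neg_neg] at h2
  refine h2.congr fun δ => ?_
  simp
  ring

lemma tendsto_four_rpow_neg :
    Tendsto (fun δ : ℝ => (4 : ℝ) ^ (-δ)) (𝓝[>] 0) (𝓝[<] 1) := by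
  refine tendsto_nhdsWithin_iff.2 ⟨?_, ?_⟩
  · have : ContinuousAt (fun δ : ℝ => (4 : ℝ) ^ (-δ)) 0 :=
      (Real.continuousAt_const_rpow (by norm_num)).comp continuousAt_neg
    have h := this.tendsto.mono_left (nhdsWithin_le_nhds (s := Set.Ioi 0))
    simpa using h
  · filter_upwards [self_mem_nhdsWithin] with δ hδ
    exact Real.rpow_lt_one_of_one_lt_of_neg (by norm_num) (by simpa using hδ)

lemma tendsto_mul_twistedMertensSum :
    Tendsto (fun δ : ℝ => (1 - (4 : ℝ) ^ (-δ)) * twistedMertensSum δ) (𝓝[>] 0) (𝓝 0) := by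
  have hid : Tendsto (fun δ : ℝ => δ) (𝓝[>] 0) (𝓝 0) := nhdsWithin_le_nhds
  have hlog : Tendsto (fun δ : ℝ => δ * Real.log δ) (𝓝[>] 0) (𝓝 0) := by
    simpa using (Real.continuous_mul_log.tendsto 0).mono_left
      (nhdsWithin_le_nhds (s := Set.Ioi 0))
  have h := tendsto_one_sub_four_rpow_div.mul
    ((hid.mul tendsto_twistedMertensSum_add_log).sub hlog)
  simp only [mul_zero, sub_zero] at h
  refine h.congr' ?_
  filter_upwards [self_mem_nhdsWithin] with δ hδ
  have : δ ≠ 0 := (Set.mem_Ioi.1 hδ).ne'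
  field_simp
  ring

lemma tendsto_blockSum_series :
    Tendsto (fun δ : ℝ => (4 : ℝ) ^ (-δ) * ∑' m, blockSum m * ((4 : ℝ) ^ (-δ)) ^ m
      + Real.log (1 - (4 : ℝ) ^ (-δ))) (𝓝[>] 0) (𝓝 (Real.log (Real.log 4))) := by
  have hdiff : Tendsto (fun δ : ℝ => (4 : ℝ) ^ (-δ) * ∑' m, blockSum m * ((4 : ℝ) ^ (-δ)) ^ m
      - twistedMertensSum δ) (𝓝[>] 0) (𝓝 0) := by
    have h := tendsto_mul_twistedMertensSum.neg
    rw [neg_zero] at h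
    refine tendsto_of_tendsto_of_tendsto_of_le_of_le' h tendsto_const_nhds ?_ ?_
    · filter_upwards [self_mem_nhdsWithin] with δ hδ
      have := mul_le_mul_of_nonneg_left (twistedMertensSum_le hδ)
        (by positivity : 0 ≤ (4 : ℝ) ^ (-δ))
      linarith
    · filter_upwards [self_mem_nhdsWithin] with δ hδ
      linarith [le_twistedMertensSum hδ]
  have h := (hdiff.add tendsto_twistedMertensSum_add_log).add
    (tendsto_one_sub_four_rpow_div.log log_four_pos.ne')
  simp only [zero_add] at h
  refine h.congr' ?_
  filter_upwards [self_mem_nhdsWithin] with δ hδ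
  have hδ0 : 0 < δ := hδ
  have hr1 : (4 : ℝ) ^ (-δ) < 1 := Real.rpow_lt_one_of_one_lt_of_neg (by norm_num) (by linarith)
  rw [Real.log_div (by linarith) hδ0.ne']
  ring

lemma tendsto_sum_blockSum_sub :
    Tendsto (fun M => ∑ m ∈ Finset.range M, (blockSum m - 1 / ((m : ℝ) + 1))) atTop
      (𝓝 (Real.log (Real.log 4))) := by
  obtain ⟨l, hl⟩ := cauchySeq_tendsto_of_complete cauchySeq_sum_blockSum_sub
  have habel := (Real.tendsto_tsum_powerSeries_nhdsWithin_lt hl).comp tendsto_four_rpow_neg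
  have hone := tendsto_nhds_of_tendsto_nhdsWithin tendsto_four_rpow_neg
  have hmul := hone.mul habel
  rw [one_mul] at hmul
  have hl' : l = Real.log (Real.log 4) := by
    refine tendsto_nhds_unique (hmul.congr' ?_) tendsto_blockSum_series
    filter_upwards [self_mem_nhdsWithin] with δ hδ
    have hr1 : (4 : ℝ) ^ (-δ) < 1 :=
      Real.rpow_lt_one_of_one_lt_of_neg (by norm_num) (by simpa using hδ)
    have hr0 : 0 < (4 : ℝ) ^ (-δ) := by positivity
    rw [Function.comp_apply]
    set r := (4 : ℝ) ^ (-δ)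
    have hF := (summable_blockSum_mul_pow hr0.le hr1).hasSum.mul_left r
    have hL := Real.hasSum_pow_div_log_of_abs_lt_one (x := r) (by rwa [abs_of_pos hr0])
    have hsub := hF.sub hL
    rw [sub_neg_eq_add] at hsub
    rw [← tsum_mul_left, ← hsub.tsum_eq]
    refine tsum_congr fun m => ?_
    rw [pow_succ]
    ring
  rwa [hl'] at hl

/-- **Mertens' third theorem** along the powers of `4`. -/
theorem tendsto_mertens_product :
    Tendsto (fun k : ℕ => (∏ p ∈ Nat.primesLE (4 ^ k), (1 - (p : ℝ)⁻¹)) *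
      (Real.exp Real.eulerMascheroniConstant * Real.log (4 ^ k))) atTop (𝓝 1) := by
  have h := tendsto_sum_blockSum_sub.add Real.tendsto_harmonic_sub_log
  have h2 := (((h.sub_const (Real.log (Real.log 4))).sub_const
    Real.eulerMascheroniConstant).neg).rexp
  rw [show -(Real.log (Real.log 4) + Real.eulerMascheroniConstant - Real.log (Real.log 4)
    - Real.eulerMascheroniConstant) = 0 by ring, Real.exp_zero] at h2
  refine h2.congr' ?_
  filter_upwards [eventually_gt_atTop 0] with k hk
  have hk0 : (0 : ℝ) < k := by exact_mod_cast hk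
  have hH : ∑ m ∈ Finset.range k, 1 / ((m : ℝ) + 1) = (harmonic k : ℝ) := by
    simp [harmonic]
  have hW : ∑ m ∈ Finset.range k, blockSum m = ∑ p ∈ Nat.primesLE (4 ^ k), mertensWeight p :=
    sum_sum_primeBlock mertensWeight k
  have hP : ∏ p ∈ Nat.primesLE (4 ^ k), (1 - (p : ℝ)⁻¹)
      = Real.exp (-∑ p ∈ Nat.primesLE (4 ^ k), mertensWeight p) := by
    rw [← Finset.sum_neg_distrib, Real.exp_sum]
    refine Finset.prod_congr rfl fun p hp => ?_
    have := inv_natCast_le_half (Nat.mem_primesLE.1 hp).2.two_le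
    rw [mertensWeight, neg_neg, Real.exp_log (by linarith)]
  have hL : Real.log ((4 : ℝ) ^ k) = Real.exp (Real.log k + Real.log (Real.log 4)) := by
    rw [Real.exp_add, Real.exp_log hk0, Real.exp_log log_four_pos, Real.log_pow]
  rw [Finset.sum_sub_distrib, hH, hW, hP, hL, ← Real.exp_add, ← Real.exp_add]
  congr 1
  ring

end MertensThird

lemma card_coprime_Ico (P q s : ℕ) :
    ((Finset.Ico s (s + P * q)).filter (fun a => P.Coprime a)).card = q * P.totient := by
  induction q with
  | zero => simp
  | succ q ih =>
    have h : Finset.Ico s (s + P * (q + 1)) =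
        Finset.Ico s (s + P * q) ∪ Finset.Ico (s + P * q) (s + P * q + P) := by
      rw [Finset.Ico_union_Ico_eq_Ico (by omega) (by omega)]
      congr 1
      ring
    rw [h, Finset.filter_union, Finset.card_union_of_disjoint, ih,
      Nat.filter_coprime_Ico_eq_totient]
    · ring
    · exact Finset.disjoint_filter_filter (Finset.Ico_disjoint_Ico_consecutive _ _ _)

/-- The product of the primes up to `Y` that divide `z`. -/
def smallRadical (Y z : ℕ) : ℕ := ∏ p ∈ z.primeFactors.filter (· ≤ Y), p

lemma smallRadical_dvd (Y z : ℕ) : smallRadical Y z ∣ z :=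
  (Finset.prod_dvd_prod_of_subset _ _ _ (Finset.filter_subset _ _)).trans
    (Nat.prod_primeFactors_dvd z)

lemma primeFactors_smallRadical (Y z : ℕ) :
    (smallRadical Y z).primeFactors = z.primeFactors.filter (· ≤ Y) :=
  Nat.primeFactors_prod fun _ hp =>
    Nat.prime_of_mem_primeFactors (Finset.mem_of_mem_filter _ hp)

lemma lt_of_coprime_smallRadical {Y z a p : ℕ} (hz : 0 < z)
    (h : (smallRadical Y z).Coprime a) (hp : p.Prime) (hd : p ∣ Nat.gcd a z) : Y < p := by
  by_contra! hle
  have hmem : p ∈ z.primeFactors.filter (· ≤ Y) :=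
    Finset.mem_filter.2
      ⟨Nat.mem_primeFactors.2 ⟨hp, hd.trans (Nat.gcd_dvd_right _ _), hz.ne'⟩, hle⟩
  have h1 : p ∣ smallRadical Y z := Finset.dvd_prod_of_mem _ hmem
  exact hp.one_lt.ne' (Nat.eq_one_of_dvd_coprimes h h1 (hd.trans (Nat.gcd_dvd_left _ _)))

lemma prod_primesLE_mul_le_card (Y : ℕ) {z : ℕ} (hz : 0 < z) (s : ℕ) :
    (∏ p ∈ Y.primesLE, (1 - (p : ℝ)⁻¹)) * z ≤
      ((Finset.Ico s (s + z)).filter (fun a => (smallRadical Y z).Coprime a)).card := by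
  obtain ⟨q, hq⟩ := smallRadical_dvd Y z
  have hcard := card_coprime_Ico (smallRadical Y z) q s
  rw [← hq] at hcard
  rw [hcard]
  have htot : ((smallRadical Y z).totient : ℝ) =
      smallRadical Y z * ∏ p ∈ z.primeFactors.filter (· ≤ Y), (1 - (p : ℝ)⁻¹) := by
    have := Nat.totient_eq_mul_prod_factors (smallRadical Y z)
    rw [primeFactors_smallRadical] at this
    have h := congrArg (fun x : ℚ => (x : ℝ)) this
    push_cast at h
    exact h
  have hsub : z.primeFactors.filter (· ≤ Y) ⊆ Y.primesLE := fun p hp => by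
    rw [Finset.mem_filter] at hp
    exact Nat.mem_primesLE.2 ⟨hp.2, Nat.prime_of_mem_primeFactors hp.1⟩
  have hprod : ∏ p ∈ Y.primesLE, (1 - (p : ℝ)⁻¹) ≤
      ∏ p ∈ z.primeFactors.filter (· ≤ Y), (1 - (p : ℝ)⁻¹) := by
    refine Finset.prod_le_prod_of_subset_of_le_one hsub (fun p hp => ?_) fun p hp _ => ?_
    · have := inv_natCast_le_half (Nat.mem_primesLE.1 hp).2.two_le
      linarith
    · have : (0 : ℝ) ≤ (p : ℝ)⁻¹ := by positivity
      linarith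
  have hz' : (z : ℝ) = smallRadical Y z * q := by exact_mod_cast hq
  calc _ ≤ (∏ p ∈ z.primeFactors.filter (· ≤ Y), (1 - (p : ℝ)⁻¹)) * z := by gcongr
    _ = _ := by
      push_cast
      rw [htot, hz']
      ring

/-- Intervals `((a + u) / z, (a + v) / z)` with `a ∈ A` are disjoint when `v ≤ u + 1`, so their lengths add up. -/
lemma volume_biUnion_Ioo (A : Finset ℕ) {z : ℕ} (hz : 0 < z) {u v : ℝ} (huv : v ≤ u + 1) :
    volume (⋃ a ∈ A, Set.Ioo (((a : ℝ) + u) / z) ((a + v) / z)) =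
      A.card * ENNReal.ofReal ((v - u) / z) := by
  have hz0 : (0 : ℝ) < z := by exact_mod_cast hz
  rw [measure_biUnion_finset]
  · rw [← nsmul_eq_mul, ← Finset.sum_const]
    refine Finset.sum_congr rfl fun a _ => ?_
    rw [Real.volume_Ioo]
    congr 1
    ring
  · intro a _ b _ hab
    rw [Function.onFun, Set.disjoint_left]
    rintro x ⟨h1, h2⟩ ⟨h3, h4⟩
    rw [div_lt_iff₀ hz0] at h1 h3
    rw [lt_div_iff₀ hz0] at h2 h4
    rcases lt_or_gt_of_ne hab with h | h
    · have : (a : ℝ) + 1 ≤ b := by exact_mod_cast h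
      linarith
    · have : (b : ℝ) + 1 ≤ a := by exact_mod_cast h
      linarith
  · exact fun _ _ => measurableSet_Ioo

lemma psi_pos (n : ℕ) : 0 < psi n := by
  unfold psi
  positivity

lemma psi_lt_half {n : ℕ} (hn : 0 < n) : psi n < 1 / 2 := by
  unfold psi
  have : (1 : ℝ) ≤ n := by exact_mod_cast hn
  exact one_div_lt_one_div_of_lt (by norm_num) (by linarith)

lemma volume_Sstar_ge {z : ℕ → ℕ} {k n : ℕ} (hn : 0 < n) (hz : 0 < z n) :
    ENNReal.ofReal (2 * psi n * ∏ p ∈ Nat.primesLE (4 ^ k), (1 - (p : ℝ)⁻¹)) ≤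
      volume (Sstar z k n) := by
  set W := ∏ p ∈ Nat.primesLE (4 ^ k), (1 - (p : ℝ)⁻¹) with hW
  set A : ℕ → Finset ℕ := fun s => (Finset.Ico s (s + z n)).filter
    (fun a => (smallRadical (4 ^ k) (z n)).Coprime a) with hA
  have hz0 : (0 : ℝ) < z n := by exact_mod_cast hz
  have hψ0 := psi_pos n
  have hψ := psi_lt_half hn
  set R := ⋃ a ∈ A 0, Set.Ioo (((a : ℝ) + 0) / z n) ((a + psi n) / z n) with hR
  set L := ⋃ a ∈ A 1, Set.Ioo (((a : ℝ) + -psi n) / z n) ((a + 0) / z n) with hL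
  have hmeasure : ∀ s, ENNReal.ofReal (psi n * W) ≤
      (A s).card * ENNReal.ofReal (psi n / z n) := fun s => by
    rw [← ENNReal.ofReal_natCast, ← ENNReal.ofReal_mul (by positivity)]
    refine ENNReal.ofReal_le_ofReal ?_
    rw [mul_div_assoc', le_div_iff₀ hz0]
    have := mul_le_mul_of_nonneg_left (prod_primesLE_mul_le_card (4 ^ k) hz s) hψ0.le
    linarith
  have hdisj : Disjoint R L := by
    rw [Set.disjoint_left]
    intro x hx hx'
    simp only [hR, hL, Set.mem_iUnion, Set.mem_Ioo, div_lt_iff₀ hz0, lt_div_iff₀ hz0] at hx hx'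
    obtain ⟨a, -, h1, h2⟩ := hx
    obtain ⟨b, -, h3, h4⟩ := hx'
    rcases lt_or_ge a b with h | h
    · have : (a : ℝ) + 1 ≤ b := by exact_mod_cast h
      linarith
    · have : (b : ℝ) ≤ a := by exact_mod_cast h
      linarith
  have hRS : R ⊆ Sstar z k n := by
    intro x hx
    simp only [hR, Set.mem_iUnion] at hx
    obtain ⟨a, ha, h1, h2⟩ := hx
    simp only [hA, Finset.mem_filter, Finset.mem_Ico] at ha
    have haz : (a : ℝ) + 1 ≤ z n := by exact_mod_cast (by omega : a + 1 ≤ z n)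
    refine ⟨⟨le_trans (by positivity) h1.le, h2.le.trans ((div_le_one hz0).2 (by linarith))⟩, ?_⟩
    simp only [Set.mem_iUnion]
    refine ⟨a, by omega, fun p hp hd => lt_of_coprime_smallRadical hz ha.2 hp hd, ?_, ?_⟩
    · rw [add_zero] at h1
      have : 0 < psi n / z n := by positivity
      linarith
    · rwa [← add_div]
  have hLS : L ⊆ Sstar z k n := by
    intro x hx
    simp only [hL, Set.mem_iUnion] at hx
    obtain ⟨a, ha, h1, h2⟩ := hx
    simp only [hA, Finset.mem_filter, Finset.mem_Ico] at ha
    have haz : (a : ℝ) ≤ z n := by exact_mod_cast (by omega : a ≤ z n)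
    have ha1 : (1 : ℝ) ≤ a := by exact_mod_cast ha.1.1
    refine ⟨⟨le_trans (div_nonneg (by linarith) hz0.le) h1.le,
      h2.le.trans ((div_le_one hz0).2 (by linarith))⟩, ?_⟩
    simp only [Set.mem_iUnion]
    refine ⟨a, by omega, fun p hp hd => lt_of_coprime_smallRadical hz ha.2 hp hd, ?_, ?_⟩
    · rwa [← sub_div, sub_eq_add_neg]
    · rw [add_zero] at h2
      have : 0 < psi n / z n := by positivity
      linarith
  have hLm : MeasurableSet L :=
    Finset.measurableSet_biUnion _ fun _ _ => measurableSet_Ioo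
  have hW0 : 0 ≤ W := Finset.prod_nonneg fun p hp => by
    have := inv_natCast_le_half (Nat.mem_primesLE.1 hp).2.two_le
    linarith
  calc ENNReal.ofReal (2 * psi n * W)
      = ENNReal.ofReal (psi n * W) + ENNReal.ofReal (psi n * W) := by
        rw [← ENNReal.ofReal_add (by positivity) (by positivity)]
        congr 1
        ring
    _ ≤ volume R + volume L := by
        rw [hR, hL, volume_biUnion_Ioo _ hz (by linarith), volume_biUnion_Ioo _ hz (by linarith)]
        rw [sub_zero, zero_sub, neg_neg]
        exact add_le_add (hmeasure 0) (hmeasure 1)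
    _ = volume (R ∪ L) := (measure_union hdisj hLm).symm
    _ ≤ _ := measure_mono (Set.union_subset hRS hLS)

theorem stmt15 (ε : ℝ) (hε : 0 < ε) :
    ∃ k₀ : ℕ, ∀ k : ℕ, Even k → k₀ ≤ k →
      ∀ z : ℕ → ℕ, Function.Injective z → (∀ n, 0 < z n) →
        ∀ n : ℕ, 2 ^ (k / 2) < n → n ≤ 2 ^ k →
          ENNReal.ofReal
              ((1 - ε) / ((n : ℝ) * Real.exp Real.eulerMascheroniConstant *
                Real.log (4 ^ k))) ≤
            volume (Sstar z k n) := by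
  have hlim := (tendsto_const_nhds (x := (1 : ℝ))).sub tendsto_one_div_add_atTop_nhds_zero_nat
    |>.mul tendsto_mertens_product
  rw [sub_zero, one_mul] at hlim
  obtain ⟨k₁, hk₁⟩ := eventually_atTop.1
    (hlim.eventually (lt_mem_nhds (by linarith : 1 - ε < 1)))
  refine ⟨max k₁ 1, fun k hk hkk z _ hz n hn _ => ?_⟩
  have hQ := hk₁ k ((le_max_left _ _).trans hkk)
  have hk1 : 1 ≤ k := (le_max_right _ _).trans hkk
  have hn0 : 0 < n := Nat.zero_lt_of_lt hn
  refine le_trans (ENNReal.ofReal_le_ofReal ?_) (volume_Sstar_ge hn0 (hz n))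
  have hnR : (0 : ℝ) < n := by exact_mod_cast hn0
  have hlog : 0 < Real.log ((4 : ℝ) ^ k) := Real.log_pos (one_lt_pow₀ (by norm_num) (by omega))
  set W := ∏ p ∈ Nat.primesLE (4 ^ k), (1 - (p : ℝ)⁻¹)
  have hW0 : 0 ≤ W := Finset.prod_nonneg fun p hp => by
    have := inv_natCast_le_half (Nat.mem_primesLE.1 hp).2.two_le
    linarith
  have hkn : (k : ℝ) + 1 ≤ 2 * n + 1 := by
    have h1 : k / 2 < 2 ^ (k / 2) := Nat.lt_two_pow_self
    exact_mod_cast (by omega : k + 1 ≤ 2 * n + 1)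
  have hfac : 1 - 1 / ((k : ℝ) + 1) ≤ 2 * psi n * n := by
    have h1 : 2 * psi n * n = 1 - 1 / (2 * (n : ℝ) + 1) := by
      unfold psi
      field_simp
      ring
    rw [h1]
    have := one_div_le_one_div_of_le (by positivity : (0 : ℝ) < k + 1) hkn
    linarith
  rw [div_le_iff₀ (by positivity)]
  calc 1 - ε ≤ _ := hQ.le
    _ ≤ 2 * psi n * n * (W * (Real.exp Real.eulerMascheroniConstant * Real.log (4 ^ k))) := by
        gcongr
    _ = _ := by ring
end
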